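/- Let G and H be one-ended right-angled Artin groups, and assume that some maximal join parabolic subgroup of G has trivial center. Let G ↷ (X,μ) and H ↷ (Y,ν) be free irreducible measure-preserving actions on standard probability spaces, and suppose they are stably orbit equivalent through a stable orbit equivalence f : U → V (U ⊆ X, V ⊆ Y of positive measure). Then κ(f) = 1, every SOE cocycle associated to f is cohomologous to the cocycle (g,x) ↦ α(g) for some group isomorphism α : G → H, and the actions are conjugate through a group isomorphism α : G → H. -/

import Mathlib

open MeasureTheory
open scoped ENNReal Pointwise symmDiff

namespace OEPaper

/- ## Right-angled Artin groups and graph combinatorics -/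

/-- The commutation relations defining the right-angled Artin group of a graph. -/
def raagRels {V : Type} (Γ : SimpleGraph V) : Set (FreeGroup V) :=
  {r | ∃ u v : V, Γ.Adj u v ∧
    r = FreeGroup.of u * FreeGroup.of v * (FreeGroup.of u)⁻¹ * (FreeGroup.of v)⁻¹}

/-- The right-angled Artin group of a simple graph `Γ`. -/
abbrev RAAG {V : Type} (Γ : SimpleGraph V) : Type := PresentedGroup (raagRels Γ)

/-- The standard generator of `RAAG Γ` associated to a vertex. -/
def gen {V : Type} (Γ : SimpleGraph V) (v : V) : RAAG Γ := PresentedGroup.of v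

/-- The standard subgroup associated to (the full subgraph spanned by) a set of vertices. -/
def standardSub {V : Type} (Γ : SimpleGraph V) (S : Set V) : Subgroup (RAAG Γ) :=
  Subgroup.closure (gen Γ '' S)

/-- Conjugate of a subgroup. -/
def conjSub {G : Type} [Group G] (g : G) (P : Subgroup G) : Subgroup G :=
  Subgroup.map (MulAut.conj g).toMonoidHom P

/-- Parabolic subgroups: conjugates of standard subgroups. -/
def IsParabolic {V : Type} (Γ : SimpleGraph V) (P : Subgroup (RAAG Γ)) : Prop :=
  ∃ (g : RAAG Γ) (S : Set V), P = conjSub g (standardSub Γ S)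

/-- The "orthogonal" of a set of vertices: vertices outside `S` adjacent to every vertex of `S`. -/
def perp {V : Type} (Γ : SimpleGraph V) (S : Set V) : Set V :=
  {v : V | v ∉ S ∧ ∀ u ∈ S, Γ.Adj v u}

/-- `S` spans a join subgraph of `Γ`. -/
def IsJoin {V : Type} (Γ : SimpleGraph V) (S : Set V) : Prop :=
  ∃ S₁ S₂ : Set V, S₁.Nonempty ∧ S₂.Nonempty ∧ S₁ ∪ S₂ = S ∧ ∀ u ∈ S₁, ∀ v ∈ S₂, Γ.Adj u v

/-- `S` spans a maximal join subgraph of `Γ`. -/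
def IsMaxJoin {V : Type} (Γ : SimpleGraph V) (S : Set V) : Prop :=
  IsJoin Γ S ∧ ∀ T : Set V, IsJoin Γ T → S ⊆ T → S = T

/-- Join parabolic subgroups. -/
def IsJoinParabolic {V : Type} (Γ : SimpleGraph V) (P : Subgroup (RAAG Γ)) : Prop :=
  ∃ (g : RAAG Γ) (S : Set V), IsJoin Γ S ∧ P = conjSub g (standardSub Γ S)

/-- Maximal join parabolic subgroups. -/
def IsMaxJoinParabolic {V : Type} (Γ : SimpleGraph V) (P : Subgroup (RAAG Γ)) : Prop :=
  ∃ (g : RAAG Γ) (S : Set V), IsMaxJoin Γ S ∧ P = conjSub g (standardSub Γ S)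

/-- The center of a subgroup `P`, as a subset of the ambient group. -/
def subCenter {G : Type} [Group G] (P : Subgroup G) : Set G :=
  {x : G | x ∈ P ∧ ∀ y ∈ P, x * y = y * x}

/-- The commutation graph of a subset `S` of a group. -/
def chainCommGraph {G : Type} [Group G] (S : Set G) : SimpleGraph S :=
  SimpleGraph.fromRel fun a b => Commute (a : G) (b : G)

/-- A generating set is chain-commuting if its commutation graph is connected. -/
def IsChainCommuting {G : Type} [Group G] (S : Set G) : Prop :=
  (chainCommGraph S).Connected

/-- Amenability: existence of a finitely additive left-invariant probability
measure defined on all subsets. -/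
def IsAmenable (G : Type) [Group G] : Prop :=
  ∃ m : Set G → ℝ, m Set.univ = 1 ∧ (∀ A : Set G, 0 ≤ m A) ∧
    (∀ A B : Set G, Disjoint A B → m (A ∪ B) = m A + m B) ∧
    ∀ (g : G) (A : Set G), m ((g * ·) '' A) = m A

/-- ICC groups: every nontrivial element has an infinite conjugacy class. -/
def IsICC (G : Type) [Group G] : Prop :=
  ∀ g : G, g ≠ 1 → {h : G | ∃ c : G, c * g * c⁻¹ = h}.Infinite

/-- The root-conjugation property. -/
def RootConjugationProperty (H : Type) [Group H] : Prop :=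
  ∀ (h₁ h₂ : H) (k : ℕ), 0 < k → Commute h₁ (h₂ ^ k) → Commute h₁ h₂

/- ## Measured dynamics -/

/-- Measure-preserving action by measurable automorphisms. -/
def PmpAction (G : Type) [Group G] (X : Type) [MeasurableSpace X] [MulAction G X]
    (μ : Measure X) : Prop :=
  ∀ g : G, MeasurePreserving (fun x : X => g • x) μ μ

/-- Essentially free action. -/
def FreeAction (G : Type) [Group G] (X : Type) [MeasurableSpace X] [MulAction G X]
    (μ : Measure X) : Prop :=
  ∀ g : G, g ≠ 1 → μ {x : X | g • x = x} = 0

/-- Ergodic action of a group. -/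
def ErgodicAction (G : Type) [Group G] (X : Type) [MeasurableSpace X] [MulAction G X]
    (μ : Measure X) : Prop :=
  ∀ A : Set X, MeasurableSet A → (∀ g : G, (fun x : X => g • x) ⁻¹' A = A) →
    μ A = 0 ∨ μ A = 1

/-- Ergodicity of the action of a subgroup. -/
def ErgodicSubgroup (G : Type) [Group G] (A : Subgroup G) (X : Type) [MeasurableSpace X]
    [MulAction G X] (μ : Measure X) : Prop :=
  ∀ s : Set X, MeasurableSet s → (∀ a ∈ A, (fun x : X => a • x) ⁻¹' s = s) →
    μ s = 0 ∨ μ s = 1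

/-- Irreducible action of a right-angled Artin group: for some identification of the group
with a `RAAG Δ`, every standard generator acts ergodically. -/
def IrreducibleAction (G : Type) [Group G] (X : Type) [MeasurableSpace X] [MulAction G X]
    (μ : Measure X) : Prop :=
  ∃ (n : ℕ) (Δ : SimpleGraph (Fin n)) (e : RAAG Δ ≃* G),
    ∀ v : Fin n, Ergodic (fun x : X => e (gen Δ v) • x) μ

/-- A measure space isomorphism (mod null sets): a measurable measure-preserving map
admitting an a.e. two-sided measurable inverse. -/
def MeasIso {A : Type} {B : Type} [MeasurableSpace A] [MeasurableSpace B]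
    (μ : Measure A) (ν : Measure B) (F : A → B) : Prop :=
  Measurable F ∧ MeasurePreserving F μ ν ∧
    ∃ F' : B → A, Measurable F' ∧ (∀ᵐ a ∂μ, F' (F a) = a) ∧ ∀ᵐ b ∂ν, F (F' b) = b

/-- Conjugacy of two actions through a given group isomorphism. -/
def ConjugateVia (G : Type) [Group G] (X : Type) [MeasurableSpace X] [MulAction G X]
    (H : Type) [Group H] (Y : Type) [MeasurableSpace Y] [MulAction H Y]
    (μ : Measure X) (ν : Measure Y) (α : G ≃* H) : Prop :=
  ∃ F : X → Y, MeasIso μ ν F ∧ ∀ g : G, ∀ᵐ x ∂μ, F (g • x) = α g • F x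

/-- Conjugacy of two actions. -/
def ConjugateActions (G : Type) [Group G] (X : Type) [MeasurableSpace X] [MulAction G X]
    (H : Type) [Group H] (Y : Type) [MeasurableSpace Y] [MulAction H Y]
    (μ : Measure X) (ν : Measure Y) : Prop :=
  ∃ α : G ≃* H, ConjugateVia G X H Y μ ν α

/-- Orbit equivalence of two actions. -/
def OrbitEquivalent (G : Type) [Group G] (X : Type) [MeasurableSpace X] [MulAction G X]
    (H : Type) [Group H] (Y : Type) [MeasurableSpace Y] [MulAction H Y]
    (μ : Measure X) (ν : Measure Y) : Prop :=
  ∃ F : X → Y, MeasIso μ ν F ∧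
    ∀ᵐ x ∂μ, F '' MulAction.orbit G x = MulAction.orbit H (F x)

/-- Measurable cocycle for an action, with values in a (discrete) group `H`. -/
def IsCocycle (G : Type) [Group G] (X : Type) [MeasurableSpace X] [MulAction G X]
    (H : Type) [Group H] (μ : Measure X) (c : G → X → H) : Prop :=
  (∀ (g : G) (h : H), MeasurableSet {x : X | c g x = h}) ∧
    ∀ g g' : G, ∀ᵐ x ∂μ, c (g * g') x = c g (g' • x) * c g' x

/-- Cohomology of cocycles. -/
def Cohomologous (G : Type) [Group G] (X : Type) [MeasurableSpace X] [MulAction G X]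
    (H : Type) [Group H] (μ : Measure X) (c c' : G → X → H) : Prop :=
  ∃ φ : X → H, (∀ h : H, MeasurableSet {x : X | φ x = h}) ∧
    ∀ g : G, ∀ᵐ x ∂μ, c' g x = φ (g • x) * c g x * (φ x)⁻¹

/-- A stable orbit equivalence between two actions: a measure-scaling Borel isomorphism
between positive measure subsets, matching orbits. -/
structure StableOE (G : Type) [Group G] (X : Type) [MeasurableSpace X] [MulAction G X]
    (H : Type) [Group H] (Y : Type) [MeasurableSpace Y] [MulAction H Y]
    (μ : Measure X) (ν : Measure Y) where
  U : Set X
  V : Set Y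
  measU : MeasurableSet U
  measV : MeasurableSet V
  posU : 0 < μ U
  posV : 0 < ν V
  toFun : X → Y
  invFun : Y → X
  meas_toFun : Measurable toFun
  meas_invFun : Measurable invFun
  maps : Set.MapsTo toFun U V
  maps_inv : Set.MapsTo invFun V U
  left_inv : ∀ x ∈ U, invFun (toFun x) = x
  right_inv : ∀ y ∈ V, toFun (invFun y) = y
  pushforward : ∀ B : Set Y, B ⊆ V → MeasurableSet B →
    (μ U)⁻¹ * μ (U ∩ toFun ⁻¹' B) = (ν V)⁻¹ * ν B
  orbit_eq : ∀ᵐ x ∂μ, x ∈ U →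
    toFun '' (MulAction.orbit G x ∩ U) = MulAction.orbit H (toFun x) ∩ V

namespace StableOE

variable {G : Type} [Group G] {X : Type} [MeasurableSpace X] [MulAction G X]
  {H : Type} [Group H] {Y : Type} [MeasurableSpace Y] [MulAction H Y]
  {μ : Measure X} {ν : Measure Y}

/-- The compression constant of a stable orbit equivalence. -/
noncomputable def kappa (f : StableOE G X H Y μ ν) : ℝ≥0∞ := ν f.V / μ f.U

/-- `c` is an SOE cocycle associated to the stable orbit equivalence `f`. -/
def IsSOECocycle (f : StableOE G X H Y μ ν) (c : G → X → H) : Prop :=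
  IsCocycle G X H μ c ∧
    ∃ p : X → X, Measurable p ∧
      (∀ᵐ x ∂μ, p x ∈ f.U ∧ p x ∈ MulAction.orbit G x) ∧
      ∀ g : G, ∀ᵐ x ∂μ, f.toFun (p (g • x)) = c g x • f.toFun (p x)

end StableOE

/-- Mildly mixing action. -/
def MildlyMixing (H : Type) [Group H] (Y : Type) [MeasurableSpace Y] [MulAction H Y]
    (ν : Measure Y) : Prop :=
  ∀ A : Set Y, MeasurableSet A → ν A ≠ 0 → ν A ≠ ν Set.univ →
    ∀ u : ℕ → H, Function.Injective u →
      0 < Filter.atTop.liminf fun n => ν (((u n • ·) '' A) ∆ A)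

/- ## Virtual conjugacy -/

/-- `(Z, qact, ρ)` together with `π : X → Z` is a model for the quotient of the action
`G ↷ (X, μ)` by the normal subgroup `F`, with the induced `G ⧸ F`-action. -/
def IsQuotientModel {G : Type} [Group G] (F : Subgroup G) [F.Normal]
    {X : Type} [MeasurableSpace X] [MulAction G X] (μ : Measure X)
    {Z : Type} [MeasurableSpace Z] (qact : G ⧸ F →* Equiv.Perm Z) (ρ : Measure Z)
    (π : X → Z) : Prop :=
  Measurable π ∧ Measure.map π μ = ρ ∧
    (∀ (g : G) (x : X), π (g • x) = qact (QuotientGroup.mk g) (π x)) ∧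
    ∀ x y : X, π x = π y ↔ ∃ f ∈ F, f • x = y

/-- The action `act : Q →* Perm Z` on `(Z, ρ)` is (isomorphic to) the action induced from the
action `act' : K →* Perm X'` of the finite-index subgroup `K` on `(X', μ')`. -/
def InducedFrom {Q : Type} [Group Q] (K : Subgroup Q)
    {Z : Type} [MeasurableSpace Z] (act : Q →* Equiv.Perm Z) (ρ : Measure Z)
    {X' : Type} [MeasurableSpace X'] (act' : ↥K →* Equiv.Perm X') (μ' : Measure X') : Prop :=
  letI : MeasurableSpace (Q ⧸ K) := ⊤
  ∃ σ : Q ⧸ K → Q, (∀ k : Q ⧸ K, (QuotientGroup.mk (σ k) : Q ⧸ K) = k) ∧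
    ∃ Φ : X' × (Q ⧸ K) → Z,
      MeasIso (Measure.sum fun k : Q ⧸ K =>
        (K.index : ℝ≥0∞)⁻¹ • Measure.map (fun x' : X' => (x', k)) μ') ρ Φ ∧
      ∀ (g : Q) (k : Q ⧸ K) (h : ↥K), (h : Q) = (σ (g • k))⁻¹ * g * σ k →
        ∀ᵐ x' ∂μ', Φ (act' h x', g • k) = act g (Φ (x', k))

/-- Data witnessing that two probability measure-preserving actions are virtually
conjugate. -/
structure VirtualConjugacyData
    (G₁ : Type) [Group G₁] (X₁ : Type) [MeasurableSpace X₁] [MulAction G₁ X₁] (μ₁ : Measure X₁)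
    (G₂ : Type) [Group G₂] (X₂ : Type) [MeasurableSpace X₂] [MulAction G₂ X₂] (μ₂ : Measure X₂) :
    Type 1 where
  F₁ : Subgroup G₁
  F₂ : Subgroup G₂
  normal₁ : F₁.Normal
  normal₂ : F₂.Normal
  finite₁ : Finite F₁
  finite₂ : Finite F₂
  K₁ : Subgroup (G₁ ⧸ F₁)
  K₂ : Subgroup (G₂ ⧸ F₂)
  finiteIndex₁ : K₁.FiniteIndex
  finiteIndex₂ : K₂.FiniteIndex
  X'₁ : Type
  X'₂ : Type
  mX'₁ : MeasurableSpace X'₁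
  mX'₂ : MeasurableSpace X'₂
  μ'₁ : Measure X'₁
  μ'₂ : Measure X'₂
  prob₁ : IsProbabilityMeasure μ'₁
  prob₂ : IsProbabilityMeasure μ'₂
  act₁ : ↥K₁ →* Equiv.Perm X'₁
  act₂ : ↥K₂ →* Equiv.Perm X'₂
  pmp₁ : ∀ k : ↥K₁, MeasurePreserving (act₁ k) μ'₁ μ'₁
  pmp₂ : ∀ k : ↥K₂, MeasurePreserving (act₂ k) μ'₂ μ'₂
  θ : ↥K₁ ≃* ↥K₂
  conjF : X'₁ → X'₂
  conjF_iso : MeasIso μ'₁ μ'₂ conjF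
  conjF_equivariant : ∀ k : ↥K₁, ∀ᵐ x ∂μ'₁, conjF (act₁ k x) = act₂ (θ k) (conjF x)
  Z₁ : Type
  Z₂ : Type
  mZ₁ : MeasurableSpace Z₁
  mZ₂ : MeasurableSpace Z₂
  ρ₁ : Measure Z₁
  ρ₂ : Measure Z₂
  qact₁ : G₁ ⧸ F₁ →* Equiv.Perm Z₁
  qact₂ : G₂ ⧸ F₂ →* Equiv.Perm Z₂
  qpmp₁ : ∀ g, MeasurePreserving (qact₁ g) ρ₁ ρ₁
  qpmp₂ : ∀ g, MeasurePreserving (qact₂ g) ρ₂ ρ₂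
  π₁ : X₁ → Z₁
  π₂ : X₂ → Z₂
  quot₁ : IsQuotientModel F₁ μ₁ qact₁ ρ₁ π₁
  quot₂ : IsQuotientModel F₂ μ₂ qact₂ ρ₂ π₂
  ind₁ : InducedFrom K₁ qact₁ ρ₁ act₁ μ'₁
  ind₂ : InducedFrom K₂ qact₂ ρ₂ act₂ μ'₂

/- ## Bernoulli actions -/

/-- The Bernoulli shift action of `G` on `G → A`. -/
instance bernoulliAction (G A : Type) [Group G] : MulAction G (G → A) where
  smul g x := fun h => x (g⁻¹ * h)
  one_smul x := funext fun h => by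
    show x (1⁻¹ * h) = x h
    rw [inv_one, one_mul]
  mul_smul g g' x := funext fun h => by
    show x ((g * g')⁻¹ * h) = x (g'⁻¹ * (g⁻¹ * h))
    rw [mul_inv_rev, mul_assoc]

/-- `μ` is the product (Bernoulli) measure on `G → A` with base `μ₀`:
it gives the product value to every cylinder set. -/
def IsBernoulliMeasure (G : Type) [Group G] {A : Type} [MeasurableSpace A]
    (μ₀ : Measure A) (μ : Measure (G → A)) : Prop :=
  ∀ (s : Finset G) (B : G → Set A), (∀ g : G, MeasurableSet (B g)) →
    μ {x : G → A | ∀ g ∈ s, x g ∈ B g} = ∏ g ∈ s, μ₀ (B g)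

/-- `𝓕`-ergodicity: every subgroup in the collection `𝓕` acts ergodically. -/
def FErgodic (G : Type) [Group G] (𝓕 : Set (Subgroup G)) (X : Type) [MeasurableSpace X]
    [MulAction G X] (μ : Measure X) : Prop :=
  ∀ A ∈ 𝓕, ErgodicSubgroup G A X μ

/-- Strong cocycle-rigidity of the pair `(G, 𝓕)`. -/
def StronglyCocycleRigid (G : Type) [Group G] (𝓕 : Set (Subgroup G)) : Prop :=
  ∀ (X : Type) [MeasurableSpace X] [StandardBorelSpace X] (μ : Measure X)
    (Y : Type) [MeasurableSpace Y] [StandardBorelSpace Y] (ν : Measure Y)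
    [IsProbabilityMeasure μ] [IsProbabilityMeasure ν]
    [MulAction G X] [MulAction G Y],
    PmpAction G X μ → FreeAction G X μ → ErgodicAction G X μ → FErgodic G 𝓕 X μ →
    PmpAction G Y ν → FreeAction G Y ν → ErgodicAction G Y ν → FErgodic G 𝓕 Y ν →
    ∀ f : StableOE G X G Y μ ν, ∀ c : G → X → G, f.IsSOECocycle c →
      ∃ α : G ≃* G, Cohomologous G X G μ c fun g _ => α g

section RAAGBasics

variable {V : Type} {Γ : SimpleGraph V}

theorem gen_comm {u v : V} (h : Γ.Adj u v) : gen Γ u * gen Γ v = gen Γ v * gen Γ u := by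
  have h1 : PresentedGroup.mk (raagRels Γ)
      (FreeGroup.of u * FreeGroup.of v * (FreeGroup.of u)⁻¹ * (FreeGroup.of v)⁻¹) = 1 :=
    PresentedGroup.one_of_mem ⟨u, v, h, rfl⟩
  simp only [map_mul, map_inv] at h1
  rw [mul_inv_eq_one, mul_inv_eq_iff_eq_mul] at h1
  exact h1

/-- The homomorphism out of a right-angled Artin group given by the images of the generators. -/
def raagLift {K : Type*} [Group K] (f : V → K)
    (hf : ∀ u v, Γ.Adj u v → f u * f v = f v * f u) : RAAG Γ →* K :=
  PresentedGroup.toGroup (rels := raagRels Γ) (f := f) (by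
    rintro r ⟨u, v, h, rfl⟩
    simp [hf u v h])

@[simp] theorem raagLift_gen {K : Type*} [Group K] (f : V → K)
    (hf : ∀ u v, Γ.Adj u v → f u * f v = f v * f u) (v : V) :
    raagLift f hf (gen Γ v) = f v := by
  simp [raagLift, gen]

theorem raag_hom_ext {K : Type*} [Group K] {f g : RAAG Γ →* K}
    (h : ∀ v, f (gen Γ v) = g (gen Γ v)) : f = g :=
  PresentedGroup.ext h

theorem gen_mem_standardSub {S : Set V} {v : V} (h : v ∈ S) : gen Γ v ∈ standardSub Γ S :=
  Subgroup.subset_closure ⟨v, h, rfl⟩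

theorem standardSub_mono {S T : Set V} (h : S ⊆ T) : standardSub Γ S ≤ standardSub Γ T :=
  Subgroup.closure_mono (Set.image_mono h)

theorem standardSub_univ : standardSub Γ Set.univ = ⊤ := by
  rw [standardSub, Set.image_univ]
  exact PresentedGroup.closure_range_of _

theorem standardSub_empty : standardSub Γ ∅ = ⊥ := by simp [standardSub]

theorem standardSub_le {S : Set V} {P : Subgroup (RAAG Γ)} (h : ∀ v ∈ S, gen Γ v ∈ P) :
    standardSub Γ S ≤ P := by
  rw [standardSub, Subgroup.closure_le]
  rintro _ ⟨v, hv, rfl⟩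
  exact h v hv

instance [Countable V] : Countable (RAAG Γ) := by
  have : Countable (FreeGroup V) := by unfold FreeGroup; infer_instance
  exact (PresentedGroup.mk_surjective (raagRels Γ)).countable

/-- Standard subgroups on completely adjacent sets of vertices commute. -/
theorem standardSub_commute {S T : Set V} (h : ∀ u ∈ S, ∀ v ∈ T, Γ.Adj u v) {a b : RAAG Γ}
    (ha : a ∈ standardSub Γ S) (hb : b ∈ standardSub Γ T) : a * b = b * a := by
  have h1 : standardSub Γ T ≤ Subgroup.centralizer (gen Γ '' S) := by
    refine standardSub_le fun v hv => ?_
    rw [Subgroup.mem_centralizer_iff]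
    rintro _ ⟨u, hu, rfl⟩
    exact gen_comm (h u hu v hv)
  have h2 : standardSub Γ S ≤ Subgroup.centralizer (standardSub Γ T : Set (RAAG Γ)) := by
    refine standardSub_le fun u hu => ?_
    rw [Subgroup.mem_centralizer_iff]
    intro k hk
    exact ((Subgroup.mem_centralizer_iff.1 (h1 hk)) _ ⟨u, hu, rfl⟩).symm
  exact ((Subgroup.mem_centralizer_iff.1 (h2 ha)) b hb).symm

/-- The exponent sum of a generator. -/
noncomputable def expo (Γ : SimpleGraph V) (v : V) : RAAG Γ →* Multiplicative ℤ :=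
  open Classical in
  raagLift (fun u => if u = v then Multiplicative.ofAdd 1 else 1) fun _ _ _ => mul_comm _ _

theorem expo_gen_self (v : V) : expo Γ v (gen Γ v) = Multiplicative.ofAdd 1 := by
  simp [expo]

theorem expo_gen_ne {u v : V} (h : u ≠ v) : expo Γ v (gen Γ u) = 1 := by
  simp [expo, h]

theorem expo_eq_one_of_mem {S : Set V} {v : V} (hv : v ∉ S) {g : RAAG Γ}
    (hg : g ∈ standardSub Γ S) : expo Γ v g = 1 := by
  have : standardSub Γ S ≤ (expo Γ v).ker :=
    standardSub_le fun u hu => expo_gen_ne (fun h => hv (h ▸ hu))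
  exact this hg

theorem gen_pow_conj_mem {S : Set V} {v : V} {n : ℕ} (hn : 0 < n) {k : RAAG Γ}
    (h : k⁻¹ * gen Γ v ^ n * k ∈ standardSub Γ S) : v ∈ S := by
  by_contra hv
  have := expo_eq_one_of_mem hv h
  simp only [map_mul, map_inv, map_pow, expo_gen_self, mul_comm (expo Γ v k)⁻¹,
    inv_mul_cancel_right] at this
  rw [← ofAdd_nsmul] at this
  have h2 : n • (1:ℤ) = 0 := this
  simp at h2
  omega

theorem gen_pow_ne_one {v : V} {n : ℕ} (hn : 0 < n) : gen Γ v ^ n ≠ 1 := by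
  intro h
  have : v ∈ (∅ : Set V) := gen_pow_conj_mem (k := 1) hn (by rw [h]; simp)
  simp at this

/-- The canonical retraction onto a standard subgroup. -/
noncomputable def ret (Γ : SimpleGraph V) (S : Set V) : RAAG Γ →* RAAG Γ :=
  open Classical in
  raagLift (fun u => if u ∈ S then gen Γ u else 1) fun u v h => by
    split_ifs <;> simp [gen_comm h]

theorem ret_gen_mem {S : Set V} {v : V} (h : v ∈ S) : ret Γ S (gen Γ v) = gen Γ v := by
  simp [ret, h]

theorem ret_gen_notMem {S : Set V} {v : V} (h : v ∉ S) : ret Γ S (gen Γ v) = 1 := by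
  simp [ret, h]

theorem ret_eq_self {S : Set V} {g : RAAG Γ} (hg : g ∈ standardSub Γ S) : ret Γ S g = g := by
  have : standardSub Γ S ≤ (ret Γ S).eqLocus (MonoidHom.id _) :=
    standardSub_le fun v hv => ret_gen_mem hv
  exact this hg

theorem ret_mem_of_mem {S T : Set V} {g : RAAG Γ} (hg : g ∈ standardSub Γ T) :
    ret Γ S g ∈ standardSub Γ T := by
  have : standardSub Γ T ≤ (standardSub Γ T).comap (ret Γ S) :=
    standardSub_le fun v hv => by
      rw [Subgroup.mem_comap]
      by_cases h : v ∈ S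
      · rw [ret_gen_mem h]; exact gen_mem_standardSub hv
      · rw [ret_gen_notMem h]; exact one_mem _
  exact this hg

theorem ret_mem {S : Set V} (g : RAAG Γ) : ret Γ S g ∈ standardSub Γ S := by
  have : (⊤ : Subgroup (RAAG Γ)) ≤ (standardSub Γ S).comap (ret Γ S) := by
    rw [← standardSub_univ]
    refine standardSub_le fun v _ => ?_
    rw [Subgroup.mem_comap]
    by_cases h : v ∈ S
    · rw [ret_gen_mem h]; exact gen_mem_standardSub h
    · rw [ret_gen_notMem h]; exact one_mem _
  exact this (Subgroup.mem_top g)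

/-- Projection to the right-angled Artin group of an induced subgraph. -/
noncomputable def proj (Γ : SimpleGraph V) (S : Set V) : RAAG Γ →* RAAG (Γ.induce S) :=
  open Classical in
  raagLift (fun u => if h : u ∈ S then gen (Γ.induce S) ⟨u, h⟩ else 1) fun u v h => by
    split_ifs
    · exact gen_comm (by simpa using h)
    all_goals simp

/-- Inclusion of the right-angled Artin group of an induced subgraph. -/
def incl (Γ : SimpleGraph V) (S : Set V) : RAAG (Γ.induce S) →* RAAG Γ :=
  raagLift (fun u => gen Γ u) fun u v h => gen_comm (by simpa using h)

@[simp] theorem incl_gen {S : Set V} (v : S) : incl Γ S (gen _ v) = gen Γ v := by simp [incl]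

theorem proj_gen_mem {S : Set V} {v : V} (h : v ∈ S) :
    proj Γ S (gen Γ v) = gen (Γ.induce S) ⟨v, h⟩ := by simp [proj, h]

theorem proj_gen_notMem {S : Set V} {v : V} (h : v ∉ S) : proj Γ S (gen Γ v) = 1 := by
  simp [proj, h]

@[simp] theorem proj_incl {S : Set V} (g : RAAG (Γ.induce S)) : proj Γ S (incl Γ S g) = g := by
  have : (proj Γ S).comp (incl Γ S) = MonoidHom.id _ := by
    refine raag_hom_ext fun v => ?_
    simp [proj_gen_mem v.2]
  exact DFunLike.congr_fun this g

theorem incl_proj {S : Set V} (g : RAAG Γ) : incl Γ S (proj Γ S g) = ret Γ S g := by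
  have : (incl Γ S).comp (proj Γ S) = ret Γ S := by
    refine raag_hom_ext fun v => ?_
    by_cases h : v ∈ S
    · simp [proj_gen_mem h, ret_gen_mem h]
    · simp [proj_gen_notMem h, ret_gen_notMem h]
  exact DFunLike.congr_fun this g

theorem incl_proj_of_mem {S : Set V} {g : RAAG Γ} (hg : g ∈ standardSub Γ S) :
    incl Γ S (proj Γ S g) = g := by rw [incl_proj, ret_eq_self hg]

theorem incl_mem {S : Set V} (g : RAAG (Γ.induce S)) : incl Γ S g ∈ standardSub Γ S := by
  have := ret_mem (S := S) (incl Γ S g)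
  rwa [← incl_proj, proj_incl] at this

/-- `incl` carries standard subgroups to standard subgroups. -/
theorem map_incl_standardSub {S : Set V} (T : Set S) :
    (standardSub (Γ.induce S) T).map (incl Γ S) = standardSub Γ (Subtype.val '' T) := by
  rw [standardSub, standardSub, MonoidHom.map_closure]
  congr 1
  ext g
  simp only [Set.mem_image, exists_exists_and_eq_and, incl_gen]

theorem proj_eq_one {S T : Set V} (h : Disjoint S T) {g : RAAG Γ} (hg : g ∈ standardSub Γ T) :
    proj Γ S g = 1 := by
  have : standardSub Γ T ≤ (proj Γ S).ker :=
    standardSub_le fun v hv => proj_gen_notMem fun h' => Set.disjoint_left.1 h h' hv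
  exact this hg

/-- Decomposition of an element of the standard subgroup on a join. -/
theorem join_decomp {S T : Set V} (hST : ∀ u ∈ S, ∀ v ∈ T, Γ.Adj u v) {g : RAAG Γ}
    (hg : g ∈ standardSub Γ (S ∪ T)) :
    g = incl Γ S (proj Γ S g) * incl Γ T (proj Γ T g) := by
  have hdis : Disjoint S T := Set.disjoint_left.2 fun a h h' => (hST a h a h').ne rfl
  induction hg using Subgroup.closure_induction with
  | mem x hx =>
    obtain ⟨v, hv | hv, rfl⟩ := hx
    · rw [incl_proj, incl_proj, ret_gen_mem hv,
        ret_gen_notMem (Set.disjoint_left.1 hdis hv), mul_one]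
    · rw [incl_proj, incl_proj, ret_gen_mem hv,
        ret_gen_notMem (Set.disjoint_right.1 hdis hv), one_mul]
  | one => simp
  | mul x y _ _ hx hy =>
    have := standardSub_commute (Γ := Γ) hST (incl_mem (proj Γ S y)) (incl_mem (proj Γ T x))
    conv_lhs => rw [hx, hy]
    simp only [map_mul, mul_assoc]
    rw [← mul_assoc (incl Γ T (proj Γ T x)), ← this, mul_assoc]
  | inv x _ hx =>
    have := standardSub_commute (Γ := Γ) hST (incl_mem (proj Γ S x)) (incl_mem (proj Γ T x))
    conv_lhs => rw [hx, this]
    simp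

end RAAGBasics

section Words

variable {V : Type} {Γ : SimpleGraph V}

/-- The group element of a signed letter. -/
def ltr (Γ : SimpleGraph V) (s : V × Bool) : RAAG Γ := if s.2 then gen Γ s.1 else (gen Γ s.1)⁻¹

/-- Evaluation of a word in signed letters. -/
def ev (Γ : SimpleGraph V) (L : List (V × Bool)) : RAAG Γ := (L.map (ltr Γ)).prod

@[simp] theorem ev_nil : ev Γ [] = 1 := rfl
@[simp] theorem ev_cons (s : V × Bool) (L : List (V × Bool)) :
    ev Γ (s :: L) = ltr Γ s * ev Γ L := by simp [ev]
@[simp] theorem ev_append (L L' : List (V × Bool)) : ev Γ (L ++ L') = ev Γ L * ev Γ L' := by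
  simp [ev]

theorem ltr_mem {S : Set V} {s : V × Bool} (h : s.1 ∈ S) : ltr Γ s ∈ standardSub Γ S := by
  unfold ltr
  split_ifs
  · exact gen_mem_standardSub h
  · exact inv_mem (gen_mem_standardSub h)

theorem ev_mem {S : Set V} {L : List (V × Bool)} (h : ∀ s ∈ L, s.1 ∈ S) :
    ev Γ L ∈ standardSub Γ S := by
  induction L with
  | nil => exact one_mem _
  | cons s L ih =>
    rw [ev_cons]
    exact mul_mem (ltr_mem (h s (by simp))) (ih fun t ht => h t (by simp [ht]))

theorem exists_word_of_mem {S : Set V} {g : RAAG Γ} (hg : g ∈ standardSub Γ S) :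
    ∃ L : List (V × Bool), (∀ s ∈ L, s.1 ∈ S) ∧ ev Γ L = g := by
  induction hg using Subgroup.closure_induction with
  | mem x hx =>
    obtain ⟨v, hv, rfl⟩ := hx
    exact ⟨[(v, true)], by simpa using hv, by simp [ltr]⟩
  | one => exact ⟨[], by simp, rfl⟩
  | mul x y _ _ hx hy =>
    obtain ⟨L, h1, rfl⟩ := hx
    obtain ⟨L', h2, rfl⟩ := hy
    exact ⟨L ++ L', by
      intro s hs
      rcases List.mem_append.1 hs with h | h
      exacts [h1 s h, h2 s h], by simp⟩
  | inv x hm hx =>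
    obtain ⟨L, h1, rfl⟩ := hx
    refine ⟨(L.map fun s => (s.1, !s.2)).reverse, ?_, ?_⟩
    · intro s hs
      simp only [List.mem_reverse, List.mem_map] at hs
      obtain ⟨t, ht, rfl⟩ := hs
      exact h1 t ht
    · clear h1 hm
      induction L with
      | nil => simp
      | cons s L ih =>
        have : ltr Γ (s.1, !s.2) = (ltr Γ s)⁻¹ := by
          obtain ⟨v, b⟩ := s
          cases b <;> simp [ltr]
        simp [ih, this]

theorem exists_word (g : RAAG Γ) : ∃ L, ev Γ L = g := by
  obtain ⟨L, -, h⟩ := exists_word_of_mem (S := Set.univ) (g := g) (by simp [standardSub_univ])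
  exact ⟨L, h⟩

theorem exists_word_length (g : RAAG Γ) : ∃ n, ∃ L, ev Γ L = g ∧ L.length = n :=
  (exists_word g).elim fun L h => ⟨_, L, h, rfl⟩

open Classical in
/-- Word length. -/
noncomputable def len (g : RAAG Γ) : ℕ := Nat.find (exists_word_length g)

theorem exists_geodesic (g : RAAG Γ) : ∃ L, ev Γ L = g ∧ L.length = len g := by
  classical exact Nat.find_spec (exists_word_length g)

theorem len_ev_le (L : List (V × Bool)) : len (ev Γ L) ≤ L.length := by
  classical exact Nat.find_min' (exists_word_length (ev Γ L)) ⟨L, rfl, rfl⟩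

/-- A word of minimal length. -/
def Geo (Γ : SimpleGraph V) (L : List (V × Bool)) : Prop := L.length = len (ev Γ L)

theorem Geo.tail {s : V × Bool} {L : List (V × Bool)} (h : Geo Γ (s :: L)) : Geo Γ L := by
  obtain ⟨L', h1, h2⟩ := exists_geodesic (ev Γ L)
  have h3 := len_ev_le (Γ := Γ) (s :: L')
  have h4 := len_ev_le (Γ := Γ) L
  unfold Geo at *
  rw [ev_cons, h1, ← ev_cons, ← h] at h3
  simp at h3
  omega

theorem ret_ev (S : Set V) [DecidablePred (· ∈ S)] (L : List (V × Bool)) :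
    ret Γ S (ev Γ L) = ev Γ (L.filter (fun s => decide (s.1 ∈ S))) := by
  induction L with
  | nil => simp
  | cons s L ih =>
    obtain ⟨v, b⟩ := s
    by_cases h : v ∈ S
    · cases b <;> simp [h, ih, ltr, ret_gen_mem h]
    · cases b <;> simp [h, ih, ltr, ret_gen_notMem h]

theorem Geo.letters {S : Set V} {L : List (V × Bool)} (h : Geo Γ L)
    (hL : len (ev Γ L) ≤ len (ret Γ S (ev Γ L))) : ∀ s ∈ L, s.1 ∈ S := by
  classical
  rw [ret_ev] at hL
  have h1 := len_ev_le (Γ := Γ) (L.filter (fun s => decide (s.1 ∈ S)))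
  have h2 : (L.filter (fun s => decide (s.1 ∈ S))).length = L.length :=
    le_antisymm (List.length_filter_le _ _) (by unfold Geo at h; omega)
  intro s hs
  simpa using List.length_filter_eq_length_iff.1 h2 s hs

theorem Geo.letters_of_mem {S : Set V} {L : List (V × Bool)} (h : Geo Γ L)
    (hL : ev Γ L ∈ standardSub Γ S) : ∀ s ∈ L, s.1 ∈ S :=
  h.letters (by rw [ret_eq_self hL])

theorem exists_geo (g : RAAG Γ) : ∃ L, ev Γ L = g ∧ Geo Γ L := by
  obtain ⟨L, h, h'⟩ := exists_geodesic g
  exact ⟨L, h, by unfold Geo; rw [h', h]⟩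

theorem mem_iInter_standardSub {ι : Type*} {S : ι → Set V} {g : RAAG Γ}
    (h : ∀ i, g ∈ standardSub Γ (S i)) : g ∈ standardSub Γ (⋂ i, S i) := by
  obtain ⟨L, rfl, hL⟩ := exists_geo g
  exact ev_mem fun s hs => Set.mem_iInter.2 fun i => hL.letters_of_mem (h i) s hs

theorem finite_len_le [Finite V] (C : ℕ) : {g : RAAG Γ | len g ≤ C}.Finite := by
  refine ((List.finite_length_le (V × Bool) C).image (ev Γ)).subset ?_
  intro g hg
  obtain ⟨L, h, h'⟩ := exists_geodesic g
  exact ⟨L, by simpa [h'] using hg, h⟩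

/-! ### Link walls -/

/-- The standard subgroup on the link of a vertex. -/
abbrev lkSub (Γ : SimpleGraph V) (v : V) : Subgroup (RAAG Γ) := standardSub Γ (Γ.neighborSet v)

theorem lkSub_commute {v : V} {g : RAAG Γ} (hg : g ∈ lkSub Γ v) :
    g * gen Γ v = gen Γ v * g :=
  (standardSub_commute (S := {v}) (T := Γ.neighborSet v)
    (by rintro _ rfl w hw; exact hw) (gen_mem_standardSub rfl) hg).symm

theorem lkSub_commute_ltr {s : V × Bool} {g : RAAG Γ} (hg : g ∈ lkSub Γ s.1) :
    g * ltr Γ s = ltr Γ s * g := by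
  have := lkSub_commute hg
  unfold ltr
  split_ifs
  · exact this
  · exact (Commute.inv_right (show Commute g (gen Γ s.1) from this)).eq

/-- Walls: cosets of link subgroups. -/
abbrev Wall (Γ : SimpleGraph V) : Type := Σ v : V, RAAG Γ ⧸ lkSub Γ v

/-- The wall crossed by a letter starting from the identity. -/
def wl (Γ : SimpleGraph V) (s : V × Bool) : Wall Γ :=
  ⟨s.1, QuotientGroup.mk (if s.2 then 1 else ltr Γ s)⟩

/-- Walls crossed by a word, with signs. -/
def edg (Γ : SimpleGraph V) : List (V × Bool) → List (Wall Γ × Bool)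
  | [] => []
  | s :: L => (wl Γ s, s.2) :: (edg Γ L).map fun e => (ltr Γ s • e.1, e.2)

theorem edg_append (L L' : List (V × Bool)) :
    edg Γ (L ++ L') = edg Γ L ++ (edg Γ L').map fun e => (ev Γ L • e.1, e.2) := by
  induction L with
  | nil => simp [edg]
  | cons s L ih => simp [edg, ih, mul_smul, Function.comp_def]

theorem mem_edg {L : List (V × Bool)} {e : Wall Γ × Bool} (h : e ∈ edg Γ L) :
    ∃ L0 s L1, L = L0 ++ s :: L1 ∧ e = (ev Γ L0 • wl Γ s, s.2) := by
  induction L generalizing e with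
  | nil => simp [edg] at h
  | cons s L ih =>
    simp only [edg, List.mem_cons, List.mem_map] at h
    rcases h with rfl | ⟨e', he', rfl⟩
    · exact ⟨[], s, L, rfl, by simp⟩
    · obtain ⟨L0, t, L1, rfl, rfl⟩ := ih he'
      exact ⟨s :: L0, t, L1, rfl, by simp [mul_smul]⟩

theorem length_edg (L : List (V × Bool)) : (edg Γ L).length = L.length := by
  induction L with
  | nil => rfl
  | cons s L ih => simp [edg, ih]

theorem wl_eq_fst {p : RAAG Γ} {s t : V × Bool} (h : wl Γ s = p • wl Γ t) : s.1 = t.1 :=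
  congrArg Sigma.fst h

theorem wl_eq_iff (p q : RAAG Γ) (v : V) : (⟨v, QuotientGroup.mk p⟩ : Wall Γ) =
    ⟨v, QuotientGroup.mk q⟩ ↔ p⁻¹ * q ∈ lkSub Γ v := by
  rw [Sigma.mk.injEq, heq_eq_eq, QuotientGroup.eq]
  simp

/-- Two crossings of the same wall with the same sign. -/
theorem wl_same {p : RAAG Γ} {s : V × Bool} (h : wl Γ s = p • wl Γ s) : p ∈ lkSub Γ s.1 := by
  obtain ⟨v, b⟩ := s
  cases b
  · have h' := (wl_eq_iff (Γ := Γ) (gen Γ v)⁻¹ (p * (gen Γ v)⁻¹) v).1 (by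
      simpa [wl, ltr] using h)
    have h2 := lkSub_commute h'
    simp only [inv_inv, mul_assoc, inv_mul_cancel, mul_one] at h2
    have h3 : p = gen Γ v * (p * (gen Γ v)⁻¹) := by
      have := mul_left_cancel h2
      rw [← this]
    simp only [inv_inv] at h'
    rw [h3]; exact h'
  · have h' := (wl_eq_iff (Γ := Γ) 1 p v).1 (by
      simp only [wl, if_true] at h
      rw [h]; exact congrArg (Sigma.mk v) (by simp))
    simpa using h'

/-- Two crossings of the same wall with opposite signs. -/
theorem wl_opp {p : RAAG Γ} {s t : V × Bool} (h : wl Γ s = (ltr Γ s * p) • wl Γ t)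
    (hb : s.2 ≠ t.2) : ltr Γ s * p * ltr Γ t = p := by
  obtain ⟨v, b⟩ := s
  obtain ⟨v', b'⟩ := t
  obtain rfl : v = v' := wl_eq_fst h
  cases b <;> cases b'
  · exact absurd rfl hb
  · have h' := (wl_eq_iff (Γ := Γ) (gen Γ v)⁻¹ ((gen Γ v)⁻¹ * p) v).1 (by
      simpa [wl, ltr] using h)
    have h2 := lkSub_commute (g := p) (by simpa [mul_assoc] using h')
    simp [ltr, mul_assoc, h2]
  · have h' := (wl_eq_iff (Γ := Γ) 1 (gen Γ v * p * (gen Γ v)⁻¹) v).1 (by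
      simpa [wl, ltr] using h)
    have h' : gen Γ v * p * (gen Γ v)⁻¹ ∈ lkSub Γ v := by simpa using h'
    have h2 := lkSub_commute h'
    simp only [ltr, if_true]
    simp only [mul_assoc, inv_mul_cancel, mul_one] at h2
    have := mul_left_cancel h2
    simp only [Bool.false_eq_true, if_false, mul_assoc]
    exact this.symm
  · exact absurd rfl hb

theorem Geo.no_opp {L : List (V × Bool)} (h : Geo Γ L) (e : Wall Γ) (b b' : Bool)
    (h1 : (e, b) ∈ edg Γ L) (h2 : (e, b') ∈ edg Γ L) : b = b' := by
  induction L generalizing e with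
  | nil => simp [edg] at h1
  | cons s L ih =>
    have key : ∀ e', ∀ b'', (e', b'') ∈ edg Γ L → wl Γ s = ltr Γ s • e' → s.2 = b'' := by
      intro e' b'' he' hs
      by_contra hne
      obtain ⟨L0, t, L1, rfl, h4⟩ := mem_edg he'
      simp only [Prod.mk.injEq] at h4
      obtain ⟨rfl, rfl⟩ := h4
      have h5 := wl_opp (p := ev Γ L0) (by rw [hs, mul_smul]) hne
      have h6 : ev Γ (s :: (L0 ++ t :: L1)) = ev Γ (L0 ++ L1) := by
        simp only [ev_cons, ev_append]
        conv_rhs => rw [← h5]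
        simp [mul_assoc]
      have h7 := len_ev_le (Γ := Γ) (L0 ++ L1)
      rw [← h6, ← h] at h7
      simp at h7
    simp only [edg, List.mem_cons, List.mem_map, Prod.mk.injEq] at h1 h2
    rcases h1 with ⟨rfl, rfl⟩ | ⟨⟨e1, b1⟩, he1, rfl, rfl⟩
    · rcases h2 with ⟨-, rfl⟩ | ⟨⟨e2, b2⟩, he2, h3, rfl⟩
      · rfl
      · exact key _ _ he2 h3.symm
    · rcases h2 with ⟨h3, rfl⟩ | ⟨⟨e2, b2⟩, he2, h3, rfl⟩
      · exact (key _ _ he1 h3.symm).symm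
      · have : e1 = e2 := MulAction.injective (ltr Γ s) h3.symm
        subst this
        exact ih h.tail _ he1 he2

/-! ### The Fox cocycle -/

/-- The translation action on finitely supported functions on walls. -/
noncomputable def wallShift (Γ : SimpleGraph V) :
    RAAG Γ →* MulAut (Multiplicative (Wall Γ →₀ ℤ)) where
  toFun g := AddEquiv.toMultiplicative (Finsupp.domCongr (MulAction.toPerm g))
  map_one' := by
    ext f e
    simp [Finsupp.domCongr]
  map_mul' g h := by
    ext f e
    show Multiplicative.toAdd f ((g * h)⁻¹ • e) = Multiplicative.toAdd f (h⁻¹ • g⁻¹ • e)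
    rw [mul_inv_rev, mul_smul]

theorem wallShift_apply (g : RAAG Γ) (f : Multiplicative (Wall Γ →₀ ℤ)) (e : Wall Γ) :
    Multiplicative.toAdd (wallShift Γ g f) e = Multiplicative.toAdd f (g⁻¹ • e) := rfl

theorem wallShift_single (g : RAAG Γ) (e : Wall Γ) (n : ℤ) :
    wallShift Γ g (Multiplicative.ofAdd (Finsupp.single e n)) =
      Multiplicative.ofAdd (Finsupp.single (g • e) n) := by
  show Multiplicative.ofAdd (Finsupp.equivMapDomain (MulAction.toPerm g) (Finsupp.single e n)) = _
  rw [Finsupp.equivMapDomain_single]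
  rfl

/-- The lift of a group to the semidirect product defined by the Fox cocycle. -/
noncomputable def foxHom (Γ : SimpleGraph V) :
    RAAG Γ →* (Multiplicative (Wall Γ →₀ ℤ)) ⋊[wallShift Γ] RAAG Γ :=
  raagLift (fun v => ⟨Multiplicative.ofAdd (Finsupp.single (wl Γ (v, true)) 1), gen Γ v⟩) (by
    intro u v h
    have key : ∀ u v, Γ.Adj u v → gen Γ u • wl Γ (v, true) = wl Γ (v, true) := by
      intro u v h
      refine congrArg (Sigma.mk v) ?_
      show QuotientGroup.mk (gen Γ u * 1) = QuotientGroup.mk 1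
      rw [QuotientGroup.eq, mul_one, mul_one]
      exact inv_mem (gen_mem_standardSub (S := Γ.neighborSet v) h.symm)
    ext1
    · simp only [SemidirectProduct.mul_left, wallShift_single, key u v h, key v u h.symm]
      exact mul_comm _ _
    · exact gen_comm h)

theorem foxHom_right (g : RAAG Γ) : (foxHom Γ g).right = g := by
  have : (SemidirectProduct.rightHom).comp (foxHom Γ) = MonoidHom.id _ := by
    refine raag_hom_ext fun v => ?_
    simp [foxHom]
  exact DFunLike.congr_fun this g

/-- The Fox cocycle. -/
noncomputable def fox (g : RAAG Γ) : Wall Γ →₀ ℤ := Multiplicative.toAdd (foxHom Γ g).left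

theorem fox_mul (g h : RAAG Γ) (e : Wall Γ) : fox (g * h) e = fox g e + fox h (g⁻¹ • e) := by
  unfold fox
  rw [map_mul, SemidirectProduct.mul_left, foxHom_right, toAdd_mul, Finsupp.add_apply,
    wallShift_apply]

theorem fox_one : fox (1 : RAAG Γ) = 0 := by simp [fox]

/-- The sign of a letter as an integer. -/
def sgn (b : Bool) : ℤ := if b then 1 else -1

theorem fox_ltr (s : V × Bool) : fox (ltr Γ s) = Finsupp.single (wl Γ s) (sgn s.2) := by
  obtain ⟨v, b⟩ := s
  have h1 : fox (gen Γ v) = Finsupp.single (wl Γ (v, true)) 1 := by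
    simp [fox, foxHom]
  cases b
  · ext e
    have h2 := fox_mul (gen Γ v) (gen Γ v)⁻¹ (gen Γ v • e)
    simp only [mul_inv_cancel, fox_one, h1, inv_smul_smul, Finsupp.coe_zero, Pi.zero_apply] at h2
    have h3 : wl Γ (v, true) = gen Γ v • e ↔ wl Γ (v, false) = e := by
      rw [← inv_smul_eq_iff]
      have : (gen Γ v)⁻¹ • wl Γ (v, true) = wl Γ (v, false) := by
        refine congrArg (Sigma.mk v) ?_
        show QuotientGroup.mk ((gen Γ v)⁻¹ * 1) = QuotientGroup.mk _
        simp [ltr]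
      rw [this]
    classical
    simp only [ltr, Bool.false_eq_true, if_false, Finsupp.single_apply, sgn, h3] at h2 ⊢
    split_ifs at h2 ⊢ <;> omega
  · simpa [ltr, sgn] using h1

open Classical in
theorem fox_ev (L : List (V × Bool)) (e : Wall Γ) :
    fox (ev Γ L) e = (edg Γ L).count (e, true) - (edg Γ L).count (e, false) := by
  induction L generalizing e with
  | nil => simp [edg, fox_one]
  | cons s L ih =>
    have hc : ∀ b, ((edg Γ L).map fun e => (ltr Γ s • e.1, e.2)).count (e, b) =
        (edg Γ L).count ((ltr Γ s)⁻¹ • e, b) := by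
      intro b
      have hinj : Function.Injective (fun e : Wall Γ × Bool => (ltr Γ s • e.1, e.2)) := by
        rintro ⟨a, b⟩ ⟨a', b'⟩ h
        simp only [Prod.mk.injEq] at h
        exact Prod.ext (MulAction.injective _ h.1) h.2
      have := List.count_map_of_injective (edg Γ L) _ hinj ((ltr Γ s)⁻¹ • e, b)
      simpa using this
    rw [ev_cons, fox_mul, ih, fox_ltr, edg, List.count_cons, List.count_cons, hc, hc,
      Finsupp.single_apply]
    obtain ⟨v, b⟩ := s
    by_cases h : wl Γ (v, b) = e <;> cases b <;> simp [h, sgn] <;> ring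

theorem Geo.fox_sgn {L : List (V × Bool)} {e : Wall Γ} {b : Bool}
    (h : (e, b) ∈ edg Γ L) (h' : (e, !b) ∉ edg Γ L) : 0 < sgn b * fox (ev Γ L) e := by
  classical
  rw [fox_ev]
  have h1 := List.count_pos_iff.2 h
  have h2 := List.count_eq_zero.2 h'
  cases b <;> simp only [Bool.not_true, Bool.not_false] at h2 <;> simp [h2, sgn] <;> simpa using h1

theorem mem_edg_of_fox {L : List (V × Bool)} {e : Wall Γ} {b : Bool}
    (h : 0 < sgn b * fox (ev Γ L) e) : (e, b) ∈ edg Γ L := by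
  classical
  rw [fox_ev] at h
  rw [← List.count_pos_iff]
  cases b <;> simp [sgn] at h <;> omega

/-- The `ℓ¹`-norm of the Fox cocycle is the word length. -/
theorem fox_norm (g : RAAG Γ) : (fox g).sum (fun _ n => n.natAbs) = len g := by
  classical
  obtain ⟨L, rfl, hL⟩ := exists_geo g
  rw [← hL]
  suffices ∀ (l : List (Wall Γ × Bool)),
      (∀ e b b', (e, b) ∈ l → (e, b') ∈ l → b = b') → ∀ f : Wall Γ →₀ ℤ,
      (∀ e, f e = l.count (e, true) - l.count (e, false)) →
      f.sum (fun _ n => n.natAbs) = l.length by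
    rw [this (edg Γ L) (fun e b b' => hL.no_opp e b b') _ (fox_ev L), length_edg]
  intro l
  induction l with
  | nil =>
    intro _ f hf
    have : f = 0 := by ext e; simp [hf]
    simp [this]
  | cons a l ih =>
    intro hl f hf
    obtain ⟨e, b⟩ := a
    have hz : l.count (e, !b) = 0 := List.count_eq_zero.2 fun h => by
      have := hl e b (!b) (by simp) (by simp [h])
      cases b <;> simp at this
    set f' := f - Finsupp.single e (sgn b) with hf'
    have h1 := ih (fun e b b' h h' => hl e b b' (by simp [h]) (by simp [h'])) f' (by
      intro e'
      rw [hf', Finsupp.sub_apply, hf, List.count_cons, List.count_cons, Finsupp.single_apply]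
      by_cases h : e = e' <;> cases b <;> simp [h, sgn] <;> ring)
    have hsum : ∀ F : Wall Γ →₀ ℤ, ∀ s : Finset (Wall Γ), F.support ⊆ s →
        F.sum (fun _ n => n.natAbs) = ∑ x ∈ s, (F x).natAbs := fun F s hs =>
      Finsupp.sum_of_support_subset _ hs _ (by simp)
    set s := insert e (f.support ∪ f'.support)
    rw [hsum f s (by intro x hx; simp [s] at hx ⊢; tauto)]
    rw [hsum f' s (by intro x hx; simp only [s, Finset.mem_insert, Finset.mem_union]; tauto)] at h1
    have hes : e ∈ s := by simp [s]
    rw [← Finset.add_sum_erase _ _ hes] at h1 ⊢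
    have h2 : ∀ x ∈ s.erase e, (f x).natAbs = (f' x).natAbs := by
      intro x hx
      have : e ≠ x := (Finset.ne_of_mem_erase hx).symm
      simp [hf', this]
    rw [Finset.sum_congr rfl h2]
    have h3 : (f e).natAbs = (f' e).natAbs + 1 := by
      have he := hf e
      rw [List.count_cons, List.count_cons] at he
      rw [hf', Finsupp.sub_apply, Finsupp.single_eq_same, he]
      cases b <;> simp only [Bool.not_true, Bool.not_false] at hz <;> simp [hz, sgn] <;> omega
    rw [List.length_cons, ← h1, h3]
    ring

theorem len_one : len (1 : RAAG Γ) = 0 := by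
  have := len_ev_le (Γ := Γ) []
  simpa using this

theorem len_eq_zero {g : RAAG Γ} (h : len g = 0) : g = 1 := by
  obtain ⟨L, rfl, hL⟩ := exists_geodesic g
  rw [h, List.length_eq_zero_iff] at hL
  simp [hL]

theorem len_mul_le (g h : RAAG Γ) : len (g * h) ≤ len g + len h := by
  obtain ⟨L, rfl, hL⟩ := exists_geodesic g
  obtain ⟨L', rfl, hL'⟩ := exists_geodesic h
  rw [← ev_append, ← hL, ← hL', ← List.length_append]
  exact len_ev_le _

theorem len_inv (g : RAAG Γ) : len g⁻¹ = len g := by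
  suffices ∀ g : RAAG Γ, len g⁻¹ ≤ len g from
    le_antisymm (this g) (by simpa using this g⁻¹)
  intro g
  obtain ⟨L, rfl, hL⟩ := exists_geodesic g
  rw [← hL]
  clear hL
  induction L with
  | nil => simp [len_one]
  | cons s L ih =>
    rw [ev_cons, mul_inv_rev]
    refine (len_mul_le _ _).trans ?_
    have : (ltr Γ s)⁻¹ = ev Γ [(s.1, !s.2)] := by
      obtain ⟨v, b⟩ := s
      cases b <;> simp [ltr]
    rw [this]
    have := len_ev_le (Γ := Γ) [(s.1, !s.2)]
    simp at this ⊢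
    omega

end Words

section Parabolics

variable {V : Type} {Γ : SimpleGraph V}

/-- `h` has minimal length in its double coset. -/
def DMin (Γ : SimpleGraph V) (R R' : Set V) (h : RAAG Γ) : Prop :=
  ∀ a ∈ standardSub Γ R, ∀ b ∈ standardSub Γ R', len h ≤ len (a * h * b)

theorem exists_dMin (R R' : Set V) (h : RAAG Γ) :
    ∃ a ∈ standardSub Γ R, ∃ b ∈ standardSub Γ R', ∃ h', h = a * h' * b ∧ DMin Γ R R' h' := by
  classical
  have hex : ∃ n, ∃ a ∈ standardSub Γ R, ∃ b ∈ standardSub Γ R', len (a * h * b) = n :=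
    ⟨_, 1, one_mem _, 1, one_mem _, rfl⟩
  obtain ⟨a, ha, b, hb, hab⟩ := Nat.find_spec hex
  refine ⟨a⁻¹, inv_mem ha, b⁻¹, inv_mem hb, a * h * b, by group, fun a' ha' b' hb' => ?_⟩
  rw [hab]
  exact Nat.find_min' hex ⟨a' * a, mul_mem ha' ha, b * b', mul_mem hb hb', by group⟩

theorem DMin.core {R R' : Set V} {h : RAAG Γ} (hh : DMin Γ R R' h) (L : List (V × Bool)) :
    Geo Γ L → ev Γ L ∈ standardSub Γ R → h⁻¹ * ev Γ L * h ∈ standardSub Γ R' →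
    ∀ s ∈ L, s.1 ∈ R ∩ R' ∧ h ∈ lkSub Γ s.1 := by
  induction L with
  | nil => intro _ _ _ s hs; simp at hs
  | cons s L ih =>
    intro hgeo hR hR'
    have hsR : ∀ t ∈ s :: L, t.1 ∈ R := hgeo.letters_of_mem hR
    obtain ⟨Lh, rfl, hLh⟩ := exists_geo h
    obtain ⟨Lg, hLgR, hLg⟩ := exists_word_of_mem hR'
    set h := ev Γ Lh with hdef
    have hL : ev Γ L ∈ standardSub Γ R := ev_mem fun t ht => hsR t (by simp [ht])
    have hs : ltr Γ s ∈ standardSub Γ R := ltr_mem (hsR s (by simp))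
    -- the wall of the first letter occurs with one sign only
    have h1 : (wl Γ s, s.2) ∈ edg Γ ((s :: L) ++ Lh) := by simp [edg]
    have h2 : (wl Γ s, !s.2) ∉ edg Γ ((s :: L) ++ Lh) := by
      intro hm
      rw [edg_append, List.mem_append] at hm
      rcases hm with hm | hm
      · have := hgeo.no_opp _ _ _ (show (wl Γ s, s.2) ∈ edg Γ (s :: L) by simp [edg]) hm
        revert this; cases s.2 <;> simp
      · obtain ⟨⟨e, b⟩, he, heq⟩ := List.mem_map.1 hm
        obtain ⟨Z0, t, U, rfl, h4⟩ := mem_edg he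
        simp only [Prod.mk.injEq] at h4 heq
        obtain ⟨rfl, rfl⟩ := h4
        have h5 := wl_opp (Γ := Γ) (s := s) (t := t) (p := ev Γ L * ev Γ Z0)
          (by rw [← heq.1]; simp [mul_smul]) (by rw [heq.2]; cases s.2 <;> simp)
        have h6 : ((ev Γ L)⁻¹ * (ltr Γ s * ev Γ L)) * h * 1 = ev Γ (Z0 ++ U) := by
          simp only [hdef, ev_append, ev_cons, mul_one]
          have : ltr Γ s * ev Γ L * ev Γ Z0 * ltr Γ t = ev Γ L * ev Γ Z0 := by
            simpa [mul_assoc] using h5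
          calc (ev Γ L)⁻¹ * (ltr Γ s * ev Γ L) * (ev Γ Z0 * (ltr Γ t * ev Γ U))
              = (ev Γ L)⁻¹ * (ltr Γ s * ev Γ L * ev Γ Z0 * ltr Γ t) * ev Γ U := by
                simp only [mul_assoc]
            _ = _ := by rw [this]; group
        have h7 := hh _ (mul_mem (inv_mem hL) (mul_mem hs hL)) 1 (one_mem _)
        rw [h6, hdef, ← hLh] at h7
        have h8 := h7.trans (len_ev_le _)
        simp at h8
    have h3 := Geo.fox_sgn h1 h2
    have h4 : ev Γ ((s :: L) ++ Lh) = ev Γ (Lh ++ Lg) := by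
      rw [ev_append, ev_append, hLg, ← hdef]; group
    rw [h4] at h3
    have h5 := mem_edg_of_fox h3
    have hkey : s.1 ∈ R' ∧ h ∈ lkSub Γ s.1 := by
      rw [edg_append, List.mem_append] at h5
      rcases h5 with hm | hm
      · exfalso
        obtain ⟨Z0, t, U, rfl, h6⟩ := mem_edg hm
        simp only [Prod.mk.injEq] at h6
        have hts : s = t := Prod.ext (wl_eq_fst h6.1) h6.2
        subst hts
        have h7 := lkSub_commute_ltr (wl_same h6.1)
        have h8 := hh _ (inv_mem hs) 1 (one_mem _)
        have h9 : (ltr Γ s)⁻¹ * h * 1 = ev Γ (Z0 ++ U) := by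
          simp only [hdef, ev_append, ev_cons, mul_one]
          rw [← mul_assoc (ev Γ Z0), h7, mul_assoc, inv_mul_cancel_left]
        rw [h9, hdef, ← hLh] at h8
        have h10 := h8.trans (len_ev_le _)
        simp at h10
      · obtain ⟨⟨e, b⟩, he, heq⟩ := List.mem_map.1 hm
        obtain ⟨Z0, t, U, rfl, h6⟩ := mem_edg he
        simp only [Prod.mk.injEq] at h6 heq
        obtain ⟨rfl, rfl⟩ := h6
        have h7 : wl Γ s = (h * ev Γ Z0) • wl Γ t := by rw [mul_smul]; exact heq.1.symm
        have hts : s = t := Prod.ext (wl_eq_fst h7) heq.2.symm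
        subst hts
        refine ⟨hLgR s (by simp), ?_⟩
        have h8 : h * ev Γ Z0 ∈ lkSub Γ s.1 := wl_same h7
        have hq : ev Γ Z0 ∈ standardSub Γ R' := ev_mem fun t ht => hLgR t (by simp [ht])
        set S := Γ.neighborSet s.1
        have h9 : 1 * h * (ev Γ Z0 * (ret Γ S (ev Γ Z0))⁻¹) = ret Γ S h := by
          have := ret_eq_self h8
          rw [map_mul] at this
          rw [one_mul, ← mul_assoc, ← this, mul_inv_cancel_right]
        have h10 := hh 1 (one_mem _) _ (mul_mem hq (inv_mem (ret_mem_of_mem (S := S) hq)))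
        rw [h9] at h10
        exact ev_mem (hLh.letters h10)
    have hcomm := lkSub_commute_ltr hkey.2
    have h11 := ih hgeo.tail hL (by
      have : h⁻¹ * ev Γ L * h = (ltr Γ s)⁻¹ * (h⁻¹ * ev Γ (s :: L) * h) := by
        have h12 : h⁻¹ * ltr Γ s = ltr Γ s * h⁻¹ := by
          rw [inv_mul_eq_iff_eq_mul, ← mul_assoc, hcomm]; group
        rw [ev_cons, ← mul_assoc h⁻¹, h12]
        group
      rw [this]
      exact mul_mem (inv_mem (ltr_mem hkey.1)) hR')
    intro t ht
    rcases List.mem_cons.1 ht with rfl | ht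
    · exact ⟨⟨hsR t (by simp), hkey.1⟩, hkey.2⟩
    · exact h11 t ht

/-- The intersection of two parabolic subgroups is contained in a parabolic subgroup of smaller
type, unless they are conjugate by an element of the normalizer. -/
theorem parabolic_inter (R R' : Set V) (h : RAAG Γ) :
    ∃ Z ⊆ R ∩ R', ∃ k : RAAG Γ,
      (∀ g ∈ standardSub Γ R, h⁻¹ * g * h ∈ standardSub Γ R' → k⁻¹ * g * k ∈ standardSub Γ Z) ∧
      (Z = R → R = R' → h ∈ standardSub Γ (R ∪ perp Γ R)) := by
  obtain ⟨a, ha, b, hb, h', rfl, hmin⟩ := exists_dMin R R' h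
  refine ⟨{r | r ∈ R ∩ R' ∧ h' ∈ lkSub Γ r}, fun r hr => hr.1, a, ?_, ?_⟩
  · intro g hg hg'
    obtain ⟨L, hL, hLg⟩ := exists_geo (a⁻¹ * g * a)
    rw [← hL]
    refine ev_mem (hmin.core L hLg ?_ ?_)
    · rw [hL]; exact mul_mem (mul_mem (inv_mem ha) hg) ha
    · rw [hL]
      have := mul_mem (mul_mem hb hg') (inv_mem hb)
      have h2 : b * ((a * h' * b)⁻¹ * g * (a * h' * b)) * b⁻¹ = h'⁻¹ * (a⁻¹ * g * a) * h' := by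
        group
      rwa [h2] at this
  · intro hZ hRR
    subst hRR
    have h1 : h' ∈ standardSub Γ (⋂ r : R, Γ.neighborSet r) :=
      mem_iInter_standardSub fun r => by
        have : r.1 ∈ {r | r ∈ R ∩ R ∧ h' ∈ lkSub Γ r} := by
          rw [hZ]; exact r.2
        exact this.2
    have h2 : (⋂ r : R, Γ.neighborSet (r : V)) ⊆ perp Γ R := by
      intro v hv
      rw [Set.mem_iInter] at hv
      exact ⟨fun hvR => Γ.irrefl (hv ⟨v, hvR⟩), fun u hu => (hv ⟨u, hu⟩).symm⟩
    have hR : standardSub Γ R ≤ standardSub Γ (R ∪ perp Γ R) :=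
      standardSub_mono Set.subset_union_left
    exact mul_mem (mul_mem (hR ha)
      (standardSub_mono (h2.trans Set.subset_union_right) h1)) (hR hb)

end Parabolics

section Roots

variable {V : Type} {Γ : SimpleGraph V}

/-- The value of a positive word. -/
def pev (Γ : SimpleGraph V) (L : List V) : RAAG Γ := ev Γ (L.map fun v => (v, true))

@[simp] theorem pev_nil : pev Γ [] = 1 := rfl
@[simp] theorem pev_cons (v : V) (L : List V) : pev Γ (v :: L) = gen Γ v * pev Γ L := by
  simp [pev, ltr]

theorem fox_pev_nonneg (L : List V) (e : Wall Γ) : 0 ≤ fox (pev Γ L) e := by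
  classical
  have : (edg Γ (L.map fun v => (v, true))).count (e, false) = 0 := by
    refine List.count_eq_zero.2 fun h => ?_
    obtain ⟨L0, s, L1, h1, h2⟩ := mem_edg h
    have : s ∈ L.map fun v => (v, true) := by rw [h1]; simp
    obtain ⟨v, -, rfl⟩ := List.mem_map.1 this
    simp at h2
  rw [pev, fox_ev, this]
  simp

/-- The total degree homomorphism. -/
def deg (Γ : SimpleGraph V) : RAAG Γ →* Multiplicative ℤ :=
  raagLift (fun _ => Multiplicative.ofAdd 1) fun _ _ _ => rfl

/-- The base wall of a vertex. -/
abbrev bw (Γ : SimpleGraph V) (v : V) : Wall Γ := ⟨v, QuotientGroup.mk 1⟩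

open Classical in
/-- The nilpotent operator associated to a vertex. -/
noncomputable def nilOp (Γ : SimpleGraph V) (v : V) : Module.End ℤ (RAAG Γ →₀ ℤ) :=
  Finsupp.linearCombination ℤ fun g =>
    if (∃ L, pev Γ L = g) ∧ fox g (bw Γ v) = 0 then Finsupp.single (gen Γ v * g) 1 else 0

theorem nilOp_pev {v : V} {L : List V} (h : fox (pev Γ L) (bw Γ v) = 0) (n : ℤ) :
    nilOp Γ v (Finsupp.single (pev Γ L) n) = Finsupp.single (pev Γ (v :: L)) n := by
  simp [nilOp, h]

theorem nilOp_pev_zero {v : V} {L : List V} (h : fox (pev Γ L) (bw Γ v) ≠ 0) (n : ℤ) :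
    nilOp Γ v (Finsupp.single (pev Γ L) n) = 0 := by
  simp [nilOp, h]

theorem nilOp_not_pev {v : V} {g : RAAG Γ} (h : ¬ ∃ L, pev Γ L = g) (n : ℤ) :
    nilOp Γ v (Finsupp.single g n) = 0 := by
  simp only [nilOp, Finsupp.linearCombination_single, h, false_and, if_false, smul_zero]

theorem fox_gen_mul (v : V) (g : RAAG Γ) (e : Wall Γ) :
    fox (gen Γ v * g) e = Finsupp.single (bw Γ v) 1 e + fox g ((gen Γ v)⁻¹ • e) := by
  rw [fox_mul]
  have : gen Γ v = ltr Γ (v, true) := by simp [ltr]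
  conv_lhs => rw [this, fox_ltr]
  simp [sgn, wl, ltr]

theorem nilOp_sq (v : V) : nilOp Γ v * nilOp Γ v = 0 := by
  refine Finsupp.lhom_ext fun g n => ?_
  by_cases hg : ∃ L, pev Γ L = g
  · obtain ⟨L, rfl⟩ := hg
    by_cases h : fox (pev Γ L) (bw Γ v) = 0
    · rw [Module.End.mul_apply, nilOp_pev h, nilOp_pev_zero]
      · rfl
      · rw [pev_cons, fox_gen_mul, Finsupp.single_eq_same]
        have := fox_pev_nonneg L ((gen Γ v)⁻¹ • bw Γ v)
        omega
    · rw [Module.End.mul_apply, nilOp_pev_zero h]; simp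
  · rw [Module.End.mul_apply, nilOp_not_pev hg]; simp

theorem nilOp_comm {u v : V} (huv : Γ.Adj u v) : nilOp Γ u * nilOp Γ v = nilOp Γ v * nilOp Γ u := by
  have key : ∀ {u v : V}, Γ.Adj u v → ∀ g, fox (gen Γ v * g) (bw Γ u) = fox g (bw Γ u) := by
    intro u v h g
    rw [fox_gen_mul, Finsupp.single_eq_of_ne, zero_add]
    · congr 1
      refine congrArg (Sigma.mk u) ?_
      show QuotientGroup.mk ((gen Γ v)⁻¹ * 1) = QuotientGroup.mk 1
      rw [QuotientGroup.eq, mul_one, mul_one, inv_inv]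
      exact gen_mem_standardSub h
    · intro h'
      have : u = v := congrArg Sigma.fst h'
      exact h.ne this
  refine Finsupp.lhom_ext fun g n => ?_
  by_cases hg : ∃ L, pev Γ L = g
  · obtain ⟨L, rfl⟩ := hg
    rw [Module.End.mul_apply, Module.End.mul_apply]
    have h1 := key huv (pev Γ L)
    have h2 := key huv.symm (pev Γ L)
    rw [← pev_cons] at h1 h2
    by_cases hu : fox (pev Γ L) (bw Γ u) = 0 <;> by_cases hv : fox (pev Γ L) (bw Γ v) = 0
    · rw [nilOp_pev hu, nilOp_pev hv, nilOp_pev (h1.trans hu), nilOp_pev (h2.trans hv)]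
      congr 1
      simp only [pev_cons, ← mul_assoc, gen_comm huv]
    · rw [nilOp_pev hu, nilOp_pev_zero hv, nilOp_pev_zero (h2.trans_ne hv), map_zero]
    · rw [nilOp_pev hv, nilOp_pev_zero hu, nilOp_pev_zero (h1.trans_ne hu), map_zero]
    · rw [nilOp_pev_zero hv, nilOp_pev_zero hu, map_zero, map_zero]
  · simp [Module.End.mul_apply, nilOp_not_pev hg]

/-- The Magnus unit associated to a vertex. -/
noncomputable def magUnit (Γ : SimpleGraph V) (v : V) : (Module.End ℤ (RAAG Γ →₀ ℤ))ˣ where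
  val := 1 + nilOp Γ v
  inv := 1 - nilOp Γ v
  val_inv := by
    have := nilOp_sq (Γ := Γ) v
    rw [mul_sub, mul_one, add_mul, one_mul, this]; abel
  inv_val := by
    have := nilOp_sq (Γ := Γ) v
    rw [mul_add, mul_one, sub_mul, one_mul, this]; abel

/-- The Magnus representation. -/
noncomputable def magnus (Γ : SimpleGraph V) : RAAG Γ →* (Module.End ℤ (RAAG Γ →₀ ℤ))ˣ :=
  raagLift (magUnit Γ) fun u v h => by
    ext1
    simp only [Units.val_mul, magUnit]
    have := nilOp_comm h
    simp only [mul_add, add_mul, one_mul, mul_one, this]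
    abel

theorem magnus_gen_zpow (v : V) (e : ℤ) :
    ((magnus Γ (gen Γ v ^ e) : (Module.End ℤ (RAAG Γ →₀ ℤ))ˣ) : Module.End ℤ (RAAG Γ →₀ ℤ)) =
      1 + e • nilOp Γ v := by
  have h1 : (magnus Γ (gen Γ v)) = magUnit Γ v := by simp [magnus]
  have hsq := nilOp_sq (Γ := Γ) v
  have hmul : ∀ a b : ℤ, (1 + a • nilOp Γ v) * (1 + b • nilOp Γ v) = 1 + (a + b) • nilOp Γ v := by
    intro a b
    simp only [mul_add, add_mul, one_mul, mul_one, smul_mul_smul_comm, hsq, add_smul, smul_zero]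
    abel
  induction e using Int.induction_on with
  | zero => simp
  | succ n ih =>
    rw [zpow_add_one, map_mul, Units.val_mul, ih, h1]
    have : (magUnit Γ v : Module.End ℤ (RAAG Γ →₀ ℤ)) = 1 + (1 : ℤ) • nilOp Γ v := by
      simp [magUnit]
    rw [this, hmul]
  | pred n ih =>
    rw [zpow_sub_one, map_mul, Units.val_mul, ih, map_inv, h1]
    have : ((magUnit Γ v)⁻¹ : (Module.End ℤ (RAAG Γ →₀ ℤ))ˣ).val = 1 + (-1 : ℤ) • nilOp Γ v := by
      rw [neg_one_smul, ← sub_eq_add_neg]; rfl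
    rw [this, hmul]
    rfl

/-- The value of a syllable word. -/
def sv (Γ : SimpleGraph V) (L : List (V × ℤ)) : RAAG Γ := (L.map fun s => gen Γ s.1 ^ s.2).prod

theorem sv_cons (s : V × ℤ) (L : List (V × ℤ)) : sv Γ (s :: L) = gen Γ s.1 ^ s.2 * sv Γ L := by
  simp [sv]

theorem sv_append (L L' : List (V × ℤ)) : sv Γ (L ++ L') = sv Γ L * sv Γ L' := by simp [sv]

/-- A syllable word of minimal length. -/
def SMin (Γ : SimpleGraph V) (L : List (V × ℤ)) : Prop :=
  ∀ L', sv Γ L' = sv Γ L → L.length ≤ L'.length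

theorem SMin.tail {s : V × ℤ} {L : List (V × ℤ)} (h : SMin Γ (s :: L)) : SMin Γ L := by
  intro L' hL'
  have := h (s :: L') (by rw [sv_cons, sv_cons, hL'])
  simpa using this

theorem exists_sMin (g : RAAG Γ) : ∃ L, sv Γ L = g ∧ SMin Γ L := by
  classical
  have hex : ∃ n, ∃ L, sv Γ L = g ∧ L.length = n := by
    obtain ⟨L, rfl⟩ := exists_word g
    refine ⟨_, L.map fun s => (s.1, sgn s.2), ?_, rfl⟩
    simp only [sv, ev, List.map_map]
    congr 2
    ext ⟨v, b⟩
    cases b <;> simp [ltr, sgn]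
  obtain ⟨L, h1, h2⟩ := Nat.find_spec hex
  exact ⟨L, h1, fun L' h' => h2 ▸ Nat.find_min' hex ⟨L', h'.trans h1, rfl⟩⟩

theorem pev_fst_mem_lk {v : V} {L : List V} (h : pev Γ L ∈ lkSub Γ v) :
    ∀ w ∈ L, Γ.Adj v w := by
  intro w hw
  by_contra hn
  have h1 := expo_eq_one_of_mem (S := Γ.neighborSet v) (v := w) hn h
  have h2 : ∀ L : List V, 0 ≤ Multiplicative.toAdd (expo Γ w (pev Γ L)) ∧
      (w ∈ L → 0 < Multiplicative.toAdd (expo Γ w (pev Γ L))) := by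
    intro L
    induction L with
    | nil => simp
    | cons u L ih =>
      rw [pev_cons, map_mul, toAdd_mul]
      by_cases h : u = w
      · subst h
        rw [expo_gen_self, toAdd_ofAdd]
        exact ⟨by omega, fun _ => by omega⟩
      · rw [expo_gen_ne h, toAdd_one, zero_add]
        refine ⟨ih.1, fun hm => ih.2 ?_⟩
        rcases List.mem_cons.1 hm with rfl | h'
        · exact absurd rfl h
        · exact h'
  have h3 := (h2 L).2 hw
  rw [h1] at h3
  simp at h3

theorem SMin.fox_eq_zero {s : V × ℤ} {L : List (V × ℤ)} (h : SMin Γ (s :: L)) :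
    fox (pev Γ (L.map Prod.fst)) (bw Γ s.1) = 0 := by
  by_contra hne
  have hpos := lt_of_le_of_ne (fox_pev_nonneg (L.map Prod.fst) (bw Γ s.1)) (Ne.symm hne)
  have hm := mem_edg_of_fox (b := true) (L := (L.map Prod.fst).map fun v => (v, true))
    (e := bw Γ s.1) (by
      show 0 < sgn true * fox (pev Γ (L.map Prod.fst)) _
      simpa [sgn] using hpos)
  obtain ⟨L0, t, L1, h1, h2⟩ := mem_edg hm
  simp only [Prod.mk.injEq] at h2
  obtain ⟨A, B, rfl, rfl, hB⟩ := List.map_eq_append_iff.1 ((List.map_map ..).symm.trans h1)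
  obtain ⟨r, C, rfl, rfl, rfl⟩ := List.map_eq_cons_iff.1 hB
  have hst : s.1 = r.1 := congrArg Sigma.fst h2.1
  have hw : wl Γ (r.1, true) = bw Γ s.1 := by simp [wl, hst]
  have h3 : ev Γ (A.map ((fun v => (v, true)) ∘ Prod.fst)) ∈ lkSub Γ s.1 := by
    have := wl_same (Γ := Γ) (s := (r.1, true)) (by rw [hw]; rw [← hw]; exact hw.trans h2.1)
    simpa [hst] using this
  have h4 : ∀ w ∈ A.map Prod.fst, Γ.Adj s.1 w :=
    pev_fst_mem_lk (by rw [pev, List.map_map]; exact h3)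
  have h5 : sv Γ A ∈ lkSub Γ s.1 := by
    refine Subgroup.list_prod_mem _ fun x hx => ?_
    obtain ⟨a, ha, rfl⟩ := List.mem_map.1 hx
    exact zpow_mem (gen_mem_standardSub (h4 _ (List.mem_map_of_mem ha))) _
  have h6 : Commute (sv Γ A) (gen Γ s.1 ^ s.2) :=
    (show Commute (sv Γ A) (gen Γ s.1) from lkSub_commute h5).zpow_right _
  have h7 := h (A ++ (s.1, s.2 + r.2) :: C) (by
    simp only [sv_cons, sv_append, zpow_add, ← hst]
    rw [← mul_assoc, ← mul_assoc, ← mul_assoc, ← mul_assoc, h6.eq])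
  simp at h7

theorem SMin.snd_ne_zero {s : V × ℤ} {L : List (V × ℤ)} (h : SMin Γ (s :: L)) : s.2 ≠ 0 := by
  intro h0
  have := h L (by rw [sv_cons, h0]; simp)
  simp at this

/-- The degree filtration. -/
def degFil (Γ : SimpleGraph V) (n : ℤ) : Submodule ℤ (RAAG Γ →₀ ℤ) :=
  Finsupp.supported ℤ ℤ {g | n ≤ Multiplicative.toAdd (deg Γ g)}

theorem deg_gen_mul (v : V) (g : RAAG Γ) : Multiplicative.toAdd (deg Γ (gen Γ v * g)) =
    1 + Multiplicative.toAdd (deg Γ g) := by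
  simp [deg]

theorem deg_pev (L : List V) : Multiplicative.toAdd (deg Γ (pev Γ L)) = L.length := by
  induction L with
  | nil => simp
  | cons v L ih => rw [pev_cons, deg_gen_mul, ih, List.length_cons]; push_cast; ring

theorem nilOp_degFil (v : V) (n : ℤ) (f : RAAG Γ →₀ ℤ) (hf : f ∈ degFil Γ n) :
    nilOp Γ v f ∈ degFil Γ (n + 1) := by
  rw [nilOp, Finsupp.linearCombination_apply]
  refine Submodule.sum_mem _ fun g hg => Submodule.smul_mem _ _ ?_
  have hg' : n ≤ Multiplicative.toAdd (deg Γ g) := hf hg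
  split_ifs
  · refine Finsupp.single_mem_supported ℤ _ ?_
    rw [Set.mem_ofPred_eq, deg_gen_mul]
    omega
  · exact zero_mem _

theorem SMin.magnus_apply {L : List (V × ℤ)} (h : SMin Γ L) :
    (magnus Γ (sv Γ L)).val (Finsupp.single 1 1) (pev Γ (L.map Prod.fst)) ≠ 0 ∧
    ∀ g, (magnus Γ (sv Γ L)).val (Finsupp.single 1 1) g ≠ 0 → g ≠ pev Γ (L.map Prod.fst) →
      Multiplicative.toAdd (deg Γ g) < L.length := by
  classical
  induction L with
  | nil =>
    simp only [sv, List.map_nil, List.prod_nil, map_one, Units.val_one, Module.End.one_apply,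
      pev_nil]
    refine ⟨by simp, fun g hg hg1 => absurd ?_ hg⟩
    exact Finsupp.single_eq_of_ne hg1
  | cons s L ih =>
    obtain ⟨ih1, ih2⟩ := ih h.tail
    have hfox := h.fox_eq_zero
    have hs := h.snd_ne_zero
    set F := (magnus Γ (sv Γ L)).val (Finsupp.single 1 1) with hF
    set π := pev Γ (L.map Prod.fst) with hπ
    have hπd : Multiplicative.toAdd (deg Γ π) = L.length := by rw [hπ, deg_pev]; simp
    set F' := F - Finsupp.single π (F π) with hF'
    have hlow : ∀ g, F' g ≠ 0 → Multiplicative.toAdd (deg Γ g) < L.length := by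
      intro g hg
      by_cases hgπ : g = π
      · subst hgπ; simp [hF'] at hg
      · refine ih2 g ?_ hgπ
        simpa [hF', Finsupp.single_apply, Ne.symm hgπ] using hg
    have hlow' : ∀ g, nilOp Γ s.1 F' g ≠ 0 → Multiplicative.toAdd (deg Γ g) < L.length + 1 := by
      intro g hg
      rw [nilOp, Finsupp.linearCombination_apply, Finsupp.sum, Finsupp.finsetSum_apply] at hg
      obtain ⟨g', hg', hne⟩ := Finset.exists_ne_zero_of_sum_ne_zero hg
      have h1 := hlow g' (Finsupp.mem_support_iff.1 hg')
      by_cases hc : (∃ L, pev Γ L = g') ∧ fox g' (bw Γ s.1) = 0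
      · rw [if_pos hc, Finsupp.smul_apply, Finsupp.single_apply] at hne
        by_cases he : gen Γ s.1 * g' = g
        · rw [← he, deg_gen_mul]; omega
        · simp [he] at hne
      · simp [if_neg hc] at hne
    have hval : (magnus Γ (sv Γ (s :: L))).val (Finsupp.single 1 1) =
        F + s.2 • (Finsupp.single (gen Γ s.1 * π) (F π) + nilOp Γ s.1 F') := by
      have h1 : nilOp Γ s.1 F = Finsupp.single (gen Γ s.1 * π) (F π) + nilOp Γ s.1 F' := by
        rw [hF', map_sub, hπ, nilOp_pev hfox, pev_cons]
        abel
      rw [sv_cons, map_mul, Units.val_mul, Module.End.mul_apply, magnus_gen_zpow, ← hF, ← h1]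
      simp
    have hFd : ∀ g, F g ≠ 0 → Multiplicative.toAdd (deg Γ g) < L.length + 1 := by
      intro g hg
      by_cases hgπ : g = π
      · rw [hgπ, hπd]; omega
      · have := ih2 g hg hgπ; omega
    have hz1 : F (gen Γ s.1 * π) = 0 := by
      by_contra hne
      have := hFd _ hne
      rw [deg_gen_mul, hπd] at this; omega
    have hz2 : nilOp Γ s.1 F' (gen Γ s.1 * π) = 0 := by
      by_contra hne
      have := hlow' _ hne
      rw [deg_gen_mul, hπd] at this; omega
    rw [hval, List.map_cons, pev_cons, ← hπ]
    refine ⟨?_, fun g hg hne => ?_⟩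
    · simp only [Finsupp.add_apply, Finsupp.smul_apply, Finsupp.single_eq_same, hz1, hz2, zero_add,
        add_zero, smul_eq_mul]
      exact mul_ne_zero hs ih1
    · rw [List.length_cons]
      push_cast
      by_contra hnl
      have hz3 : F g = 0 := by
        by_contra h'; exact hnl (hFd _ h')
      have hz4 : nilOp Γ s.1 F' g = 0 := by
        by_contra h'; exact hnl (hlow' _ h')
      simp [hz3, hz4, Ne.symm hne] at hg

theorem magnus_injective : Function.Injective (magnus Γ) := by
  rw [injective_iff_map_eq_one]
  intro g hg
  obtain ⟨L, rfl, hL⟩ := exists_sMin g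
  have h1 := hL.magnus_apply.1
  rw [hg, Units.val_one, Module.End.one_apply] at h1
  cases L with
  | nil => rfl
  | cons s L =>
    exfalso
    have h2 : pev Γ ((s :: L).map Prod.fst) = 1 := by
      by_contra hne
      exact h1 (Finsupp.single_eq_of_ne hne)
    have h4 := deg_pev (Γ := Γ) ((s :: L).map Prod.fst)
    rw [h2] at h4
    simp at h4
    omega

/-- Operators congruent to the identity for the degree filtration. -/
def unip (Γ : SimpleGraph V) (T : Module.End ℤ (RAAG Γ →₀ ℤ)) : Prop :=
  ∀ n, ∀ f ∈ degFil Γ n, T f - f ∈ degFil Γ (n + 1)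

theorem degFil_mono {m n : ℤ} (h : m ≤ n) : degFil Γ n ≤ degFil Γ m :=
  Finsupp.supported_mono fun _ hg => h.trans hg

theorem unip.mul {S T : Module.End ℤ (RAAG Γ →₀ ℤ)} (hS : unip Γ S) (hT : unip Γ T) :
    unip Γ (S * T) := by
  intro n f hf
  have h1 := hT n f hf
  have h2 : T f ∈ degFil Γ n := by
    have := add_mem (degFil_mono (by omega) h1) hf
    simpa using this
  have h3 := hS n _ h2
  have := add_mem h3 h1
  simpa using this

theorem unip_magnus (g : RAAG Γ) : unip Γ (magnus Γ g).val := by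
  obtain ⟨L, rfl, -⟩ := exists_sMin g
  induction L with
  | nil => intro n f _; simp [sv]
  | cons s L ih =>
    rw [sv_cons, map_mul, Units.val_mul]
    refine unip.mul ?_ ih
    intro n f hf
    rw [magnus_gen_zpow]
    simpa using Submodule.smul_mem _ s.2 (nilOp_degFil s.1 n f hf)

/-- Right-angled Artin groups have unique roots. -/
theorem raag_root {s t : RAAG Γ} {k : ℕ} (hk : 0 < k) (h : s ^ k = t ^ k) : s = t := by
  apply magnus_injective
  ext1
  set T := (magnus Γ s).val with hT
  set T' := (magnus Γ t).val with hT'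
  have hu : unip Γ T := unip_magnus s
  have hu' : unip Γ T' := unip_magnus t
  have hup : ∀ m, unip Γ (T' ^ m) := by
    intro m
    rw [hT', ← Units.val_pow_eq_pow_val, ← map_pow]
    exact unip_magnus _
  have hpow : T ^ k = T' ^ k := by
    rw [hT, hT', ← Units.val_pow_eq_pow_val, ← Units.val_pow_eq_pow_val, ← map_pow, ← map_pow, h]
  have key : ∀ j : ℕ, ∀ n, ∀ f ∈ degFil Γ n, T f - T' f ∈ degFil Γ (n + 1 + j) := by
    intro j
    induction j with
    | zero =>
      intro n f hf
      have := sub_mem (hu n f hf) (hu' n f hf)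
      simpa using this
    | succ j ih =>
      have hm : ∀ m : ℕ, ∀ n, ∀ f ∈ degFil Γ n,
          (T ^ m) f - (T' ^ m) f - m • (T f - T' f) ∈ degFil Γ (n + 1 + (j + 1)) := by
        intro m n f hf
        induction m with
        | zero => simp
        | succ m ihm =>
          have h1 : (T ^ m) f - (T' ^ m) f ∈ degFil Γ (n + 1 + j) := by
            have := add_mem (degFil_mono (by omega) ihm)
              (nsmul_mem (ih n f hf) m)
            simpa using this
          have h2 := hu _ _ h1
          have h3 := ih (n + 1) _ (hup m n f hf)
          have h4 := add_mem (add_mem ihm (degFil_mono (by omega) h2))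
            (degFil_mono (show n + 1 + ((j:ℤ) + 1) ≤ n + 1 + 1 + j by omega) h3)
          convert h4 using 1
          rw [pow_succ', pow_succ', Module.End.mul_apply, Module.End.mul_apply, succ_nsmul]
          simp only [map_sub]
          abel
      intro n f hf
      have h1 := hm k n f hf
      rw [hpow, sub_self, zero_sub, neg_mem_iff] at h1
      intro g hg
      have h2 := h1 (a := g) (Finsupp.mem_support_iff.2 (by
        rw [Finsupp.smul_apply]
        exact smul_ne_zero hk.ne' (Finsupp.mem_support_iff.1 hg)))
      simpa using h2
  refine LinearMap.ext fun f => ?_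
  obtain ⟨n, hn⟩ : ∃ n : ℤ, f ∈ degFil Γ n := by
    obtain ⟨n, hn⟩ := (f.support.image fun g => Multiplicative.toAdd (deg Γ g)).bddBelow
    exact ⟨n, fun g hg => hn (by simpa using ⟨g, by simpa using hg, rfl⟩)⟩
  rw [← sub_eq_zero]
  by_contra hne
  obtain ⟨g, hg⟩ := Finsupp.support_nonempty_iff.2 hne
  obtain ⟨j, hj⟩ := exists_nat_gt (Multiplicative.toAdd (deg Γ g) - n)
  have : n + 1 + j ≤ Multiplicative.toAdd (deg Γ g) := key j n f hn hg
  omega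

theorem raag_torsionFree {s : RAAG Γ} {k : ℕ} (hk : 0 < k) (h : s ^ k = 1) : s = 1 :=
  raag_root hk (by rw [h, one_pow])

theorem raag_commute_of_pow {a b : RAAG Γ} {k : ℕ} (hk : 0 < k) (h : Commute a (b ^ k)) :
    Commute a b := by
  have : a * b * a⁻¹ = b := raag_root hk (by
    rw [conj_pow, h.eq, mul_inv_cancel_right])
  exact mul_inv_eq_iff_eq_mul.1 this

end Roots

section Connectivity

/-- The integral Heisenberg group. -/
@[ext] structure Heis where
  p : ℤ
  q : ℤ
  r : ℤ

instance : Mul Heis := ⟨fun a b => ⟨a.p + b.p, a.q + b.q, a.r + b.r + a.p * b.q⟩⟩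
instance : One Heis := ⟨⟨0, 0, 0⟩⟩
instance : Inv Heis := ⟨fun a => ⟨-a.p, -a.q, -a.r + a.p * a.q⟩⟩

theorem Heis.mul_def (a b : Heis) : a * b = ⟨a.p + b.p, a.q + b.q, a.r + b.r + a.p * b.q⟩ := rfl
theorem Heis.one_def : (1 : Heis) = ⟨0, 0, 0⟩ := rfl
theorem Heis.inv_def (a : Heis) : a⁻¹ = ⟨-a.p, -a.q, -a.r + a.p * a.q⟩ := rfl

instance : Group Heis :=
  Group.ofLeftAxioms
    (fun a b c => by simp only [Heis.mul_def, Heis.mk.injEq]; refine ⟨?_, ?_, ?_⟩ <;> ring)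
    (fun a => by simp [Heis.mul_def, Heis.one_def])
    (fun a => by simp [Heis.mul_def, Heis.one_def, Heis.inv_def])

/-- First coordinate. -/
def Heis.fstHom : Heis →* Multiplicative ℤ where
  toFun a := Multiplicative.ofAdd a.p
  map_one' := rfl
  map_mul' _ _ := rfl

/-- Second coordinate. -/
def Heis.sndHom : Heis →* Multiplicative ℤ where
  toFun a := Multiplicative.ofAdd a.q
  map_one' := rfl
  map_mul' _ _ := rfl

variable {V W : Type} {Γ : SimpleGraph V} {Δ : SimpleGraph W}

theorem expo_pairing {a b : W} (hab : ¬ Δ.Adj a b) (hne : a ≠ b) {g h : RAAG Δ}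
    (hgh : g * h = h * g) :
    Multiplicative.toAdd (expo Δ a g) * Multiplicative.toAdd (expo Δ b h) =
      Multiplicative.toAdd (expo Δ a h) * Multiplicative.toAdd (expo Δ b g) := by
  classical
  let φ : RAAG Δ →* Heis := raagLift
    (fun u => if u = a then ⟨1, 0, 0⟩ else if u = b then ⟨0, 1, 0⟩ else 1) (by
      intro u v huv
      by_cases h1 : u = a <;> by_cases h2 : v = a
      · simp [h1, h2]
      · by_cases h3 : v = b
        · subst h1; subst h3; exact absurd huv hab
        · simp [h2, h3]
      · by_cases h3 : u = b
        · subst h2; subst h3; exact absurd huv.symm hab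
        · simp [h1, h3]
      · by_cases h3 : u = b <;> by_cases h4 : v = b <;> simp [h1, h2, h3, h4])
  have hp : ∀ g, (φ g).p = Multiplicative.toAdd (expo Δ a g) := by
    have : Heis.fstHom.comp φ = expo Δ a := by
      refine raag_hom_ext fun u => ?_
      by_cases h1 : u = a
      · subst h1; simp [φ, expo, Heis.fstHom]
      · by_cases h2 : u = b
        · subst h2; simp [φ, expo, Heis.fstHom, h1]
        · simp [φ, expo, h1, h2]
    intro g
    rw [← this]; rfl
  have hq : ∀ g, (φ g).q = Multiplicative.toAdd (expo Δ b g) := by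
    have : Heis.sndHom.comp φ = expo Δ b := by
      refine raag_hom_ext fun u => ?_
      by_cases h1 : u = a
      · subst h1; simp [φ, expo, Heis.sndHom, hne]
      · by_cases h2 : u = b
        · subst h2; simp [φ, expo, Heis.sndHom, h1]
        · simp [φ, expo, h1, h2]
    intro g
    rw [← this]; rfl
  have h1 : φ g * φ h = φ h * φ g := by rw [← map_mul, ← map_mul, hgh]
  have h2 := congrArg Heis.r h1
  simp only [Heis.mul_def] at h2
  rw [← hp, ← hp, ← hq, ← hq]
  linarith

theorem hom_eq_one_of_expo [Finite W] (f : RAAG Δ →* Multiplicative ℤ) {h : RAAG Δ}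
    (hh : ∀ w, expo Δ w h = 1) : f h = 1 := by
  classical
  have := Fintype.ofFinite W
  let F : RAAG Δ →* Multiplicative ℤ :=
    ∏ w, (zpowGroupHom (Multiplicative.toAdd (f (gen Δ w)))).comp (expo Δ w)
  have hF : F = f := by
    refine raag_hom_ext fun u => ?_
    simp only [F, MonoidHom.finsetProd_apply, MonoidHom.comp_apply, zpowGroupHom_apply]
    rw [Finset.prod_eq_single u]
    · rw [expo_gen_self, ← ofAdd_zsmul]; simp
    · intro w _ hw
      rw [expo_gen_ne (Ne.symm hw), one_zpow]
    · simp
  rw [← hF]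
  simp only [F, MonoidHom.finsetProd_apply, MonoidHom.comp_apply, hh, map_one,
    Finset.prod_const_one]

/-- Connectedness of the defining graph is an isomorphism invariant. -/
theorem closed_of_connected [Finite W] [Nontrivial V] (hΓ : Γ.Connected)
    (e : RAAG Γ ≃* RAAG Δ) {S : Set W}
    (hS : ∀ u ∈ S, ∀ w, Δ.Adj u w → w ∈ S) {a b : W} (ha : a ∈ S) (hb : b ∉ S) : False := by
  classical
  set x : V → W → ℤ := fun v w => Multiplicative.toAdd (expo Δ w (e (gen Γ v))) with hx
  have hpair : ∀ u v, Γ.Adj u v → ∀ s ∈ S, ∀ t ∉ S, x u s * x v t = x v s * x u t := by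
    intro u v huv s hs t ht
    refine expo_pairing (fun h => ht (hS s hs t h)) (fun h => ht (h ▸ hs)) ?_
    rw [← map_mul, ← map_mul, gen_comm huv]
  have hprop : ∀ u v, u ≠ v → ∀ α β : ℤ, α ≠ 0 → ¬ ∀ w, α * x v w = β * x u w := by
    intro u v huv α β hα h
    have h1 : ∀ w, expo Δ w (e (gen Γ v ^ α * gen Γ u ^ (-β))) = 1 := by
      intro w
      rw [← toAdd_eq_zero]
      simp only [map_mul, map_zpow, toAdd_mul, toAdd_zpow, smul_eq_mul]
      have := h w
      simp only [hx] at this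
      linarith
    have h2 := hom_eq_one_of_expo ((expo Γ v).comp e.symm.toMonoidHom) h1
    rw [← toAdd_eq_zero] at h2
    simp [expo_gen_self, expo_gen_ne huv] at h2
    exact hα h2
  have hdich : ∀ u, (∀ s ∈ S, x u s = 0) ∨ ∀ t ∉ S, x u t = 0 := by
    intro u
    by_contra! hcon
    obtain ⟨⟨a0, ha0, hxa⟩, ⟨b0, hb0, hxb⟩⟩ := hcon
    obtain ⟨v, huv⟩ := hΓ.preconnected.exists_adj_of_nontrivial u
    refine hprop u v huv.ne (x u b0) (x v b0) hxb fun w => ?_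
    by_cases hw : w ∈ S
    · have := hpair u v huv w hw b0 hb0
      linarith
    · have h1 := hpair u v huv a0 ha0 w hw
      have h2 := hpair u v huv a0 ha0 b0 hb0
      refine mul_left_cancel₀ hxa ?_
      linear_combination (x u b0) * h1 - (x u w) * h2
  have hnot : ∀ u, ¬ ((∀ s ∈ S, x u s = 0) ∧ ∀ t ∉ S, x u t = 0) := by
    rintro u ⟨h1, h2⟩
    obtain ⟨v, huv⟩ := hΓ.preconnected.exists_adj_of_nontrivial u
    refine hprop v u huv.ne.symm 1 0 one_ne_zero fun w => ?_
    by_cases hw : w ∈ S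
    · simp [h1 w hw]
    · simp [h2 w hw]
  have hfin : ∀ w, ¬ ∀ v, x v w = 0 := by
    intro w hcon
    have : (expo Δ w).comp e.toMonoidHom = 1 := by
      refine raag_hom_ext fun v => ?_
      have := hcon v
      simpa [hx] using this
    have h2 := DFunLike.congr_fun this (e.symm (gen Δ w))
    simp [expo_gen_self] at h2
  have hwalk : ∀ P : V → Prop, (∀ u v, Γ.Adj u v → P u → P v) → ∀ u, P u → ∀ v, P v := by
    intro P hP u hu v
    obtain ⟨p⟩ := hΓ.preconnected u v
    induction p with
    | nil => exact hu
    | cons h _ ih => exact ih (hP _ _ h hu)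
  obtain ⟨u0⟩ := hΓ.nonempty
  rcases hdich u0 with h0 | h0
  · refine hfin a fun v => hwalk (fun u => ∀ s ∈ S, x u s = 0) ?_ u0 h0 v a ha
    intro u v huv hu s hs
    have h1 : ∃ t ∉ S, x u t ≠ 0 := by
      by_contra! hcon
      exact hnot u ⟨hu, hcon⟩
    obtain ⟨t, ht, hne⟩ := h1
    have := hpair u v huv s hs t ht
    rw [hu s hs, zero_mul] at this
    exact (mul_eq_zero.1 this.symm).resolve_right hne
  · refine hfin b fun v => hwalk (fun u => ∀ t ∉ S, x u t = 0) ?_ u0 h0 v b hb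
    intro u v huv hu t ht
    have h1 : ∃ s ∈ S, x u s ≠ 0 := by
      by_contra! hcon
      exact hnot u ⟨hcon, hu⟩
    obtain ⟨s, hs, hne⟩ := h1
    have := hpair u v huv s hs t ht
    rw [hu t ht, mul_zero] at this
    exact (mul_eq_zero.1 this).resolve_left hne

theorem preconnected_transfer [Finite W] [Nontrivial V] (hΓ : Γ.Connected)
    (e : RAAG Γ ≃* RAAG Δ) : Δ.Preconnected := by
  intro a b
  by_contra h
  exact closed_of_connected hΓ e (S := {w | Δ.Reachable a w})
    (fun u hu w huw => SimpleGraph.Reachable.trans hu huw.reachable)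
    (SimpleGraph.Reachable.refl a) h

end Connectivity

section CountableMeasurability

variable {X : Type*} [MeasurableSpace X] {D E F : Type*}

/-- Measurability of a map to a discrete set. -/
def Cm (φ : X → D) : Prop := ∀ d, MeasurableSet {x | φ x = d}

theorem Cm.preimage [Countable D] {φ : X → D} (hφ : Cm φ) (s : Set D) :
    MeasurableSet {x | φ x ∈ s} := by
  have : {x | φ x ∈ s} = ⋃ d ∈ s, {x | φ x = d} := by ext; simp
  rw [this]
  exact MeasurableSet.biUnion s.to_countable fun d _ => hφ d

theorem Cm.meas_bind [Countable D] {β : Type*} [MeasurableSpace β] {φ : X → D} (hφ : Cm φ)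
    {F : D → X → β} (hF : ∀ d, Measurable (F d)) : Measurable fun x => F (φ x) x := by
  intro s hs
  have : (fun x => F (φ x) x) ⁻¹' s = ⋃ d, {x | φ x = d} ∩ F d ⁻¹' s := by ext; simp
  rw [this]
  exact MeasurableSet.iUnion fun d => (hφ d).inter (hF d hs)

theorem Cm.bind [Countable D] {φ : X → D} (hφ : Cm φ)
    {F : D → X → E} (hF : ∀ d, Cm (F d)) : Cm fun x => F (φ x) x := by
  intro e
  have : {x | F (φ x) x = e} = ⋃ d, {x | φ x = d} ∩ {x | F d x = e} := by ext; simp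
  rw [this]
  exact MeasurableSet.iUnion fun d => (hφ d).inter (hF d e)

theorem Cm.const (d : D) : Cm fun _ : X => d := fun _ => MeasurableSet.const _

theorem Cm.comp [Countable D] {φ : X → D} (hφ : Cm φ) (f : D → E) : Cm fun x => f (φ x) :=
  hφ.bind fun d => Cm.const (f d)

theorem Cm.comp₂ [Countable D] [Countable E] {φ : X → D} {ψ : X → E} (hφ : Cm φ) (hψ : Cm ψ)
    (f : D → E → F) : Cm fun x => f (φ x) (ψ x) :=
  hφ.bind fun d => hψ.comp (f d)

theorem Cm.comp_meas {Y : Type*} [MeasurableSpace Y] {φ : X → D} (hφ : Cm φ) {T : Y → X}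
    (hT : Measurable T) : Cm fun y => φ (T y) := fun d => hT (hφ d)

theorem Cm.set₂ [Countable D] [Countable E] {φ : X → D} {ψ : X → E} (hφ : Cm φ) (hψ : Cm ψ)
    (P : D → E → Prop) : MeasurableSet {x | P (φ x) (ψ x)} := by
  have := hφ.comp₂ hψ P
  have h : {x | P (φ x) (ψ x)} = {x | P (φ x) (ψ x) = True} := by ext; simp
  rw [h]; exact this _

theorem Cm.measurable [Countable D] {β : Type*} [MeasurableSpace β] {φ : X → D} (hφ : Cm φ)
    (f : D → β) : Measurable fun x => f (φ x) := hφ.meas_bind fun _ => measurable_const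

/-- A countable valued map which is invariant under an ergodic transformation is constant. -/
theorem Cm.ergodic_const [Countable D] {μ : Measure X} [IsProbabilityMeasure μ] {T : X → X}
    (hT : Ergodic T μ) {φ : X → D} (hφ : Cm φ) (h : ∀ᵐ x ∂μ, φ (T x) = φ x) :
    ∃ d, ∀ᵐ x ∂μ, φ x = d := by
  by_contra hc
  push Not at hc
  have h0 : ∀ d, μ {x | φ x = d} = 0 := by
    intro d
    have h1 : T ⁻¹' {x | φ x = d} =ᵐ[μ] {x | φ x = d} := by
      filter_upwards [h] with x hx
      simp only [Set.preimage, eq_iff_iff]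
      show φ (T x) = d ↔ φ x = d
      rw [hx]
    rcases hT.quasiErgodic.ae_empty_or_univ₀ (hφ d).nullMeasurableSet h1 with h2 | h2
    · simpa using measure_congr h2
    · exact absurd (by filter_upwards [h2] with x hx; exact not_not.2 (hx.mpr trivial)) (hc d)
  have : μ Set.univ = 0 := by
    have : (Set.univ : Set X) = ⋃ d, {x | φ x = d} := by ext; simp
    rw [this]; exact measure_iUnion_null h0
  simp at this

/-- Poincaré recurrence for countable valued maps. -/
theorem Cm.recurrent [Countable D] {μ : Measure X} [IsProbabilityMeasure μ] {T : X → X}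
    (hT : MeasurePreserving T μ μ) {φ : X → D} (hφ : Cm φ) (τ : D → D)
    (h : ∀ᵐ x ∂μ, φ (T x) = τ (φ x)) :
    ∀ᵐ x ∂μ, ∃ n, 0 < n ∧ τ^[n] (φ x) = φ x := by
  have h1 : ∀ n, ∀ᵐ x ∂μ, φ (T^[n] x) = τ^[n] (φ x) := by
    intro n
    induction n with
    | zero => simp
    | succ n ih =>
      filter_upwards [ih, (hT.iterate n).quasiMeasurePreserving.ae h] with x hx hx'
      rw [Function.iterate_succ_apply', Function.iterate_succ_apply', hx', hx]
  have h2 : ∀ d, ∀ᵐ x ∂μ, φ x = d → ∃ᶠ n in Filter.atTop, φ (T^[n] x) = d := fun d => by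
    have := hT.conservative.ae_mem_imp_frequently_image_mem (hφ d).nullMeasurableSet
    exact this
  filter_upwards [ae_all_iff.2 h1, ae_all_iff.2 h2] with x hx hx'
  obtain ⟨n, hn, hn'⟩ := (Filter.frequently_atTop.1 (hx' (φ x) rfl)) 1
  exact ⟨n, hn, by rw [← hx n, hn']⟩

end CountableMeasurability

section AbsDiff

/-- The distance `|a - b|` in `ℝ≥0∞`. -/
noncomputable def ad (a b : ℝ≥0∞) : ℝ≥0∞ := max (a - b) (b - a)

theorem ad_le_iff {a b e : ℝ≥0∞} : ad a b ≤ e ↔ a ≤ e + b ∧ b ≤ e + a := by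
  simp [ad, tsub_le_iff_right]

theorem le_ad_add (a b : ℝ≥0∞) : a ≤ ad a b + b := (ad_le_iff.1 le_rfl).1
theorem le_ad_add' (a b : ℝ≥0∞) : b ≤ ad a b + a := (ad_le_iff.1 le_rfl).2

theorem ad_comm (a b : ℝ≥0∞) : ad a b = ad b a := max_comm _ _

@[simp] theorem ad_self (a : ℝ≥0∞) : ad a a = 0 := by simp [ad]

theorem ad_triangle (a b c : ℝ≥0∞) : ad a c ≤ ad a b + ad b c := by
  rw [ad_le_iff]
  constructor
  · calc a ≤ ad a b + b := le_ad_add _ _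
      _ ≤ ad a b + (ad b c + c) := by gcongr; exact le_ad_add _ _
      _ = _ := by ring
  · calc c ≤ ad b c + b := le_ad_add' _ _
      _ ≤ ad b c + (ad a b + a) := by gcongr; exact le_ad_add' _ _
      _ = _ := by ring

theorem ad_mul_le (a b a' b' : ℝ≥0∞) : ad (a * b) (a' * b') ≤ ad a a' * b + a' * ad b b' := by
  refine (ad_triangle _ (a' * b) _).trans ?_
  gcongr
  · rw [ad_le_iff, ← add_mul, ← add_mul]
    exact ⟨by gcongr; exact le_ad_add _ _, by gcongr; exact le_ad_add' _ _⟩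
  · rw [ad_le_iff, ← mul_add, ← mul_add]
    exact ⟨by gcongr; exact le_ad_add _ _, by gcongr; exact le_ad_add' _ _⟩

theorem ad_mul_right_le (a a' b : ℝ≥0∞) : ad (a * b) (a' * b) ≤ ad a a' * b := by
  simpa using ad_mul_le a b a' b

theorem ad_tsum_le {ι : Type*} (f g : ι → ℝ≥0∞) :
    ad (∑' i, f i) (∑' i, g i) ≤ ∑' i, ad (f i) (g i) := by
  rw [ad_le_iff, ← ENNReal.tsum_add, ← ENNReal.tsum_add]
  exact ⟨ENNReal.tsum_le_tsum fun i => le_ad_add _ _, ENNReal.tsum_le_tsum fun i => le_ad_add' _ _⟩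

theorem ad_le_add (a b : ℝ≥0∞) : ad a b ≤ a + b :=
  ad_le_iff.2 ⟨by rw [add_assoc]; exact le_self_add, by rw [add_assoc, add_comm, add_assoc]; exact le_self_add⟩

theorem Measurable.ad {X : Type*} [MeasurableSpace X] {f g : X → ℝ≥0∞} (hf : Measurable f)
    (hg : Measurable g) : Measurable fun x => ad (f x) (g x) :=
  (hf.sub hg).max (hg.sub hf)

end AbsDiff

/-- Equivariant maps with prescribed invariant properties exist as soon as stabilizers allow. -/
theorem exists_equivariant {M A B : Type*} [Group M] (pA : M →* Equiv.Perm A)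
    (pB : M →* Equiv.Perm B) (P : A → B → Prop)
    (hP : ∀ m a b, P a b → P (pA m a) (pB m b))
    (h : ∀ a, ∃ b, P a b ∧ ∀ m, pA m a = a → pB m b = b) :
    ∃ j : A → B, (∀ m a, j (pA m a) = pB m (j a)) ∧ ∀ a, P a (j a) := by
  classical
  let s : Setoid A := ⟨fun a a' => ∃ m, pA m a = a', ⟨fun a => ⟨1, by simp⟩,
    fun {a b} ⟨m, hm⟩ => ⟨m⁻¹, by rw [← hm, ← Equiv.Perm.mul_apply, ← map_mul]; simp⟩,
    fun {a b c} ⟨m, hm⟩ ⟨n, hn⟩ => ⟨n * m, by rw [map_mul, Equiv.Perm.mul_apply, hm, hn]⟩⟩⟩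
  have hr : ∀ a, ∃ m, pA m (Quotient.out (Quotient.mk s a)) = a :=
    fun a => Quotient.exact (Quotient.out_eq (Quotient.mk s a))
  choose f hf hf' using h
  choose m hm using hr
  have key : ∀ a n, pA n (Quotient.out (Quotient.mk s a)) = a →
      pB (m a) (f (Quotient.out (Quotient.mk s a))) = pB n (f (Quotient.out (Quotient.mk s a))) := by
    intro a n hn
    have := hf' (Quotient.out (Quotient.mk s a)) (n⁻¹ * m a) (by
      rw [map_mul, Equiv.Perm.mul_apply, hm, map_inv, Equiv.Perm.inv_eq_iff_eq]; exact hn.symm)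
    rw [map_mul, Equiv.Perm.mul_apply, map_inv, Equiv.Perm.inv_eq_iff_eq] at this
    exact this
  refine ⟨fun a => pB (m a) (f (Quotient.out (Quotient.mk s a))), fun n a => ?_, fun a => ?_⟩
  · have h1 : Quotient.mk s (pA n a) = Quotient.mk s a := (Quotient.sound ⟨n, rfl⟩ : Quotient.mk s a = _).symm
    have h2 := key (pA n a) (n * m a) (by rw [h1, map_mul, Equiv.Perm.mul_apply, hm])
    beta_reduce
    rw [h2, h1, map_mul, Equiv.Perm.mul_apply]
  · have := hP (m a) _ _ (hf (Quotient.out (Quotient.mk s a)))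
    rwa [hm] at this

section RandomMeasures

variable {X : Type*} [MeasurableSpace X] {μ : Measure X} {D E F : Type*}

/-- A random probability measure on a countable set. -/
structure RM (μ : Measure X) (ζ : X → D → ℝ≥0∞) : Prop where
  meas : ∀ k, Measurable fun x => ζ x k
  sum : ∀ᵐ x ∂μ, ∑' k, ζ x k = 1

/-- The invariance defect of a random measure under a skew transformation. -/
noncomputable def err (μ : Measure X) (T : X → X) (σ : X → Equiv.Perm D)
    (ζ : X → D → ℝ≥0∞) : ℝ≥0∞ :=
  ∫⁻ x, ∑' k, ad (ζ (T x) (σ x k)) (ζ x k) ∂μ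

/-- The integral of a function against a random measure. -/
noncomputable def wt (μ : Measure X) (f : X → D → ℝ≥0∞) (ζ : X → D → ℝ≥0∞) : ℝ≥0∞ :=
  ∫⁻ x, ∑' k, f x k * ζ x k ∂μ

open Classical in
/-- The indicator of a proposition. -/
noncomputable def ind (P : Prop) : ℝ≥0∞ := if P then 1 else 0

theorem ind_true {P : Prop} (h : P) : ind P = 1 := by simp [ind, h]
theorem ind_false {P : Prop} (h : ¬ P) : ind P = 0 := by simp [ind, h]
theorem ind_le_one (P : Prop) : ind P ≤ 1 := by unfold ind; split_ifs <;> simp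
theorem ind_mono {P Q : Prop} (h : P → Q) : ind P ≤ ind Q := by
  by_cases hP : P
  · rw [ind_true hP, ind_true (h hP)]
  · rw [ind_false hP]; exact zero_le
theorem ind_le_add {P Q R : Prop} (h : P → Q ∨ R) : ind P ≤ ind Q + ind R := by
  by_cases hP : P
  · rcases h hP with h | h
    · rw [ind_true h]; exact (ind_le_one P).trans le_self_add
    · rw [ind_true h]; exact (ind_le_one P).trans le_add_self
  · rw [ind_false hP]; exact zero_le
theorem ind_mul (P Q : Prop) : ind (P ∧ Q) = ind P * ind Q := by
  by_cases hP : P <;> by_cases hQ : Q <;> simp [ind, hP, hQ]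
theorem ind_add_not (P : Prop) : ind P + ind (¬ P) = 1 := by
  by_cases hP : P <;> simp [ind, hP]

theorem measurable_ind {P : X → Prop} (h : MeasurableSet {x | P x}) :
    Measurable fun x => ind (P x) := by
  classical
  have : (fun x => ind (P x)) = Set.indicator {x | P x} 1 := by
    ext x; by_cases hx : P x <;> simp [ind, hx]
  rw [this]
  exact measurable_one.indicator h

theorem lintegral_ind {P : X → Prop} (h : MeasurableSet {x | P x}) :
    ∫⁻ x, ind (P x) ∂μ = μ {x | P x} := by
  classical
  have : (fun x => ind (P x)) = Set.indicator {x | P x} 1 := by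
    ext x; by_cases hx : P x <;> simp [ind, hx]
  rw [this, lintegral_indicator_one h]

theorem tsum_ind_mul (f : D → ℝ≥0∞) (d : D) : ∑' k, ind (d = k) * f k = f d := by
  rw [tsum_eq_single d]
  · rw [ind_true rfl, one_mul]
  · intro k hk; rw [ind_false hk.symm, zero_mul]

theorem tsum_mul_ind (f : D → ℝ≥0∞) (d : D) : ∑' k, f k * ind (d = k) = f d := by
  rw [← tsum_ind_mul f d]; exact tsum_congr fun k => mul_comm _ _

/-- Push-forward of a random measure. -/
noncomputable def push (j : X → D → E) (ζ : X → D → ℝ≥0∞) : X → E → ℝ≥0∞ :=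
  fun x e => ∑' k, ind (j x k = e) * ζ x k

theorem tsum_mul_push (j : X → D → E) (ζ : X → D → ℝ≥0∞) (f : E → ℝ≥0∞) (x : X) :
    ∑' e, f e * push j ζ x e = ∑' k, f (j x k) * ζ x k := by
  simp_rw [push, ← ENNReal.tsum_mul_left]
  rw [ENNReal.tsum_comm]
  refine tsum_congr fun k => ?_
  simp_rw [← mul_assoc]
  rw [ENNReal.tsum_mul_right, tsum_mul_ind]

theorem wt_push (j : X → D → E) (ζ : X → D → ℝ≥0∞) (f : X → E → ℝ≥0∞) :
    wt μ f (push j ζ) = wt μ (fun x k => f x (j x k)) ζ :=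
  lintegral_congr fun x => tsum_mul_push j ζ (f x) x

theorem RM.push [Countable D] {ζ : X → D → ℝ≥0∞} (hζ : RM μ ζ) {j : X → D → E}
    (hj : ∀ k, Cm fun x => j x k) : RM μ (push j ζ) where
  meas e := by
    refine Measurable.tsum fun k => ?_
    exact (measurable_ind (hj k e)).mul (hζ.meas k)
  sum := by
    filter_upwards [hζ.sum] with x hx
    have := tsum_mul_push j ζ (fun _ => 1) x
    simpa [hx] using this

/-- Product of random measures. -/
noncomputable def prd (ζ : X → D → ℝ≥0∞) (ξ : X → E → ℝ≥0∞) : X → D × E → ℝ≥0∞ :=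
  fun x p => ζ x p.1 * ξ x p.2

theorem tsum_prd (ζ : X → D → ℝ≥0∞) (ξ : X → E → ℝ≥0∞) (f : D × E → ℝ≥0∞) (x : X) :
    ∑' p, f p * prd ζ ξ x p = ∑' k, (∑' e, f (k, e) * ξ x e) * ζ x k := by
  rw [ENNReal.tsum_prod']
  refine tsum_congr fun k => ?_
  rw [← ENNReal.tsum_mul_right]
  exact tsum_congr fun e => by simp only [prd]; ring

theorem RM.prd {ζ : X → D → ℝ≥0∞} {ξ : X → E → ℝ≥0∞} (hζ : RM μ ζ) (hξ : RM μ ξ) :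
    RM μ (prd ζ ξ) where
  meas p := (hζ.meas _).mul (hξ.meas _)
  sum := by
    filter_upwards [hζ.sum, hξ.sum] with x hx hx'
    have := tsum_prd ζ ξ (fun _ => 1) x
    simpa [hx, hx'] using this

theorem wt_mono {f g : X → D → ℝ≥0∞} (h : ∀ᵐ x ∂μ, ∀ k, f x k ≤ g x k) (ζ : X → D → ℝ≥0∞) :
    wt μ f ζ ≤ wt μ g ζ := by
  refine lintegral_mono_ae ?_
  filter_upwards [h] with x hx
  exact ENNReal.tsum_le_tsum fun k => mul_le_mul_left (hx k) _

theorem measurable_wt [Countable D] {f : X → D → ℝ≥0∞} (hf : ∀ k, Measurable fun x => f x k)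
    {ζ : X → D → ℝ≥0∞} (hζ : RM μ ζ) : Measurable fun x => ∑' k, f x k * ζ x k :=
  Measurable.tsum fun k => (hf k).mul (hζ.meas k)

theorem wt_add [Countable D] {f g : X → D → ℝ≥0∞} (hf : ∀ k, Measurable fun x => f x k)
    {ζ : X → D → ℝ≥0∞} (hζ : RM μ ζ) :
    wt μ (fun x k => f x k + g x k) ζ = wt μ f ζ + wt μ g ζ := by
  unfold wt
  rw [← lintegral_add_left (measurable_wt hf hζ)]
  refine lintegral_congr fun x => ?_
  rw [← ENNReal.tsum_add]
  exact tsum_congr fun k => add_mul _ _ _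

theorem wt_const [IsProbabilityMeasure μ] {ζ : X → D → ℝ≥0∞} (hζ : RM μ ζ) (r : ℝ≥0∞) :
    wt μ (fun _ _ => r) ζ = r := by
  have : ∀ᵐ x ∂μ, ∑' k, r * ζ x k = r := by
    filter_upwards [hζ.sum] with x hx
    rw [ENNReal.tsum_mul_left, hx, mul_one]
  unfold wt
  rw [lintegral_congr_ae this]; simp

theorem wt_fiberwise {ζ : X → D → ℝ≥0∞} (hζ : RM μ ζ) (f : X → ℝ≥0∞) :
    wt μ (fun x _ => f x) ζ = ∫⁻ x, f x ∂μ := by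
  refine lintegral_congr_ae ?_
  filter_upwards [hζ.sum] with x hx
  rw [ENNReal.tsum_mul_left, hx, mul_one]

theorem wt_const_mul [Countable D] {f : X → D → ℝ≥0∞} (hf : ∀ k, Measurable fun x => f x k)
    {ζ : X → D → ℝ≥0∞} (hζ : RM μ ζ) (r : ℝ≥0∞) :
    wt μ (fun x k => r * f x k) ζ = r * wt μ f ζ := by
  unfold wt
  rw [← lintegral_const_mul _ (measurable_wt hf hζ)]
  refine lintegral_congr fun x => ?_
  rw [← ENNReal.tsum_mul_left]
  exact tsum_congr fun k => mul_assoc _ _ _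

theorem measurable_skew [Countable D] {T : X → X} (hT : Measurable T) {σ : X → Equiv.Perm D}
    (hσ : ∀ k, Cm fun x => σ x k) {ζ : X → D → ℝ≥0∞} (hζ : ∀ k, Measurable fun x => ζ x k) (k : D) :
    Measurable fun x => ζ (T x) (σ x k) :=
  (hσ k).meas_bind fun d => (hζ d).comp hT

theorem measurable_errInt [Countable D] {T : X → X} (hT : Measurable T) {σ : X → Equiv.Perm D}
    (hσ : ∀ k, Cm fun x => σ x k) {ζ : X → D → ℝ≥0∞} (hζ : RM μ ζ) :
    Measurable fun x => ∑' k, ad (ζ (T x) (σ x k)) (ζ x k) :=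
  Measurable.tsum fun k => Measurable.ad (measurable_skew hT hσ hζ.meas k) (hζ.meas k)

theorem err_push_le [Countable D] [Countable E] {T : X → X} (hT : Measurable T)
    {σ : X → Equiv.Perm D} (hσ : ∀ k, Cm fun x => σ x k) {ζ : X → D → ℝ≥0∞} (hζ : RM μ ζ)
    (τ : X → Equiv.Perm E) (j : X → D → E) :
    err μ T τ (push j ζ) ≤ err μ T σ ζ +
      2 * wt μ (fun x k => ind (j (T x) (σ x k) ≠ τ x (j x k))) ζ := by
  have h2 : 2 * wt μ (fun x k => ind (j (T x) (σ x k) ≠ τ x (j x k))) ζ ≥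
      ∫⁻ x, ∑' k, 2 * (ind (j (T x) (σ x k) ≠ τ x (j x k)) * ζ x k) ∂μ := by
    simp_rw [ENNReal.tsum_mul_left]
    rw [lintegral_const_mul' _ _ (by simp)]
    exact le_rfl
  refine le_trans ?_ (add_le_add_right h2 _)
  unfold err
  rw [← lintegral_add_left (measurable_errInt hT hσ hζ)]
  refine lintegral_mono fun x => ?_
  have key : ∀ e, ad (push j ζ (T x) (τ x e)) (push j ζ x e) ≤
      ∑' k, (ind (j (T x) (σ x k) = τ x e) * ad (ζ (T x) (σ x k)) (ζ x k) +
        ad (ind (j (T x) (σ x k) = τ x e)) (ind (τ x (j x k) = τ x e)) * ζ x k) := by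
    intro e
    have e1 : push j ζ (T x) (τ x e) = ∑' k, ind (j (T x) (σ x k) = τ x e) * ζ (T x) (σ x k) :=
      ((σ x).tsum_eq fun k => ind (j (T x) k = τ x e) * ζ (T x) k).symm
    have e2 : push j ζ x e = ∑' k, ind (τ x (j x k) = τ x e) * ζ x k := by
      simp only [push, EmbeddingLike.apply_eq_iff_eq]
    rw [e1, e2]
    refine (ad_tsum_le _ _).trans (ENNReal.tsum_le_tsum fun k => ?_)
    rw [mul_comm (ind _) (ζ (T x) _), mul_comm (ind _) (ζ x _)]
    refine (ad_mul_le _ _ _ _).trans (le_of_eq ?_)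
    ring
  refine (ENNReal.tsum_le_tsum key).trans ?_
  rw [ENNReal.tsum_comm, ← ENNReal.tsum_add]
  refine ENNReal.tsum_le_tsum fun k => ?_
  rw [ENNReal.tsum_add, ENNReal.tsum_mul_right, ENNReal.tsum_mul_right]
  have e3 : ∀ d, ∑' e, ind (d = τ x e) = 1 := fun d => by
    rw [(τ x).tsum_eq fun e => ind (d = e)]
    simpa using tsum_ind_mul (fun _ => 1) d
  rw [e3, one_mul, ← mul_assoc]
  gcongr
  by_cases h : j (T x) (σ x k) = τ x (j x k)
  · simp [h]
  · rw [ind_true h]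
    refine (ENNReal.tsum_le_tsum fun e => ad_le_add _ _).trans ?_
    rw [ENNReal.tsum_add, e3, e3]
    norm_num

theorem err_prd_le [Countable D] [Countable E] {T : X → X} (hT : MeasurePreserving T μ μ)
    {σ : X → Equiv.Perm D} (hσ : ∀ k, Cm fun x => σ x k) {τ : X → Equiv.Perm E}
    {ζ : X → D → ℝ≥0∞} (hζ : RM μ ζ) {ξ : X → E → ℝ≥0∞} (hξ : RM μ ξ) :
    err μ T (fun x => (σ x).prodCongr (τ x)) (prd ζ ξ) ≤ err μ T σ ζ + err μ T τ ξ := by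
  unfold err
  rw [← lintegral_add_left (measurable_errInt hT.measurable hσ hζ)]
  refine lintegral_mono_ae ?_
  filter_upwards [hζ.sum, hT.quasiMeasurePreserving.ae hξ.sum] with x h1 h2
  have : ∀ p : D × E, ad (prd ζ ξ (T x) ((σ x).prodCongr (τ x) p)) (prd ζ ξ x p) ≤
      ad (ζ (T x) (σ x p.1)) (ζ x p.1) * ξ (T x) (τ x p.2) +
        ζ x p.1 * ad (ξ (T x) (τ x p.2)) (ξ x p.2) := fun p => ad_mul_le _ _ _ _
  refine (ENNReal.tsum_le_tsum this).trans ?_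
  rw [ENNReal.tsum_add, ENNReal.tsum_prod', ENNReal.tsum_prod']
  simp only [ENNReal.tsum_mul_left, ENNReal.tsum_mul_right, h1, (τ x).tsum_eq, h2, mul_one, one_mul]
  exact le_rfl

theorem err_comp_le [Countable D] {T S : X → X} (hT : Measurable T) (hS : MeasurePreserving S μ μ)
    {σ τ : X → Equiv.Perm D} (hσ : ∀ k, Cm fun x => σ x k) (hτ : ∀ k, Cm fun x => τ x k)
    {ζ : X → D → ℝ≥0∞} (hζ : RM μ ζ) :
    err μ (fun x => T (S x)) (fun x => σ (S x) * τ x) ζ ≤ err μ T σ ζ + err μ S τ ζ := by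
  have h1 : err μ T σ ζ = ∫⁻ x, ∑' k, ad (ζ (T (S x)) (σ (S x) k)) (ζ (S x) k) ∂μ :=
    (hS.lintegral_comp (measurable_errInt hT hσ hζ)).symm
  rw [h1]
  unfold err
  rw [← lintegral_add_right _ (measurable_errInt hS.measurable hτ hζ)]
  refine lintegral_mono fun x => ?_
  rw [← (τ x).tsum_eq (fun k => ad (ζ (T (S x)) (σ (S x) k)) (ζ (S x) k)), ← ENNReal.tsum_add]
  exact ENNReal.tsum_le_tsum fun k => ad_triangle _ _ _

theorem err_congr {T S : X → X} {σ τ : X → Equiv.Perm D} {ζ : X → D → ℝ≥0∞}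
    (h : ∀ᵐ x ∂μ, T x = S x ∧ σ x = τ x) : err μ T σ ζ = err μ S τ ζ := by
  refine lintegral_congr_ae ?_
  filter_upwards [h] with x hx
  rw [hx.1, hx.2]

theorem err_inv [Countable D] {T S : X → X} (hT : MeasurePreserving T μ μ) (hS : Measurable S)
    (hST : ∀ x, S (T x) = x) {σ τ : X → Equiv.Perm D} (hτ : ∀ k, Cm fun x => τ x k)
    (h : ∀ᵐ x ∂μ, τ (T x) = (σ x)⁻¹) {ζ : X → D → ℝ≥0∞} (hζ : RM μ ζ) :
    err μ S τ ζ = err μ T σ ζ := by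
  unfold err
  rw [← hT.lintegral_comp (measurable_errInt hS hτ hζ)]
  refine lintegral_congr_ae ?_
  filter_upwards [h] with x hx
  rw [hx, hST, ← (σ x).tsum_eq]
  simp [ad_comm]

/-- Transport of a test function along a skew transformation. -/
theorem wt_transport_le [Countable D] {T : X → X} (hT : MeasurePreserving T μ μ)
    {σ : X → Equiv.Perm D} (hσ : ∀ k, Cm fun x => σ x k) {ζ : X → D → ℝ≥0∞} (hζ : RM μ ζ)
    {f : X → D → ℝ≥0∞} (hf : ∀ k, Measurable fun x => f x k) (hf1 : ∀ x k, f x k ≤ 1) :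
    wt μ (fun x k => f (T x) (σ x k)) ζ ≤ err μ T σ ζ + wt μ f ζ := by
  have h1 : wt μ f ζ = ∫⁻ x, ∑' k, f (T x) k * ζ (T x) k ∂μ :=
    (hT.lintegral_comp (measurable_wt hf hζ)).symm
  rw [h1]
  unfold err wt
  rw [← lintegral_add_left (measurable_errInt hT.measurable hσ hζ)]
  refine lintegral_mono fun x => ?_
  rw [← (σ x).tsum_eq (fun k => f (T x) k * ζ (T x) k), ← ENNReal.tsum_add]
  refine ENNReal.tsum_le_tsum fun k => ?_
  calc f (T x) (σ x k) * ζ x k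
      ≤ f (T x) (σ x k) * (ad (ζ (T x) (σ x k)) (ζ x k) + ζ (T x) (σ x k)) := by
        gcongr; exact le_ad_add' _ _
    _ ≤ _ := by
        rw [mul_add]; gcongr
        exact mul_le_of_le_one_left' (hf1 _ _)

/-- The translate of a random measure by a skew transformation. -/
noncomputable def tr (S : X → X) (τ : X → Equiv.Perm D) (ζ : X → D → ℝ≥0∞) : X → D → ℝ≥0∞ :=
  fun x k => ζ (S x) ((τ (S x))⁻¹ k)

theorem RM.tr [Countable D] {S : X → X} (hS : MeasurePreserving S μ μ) {τ : X → Equiv.Perm D}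
    (hτ : ∀ k, Cm fun x => (τ x)⁻¹ k) {ζ : X → D → ℝ≥0∞} (hζ : RM μ ζ) : RM μ (tr S τ ζ) where
  meas k := ((hτ k).comp_meas hS.measurable).meas_bind fun d => (hζ.meas d).comp hS.measurable
  sum := by
    filter_upwards [hS.quasiMeasurePreserving.ae hζ.sum] with x hx
    simp only [OEPaper.tr]
    rw [(τ (S x))⁻¹.tsum_eq, hx]

theorem wt_tr [Countable D] {T S : X → X} (hT : MeasurePreserving T μ μ)
    (hS : MeasurePreserving S μ μ)
    (hST : ∀ x, S (T x) = x) {τ : X → Equiv.Perm D} (hτ : ∀ k, Cm fun x => (τ x)⁻¹ k)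
    {ζ : X → D → ℝ≥0∞} (hζ : RM μ ζ) {f : X → D → ℝ≥0∞} (hf : ∀ k, Measurable fun x => f x k) :
    wt μ f (tr S τ ζ) = wt μ (fun x k => f (T x) (τ x k)) ζ := by
  unfold wt
  rw [← hT.lintegral_comp (measurable_wt hf (hζ.tr hS hτ))]
  refine lintegral_congr fun x => ?_
  rw [← (τ x).tsum_eq]
  simp [tr, hST]

theorem err_tr [Countable D] {T S R : X → X} (hT : MeasurePreserving T μ μ)
    (hS : MeasurePreserving S μ μ) (hR : Measurable R)
    (hST : ∀ x, S (T x) = x) {τ σ : X → Equiv.Perm D} (hτ : ∀ k, Cm fun x => (τ x)⁻¹ k)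
    (hσ : ∀ k, Cm fun x => σ x k) {ζ : X → D → ℝ≥0∞} (hζ : RM μ ζ)
    (h : ∀ᵐ x ∂μ, R (T x) = T (R x) ∧ σ (T x) * τ x = τ (R x) * σ x) :
    err μ R σ (tr S τ ζ) = err μ R σ ζ := by
  unfold err
  rw [← hT.lintegral_comp (measurable_errInt hR hσ (hζ.tr hS hτ))]
  refine lintegral_congr_ae ?_
  filter_upwards [h] with x hx
  rw [← (τ x).tsum_eq]
  refine tsum_congr fun k => ?_
  have : σ (T x) (τ x k) = τ (R x) (σ x k) := by
    rw [← Equiv.Perm.mul_apply, hx.2, Equiv.Perm.mul_apply]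
  simp [tr, this, hx.1, hST]

end RandomMeasures

section Reiter

variable {X : Type} [MeasurableSpace X] {μ : Measure X} {𝔾 : Type} [Group 𝔾] [MulAction 𝔾 X]
  {H K : Type} [Group H] [Group K] {D E : Type*}

/-- Random measures which are invariant up to `δ` under the elements of `A`. -/
structure AInv (μ : Measure X) (c : 𝔾 → X → H) (A : Set 𝔾) (τ : H →* Equiv.Perm D) (δ : ℝ≥0∞)
    (ζ : X → D → ℝ≥0∞) : Prop where
  rm : RM μ ζ
  err_le : ∀ a ∈ A, err μ (a • ·) (fun x => τ (c a x)) ζ ≤ δ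

theorem AInv.mono {c : 𝔾 → X → H} {A : Set 𝔾} {τ : H →* Equiv.Perm D} {δ δ' : ℝ≥0∞}
    {ζ : X → D → ℝ≥0∞} (h : AInv μ c A τ δ ζ) (hd : δ ≤ δ') : AInv μ c A τ δ' ζ :=
  ⟨h.rm, fun a ha => (h.err_le a ha).trans hd⟩

/-- Existence of almost invariant random measures. -/
def HasReiter (μ : Measure X) (c : 𝔾 → X → H) (A : Set 𝔾) (τ : H →* Equiv.Perm D) : Prop :=
  ∀ δ > 0, ∃ ζ, AInv μ c A τ δ ζ

theorem IsCocycle.cm {c : 𝔾 → X → H} (hc : IsCocycle 𝔾 X H μ c) (g : 𝔾) : Cm (c g) := hc.1 g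

theorem cm_perm [Countable H] {s : X → H} (hs : Cm s) (τ : H →* Equiv.Perm D) (k : D) :
    Cm fun x => τ (s x) k := hs.comp fun h => τ h k

theorem IsCocycle.one {c : 𝔾 → X → H} (hc : IsCocycle 𝔾 X H μ c) : ∀ᵐ x ∂μ, c 1 x = 1 := by
  filter_upwards [hc.2 1 1] with x hx
  simpa using hx

theorem IsCocycle.inv {c : 𝔾 → X → H} (hc : IsCocycle 𝔾 X H μ c) (g : 𝔾) :
    ∀ᵐ x ∂μ, c g⁻¹ (g • x) = (c g x)⁻¹ := by
  filter_upwards [hc.2 g⁻¹ g, hc.one] with x hx h1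
  rw [inv_mul_cancel, h1] at hx
  exact eq_inv_of_mul_eq_one_left hx.symm

theorem PmpAction.ae (hG : PmpAction 𝔾 X μ) {P : X → Prop} (h : ∀ᵐ x ∂μ, P x) (g : 𝔾) :
    ∀ᵐ x ∂μ, P (g • x) := (hG g).quasiMeasurePreserving.ae h

/-- Pushing almost invariant random measures by a family of maps that is equivariant up to a
small error. -/
theorem AInv.push_of_le [Countable D] [Countable E] [Countable H] (hG : PmpAction 𝔾 X μ)
    {c : 𝔾 → X → H} {c' : 𝔾 → X → K} {A : Set 𝔾} (hc : ∀ a ∈ A, Cm (c a))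
    {τ : H →* Equiv.Perm D} {τ' : K →* Equiv.Perm E} {δ δ' : ℝ≥0∞} {ζ : X → D → ℝ≥0∞}
    (h : AInv μ c A τ δ ζ) {j : X → D → E} (hj : ∀ k, Cm fun x => j x k)
    (hb : ∀ a ∈ A, wt μ (fun x k => ind (j (a • x) (τ (c a x) k) ≠ τ' (c' a x) (j x k))) ζ ≤ δ') :
    AInv μ c' A τ' (δ + 2 * δ') (push j ζ) where
  rm := h.rm.push hj
  err_le a ha := by
    refine (err_push_le (hG a).measurable (cm_perm (hc a ha) τ) h.rm _ j).trans ?_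
    gcongr
    · exact h.err_le a ha
    · exact hb a ha

theorem AInv.push [Countable D] [Countable E] [Countable H] (hG : PmpAction 𝔾 X μ)
    {c : 𝔾 → X → H} {c' : 𝔾 → X → K} {A : Set 𝔾} (hc : ∀ a ∈ A, Cm (c a))
    {τ : H →* Equiv.Perm D} {τ' : K →* Equiv.Perm E} {δ : ℝ≥0∞} {ζ : X → D → ℝ≥0∞}
    (h : AInv μ c A τ δ ζ) {j : X → D → E} (hj : ∀ k, Cm fun x => j x k)
    (hb : ∀ a ∈ A, ∀ᵐ x ∂μ, ∀ k, j (a • x) (τ (c a x) k) = τ' (c' a x) (j x k)) :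
    AInv μ c' A τ' δ (push j ζ) := by
  have := h.push_of_le (c' := c') (τ' := τ') (δ' := 0) hG hc hj fun a ha => by
    have : wt μ (fun x k => ind (j (a • x) (τ (c a x) k) ≠ τ' (c' a x) (j x k))) ζ
        ≤ wt μ (fun _ _ => 0) ζ := by
      refine wt_mono ?_ ζ
      filter_upwards [hb a ha] with x hx k
      rw [ind_false (by simp [hx k])]
    simpa [wt] using this
  simpa using this

theorem HasReiter.push [Countable D] [Countable E] [Countable H] (hG : PmpAction 𝔾 X μ)
    {c : 𝔾 → X → H} {c' : 𝔾 → X → K} {A : Set 𝔾} (hc : ∀ a ∈ A, Cm (c a))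
    {τ : H →* Equiv.Perm D} {τ' : K →* Equiv.Perm E}
    (h : HasReiter μ c A τ) {j : X → D → E} (hj : ∀ k, Cm fun x => j x k)
    (hb : ∀ a ∈ A, ∀ᵐ x ∂μ, ∀ k, j (a • x) (τ (c a x) k) = τ' (c' a x) (j x k)) :
    HasReiter μ c' A τ' := fun δ hδ =>
  let ⟨_, hζ⟩ := h δ hδ
  ⟨_, hζ.push hG hc hj hb⟩

/-- The cocycle `c` twisted by `φ`. -/
def gauge (φ : X → H) (c : 𝔾 → X → H) : 𝔾 → X → H := fun g x => φ (g • x) * c g x * (φ x)⁻¹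

theorem gauge_isCocycle [Countable H] (hG : PmpAction 𝔾 X μ) {φ : X → H} (hφ : Cm φ)
    {c : 𝔾 → X → H} (hc : IsCocycle 𝔾 X H μ c) : IsCocycle 𝔾 X H μ (gauge φ c) := by
  refine ⟨fun g => ?_, fun g g' => ?_⟩
  · exact ((hφ.comp_meas (hG g).measurable).comp₂ (hc.cm g) (· * ·)).comp₂ hφ fun a b => a * b⁻¹
  · filter_upwards [hc.2 g g'] with x hx
    simp only [gauge, hx, mul_smul]
    group

theorem gauge_gauge (φ ψ : X → H) (c : 𝔾 → X → H) :
    gauge φ (gauge ψ c) = gauge (fun x => φ x * ψ x) c := by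
  ext g x; simp only [gauge]; group

theorem gauge_inv_gauge (φ : X → H) (c : 𝔾 → X → H) :
    gauge (fun x => (φ x)⁻¹) (gauge φ c) = c := by
  ext g x; simp only [gauge]; group

theorem AInv.gauge [Countable D] [Countable H] (hG : PmpAction 𝔾 X μ)
    {c : 𝔾 → X → H} {A : Set 𝔾} (hc : ∀ a ∈ A, Cm (c a))
    {τ : H →* Equiv.Perm D} {δ : ℝ≥0∞} {ζ : X → D → ℝ≥0∞}
    (h : AInv μ c A τ δ ζ) {φ : X → H} (hφ : Cm φ) :
    AInv μ (gauge φ c) A τ δ (OEPaper.push (fun x k => τ (φ x) k) ζ) :=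
  h.push hG hc (fun k => cm_perm hφ τ k) fun a ha => by
    filter_upwards with x k
    simp only [OEPaper.gauge, ← Equiv.Perm.mul_apply, ← map_mul]
    congr 2; group

theorem HasReiter.gauge [Countable D] [Countable H] (hG : PmpAction 𝔾 X μ)
    {c : 𝔾 → X → H} {A : Set 𝔾} (hc : ∀ a ∈ A, Cm (c a))
    {τ : H →* Equiv.Perm D} (h : HasReiter μ c A τ) {φ : X → H} (hφ : Cm φ) :
    HasReiter μ (gauge φ c) A τ := fun δ hδ =>
  let ⟨_, hζ⟩ := h δ hδ
  ⟨_, hζ.gauge hG hc hφ⟩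

/-- The action on a product of two sets. -/
def prodPerm (τ : H →* Equiv.Perm D) (τ' : H →* Equiv.Perm E) : H →* Equiv.Perm (D × E) where
  toFun h := (τ h).prodCongr (τ' h)
  map_one' := by ext p <;> simp
  map_mul' g h := by ext p <;> simp

@[simp] theorem prodPerm_apply (τ : H →* Equiv.Perm D) (τ' : H →* Equiv.Perm E) (h : H) (p : D × E) :
    prodPerm τ τ' h p = (τ h p.1, τ' h p.2) := rfl

theorem AInv.prd [Countable D] [Countable E] [Countable H] (hG : PmpAction 𝔾 X μ)
    {c : 𝔾 → X → H} {A : Set 𝔾} (hc : ∀ a ∈ A, Cm (c a))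
    {τ : H →* Equiv.Perm D} {τ' : H →* Equiv.Perm E} {δ δ' : ℝ≥0∞} {ζ : X → D → ℝ≥0∞}
    {ξ : X → E → ℝ≥0∞} (h : AInv μ c A τ δ ζ) (h' : AInv μ c A τ' δ' ξ) :
    AInv μ c A (prodPerm τ τ') (δ + δ') (prd ζ ξ) where
  rm := h.rm.prd h'.rm
  err_le a ha := (err_prd_le (hG a) (cm_perm (hc a ha) τ) h.rm h'.rm).trans
    (add_le_add (h.err_le a ha) (h'.err_le a ha))

theorem AInv.translate [Countable D] [Countable H] (hG : PmpAction 𝔾 X μ)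
    {c : 𝔾 → X → H} (hc : IsCocycle 𝔾 X H μ c) {A : Set 𝔾}
    {τ : H →* Equiv.Perm D} {δ : ℝ≥0∞} {ζ : X → D → ℝ≥0∞} (h : AInv μ c A τ δ ζ)
    {g : 𝔾} (hg : ∀ a ∈ A, Commute g a) :
    AInv μ c A τ δ (tr (g⁻¹ • ·) (fun x => τ (c g x)) ζ) := by
  have hm : ∀ k, Cm fun x => (τ (c g x))⁻¹ k := fun k => (hc.cm g).comp fun h => (τ h)⁻¹ k
  refine ⟨h.rm.tr (hG g⁻¹) hm, fun a ha => ?_⟩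
  rw [err_tr (hG g) (hG g⁻¹) (hG a).measurable (fun x => inv_smul_smul g x) hm
    (cm_perm (hc.cm a) τ) h.rm]
  · exact h.err_le a ha
  · filter_upwards [hc.2 a g, hc.2 g a] with x h1 h2
    refine ⟨?_, ?_⟩
    · rw [← mul_smul, ← mul_smul, (hg a ha).eq]
    · rw [← map_mul, ← map_mul, ← h1, ← h2, (hg a ha).eq]

/-- Almost invariance under `A` passes to the subgroup generated by `A`. -/
theorem err_closure [Countable D] [Countable H] (hG : PmpAction 𝔾 X μ)
    {c : 𝔾 → X → H} (hc : IsCocycle 𝔾 X H μ c) {A : Set 𝔾}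
    (τ : H →* Equiv.Perm D) {g : 𝔾} (hg : g ∈ Subgroup.closure A) :
    ∃ n : ℕ, ∀ δ ζ, AInv μ c A τ δ ζ → err μ (g • ·) (fun x => τ (c g x)) ζ ≤ n * δ := by
  induction hg using Subgroup.closure_induction with
  | mem a ha => exact ⟨1, fun δ ζ h => by simpa using h.err_le a ha⟩
  | one =>
    refine ⟨0, fun δ ζ h => ?_⟩
    rw [err_congr (S := id) (τ := fun _ => 1)]
    · simp [err]
    · filter_upwards [hc.one] with x hx; simp [hx]
  | mul g g' _ _ ih ih' =>
    obtain ⟨n, hn⟩ := ih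
    obtain ⟨m, hm⟩ := ih'
    refine ⟨n + m, fun δ ζ h => ?_⟩
    have := err_comp_le (hG g).measurable (hG g') (cm_perm (hc.cm g) τ) (cm_perm (hc.cm g') τ) h.rm
    rw [err_congr (S := fun x => g • g' • x) (τ := fun x => τ (c g (g' • x)) * τ (c g' x))]
    · refine this.trans ?_
      push_cast
      rw [add_mul]
      exact add_le_add (hn δ ζ h) (hm δ ζ h)
    · filter_upwards [hc.2 g g'] with x hx
      rw [hx, map_mul]; exact ⟨mul_smul _ _ _, rfl⟩
  | inv g _ ih =>
    obtain ⟨n, hn⟩ := ih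
    refine ⟨n, fun δ ζ h => ?_⟩
    rw [err_inv (hG g) (hG g⁻¹).measurable (fun x => inv_smul_smul g x)
      (cm_perm (hc.cm g⁻¹) τ) (σ := fun x => τ (c g x)) ?_ h.rm]
    · exact hn δ ζ h
    · filter_upwards [hc.inv g] with x hx; rw [hx, map_inv]

end Reiter

section Pointwise

variable {D Bl : Type*}

theorem tsum_ind_add (b : D → Prop) {p : D → ℝ≥0∞} (hp : ∑' k, p k = 1) :
    ∑' k, ind (b k) * p k + ∑' k, ind (¬ b k) * p k = 1 := by
  rw [← ENNReal.tsum_add, ← hp]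
  exact tsum_congr fun k => by rw [← add_mul, ind_add_not, one_mul]

theorem out_mul_le (bl : D → Bl) (p p' : D → ℝ≥0∞) (B : Bl) :
    (∑' k, ind (bl k ≠ B) * p k) * (∑' k, ind (bl k = B) * p' k) ≤
      ∑' r : D × D, ind (bl r.1 ≠ bl r.2) * (p r.1 * p' r.2) := by
  rw [ENNReal.tsum_prod', ← ENNReal.tsum_mul_right]
  refine ENNReal.tsum_le_tsum fun k => ?_
  rw [← ENNReal.tsum_mul_left]
  refine ENNReal.tsum_le_tsum fun k' => ?_
  calc ind (bl k ≠ B) * p k * (ind (bl k' = B) * p' k')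
      = (ind (bl k ≠ B ∧ bl k' = B)) * (p k * p' k') := by rw [ind_mul]; ring
    _ ≤ _ := by
      gcongr
      apply ind_mono
      rintro ⟨h1, h2⟩ h3
      exact h1 (h3.trans h2)

theorem exists_heavy (bl : D → Bl) {p : D → ℝ≥0∞} (hp : ∑' k, p k = 1)
    (h : ∑' r : D × D, ind (bl r.1 ≠ bl r.2) * (p r.1 * p r.2) < 1 / 4) :
    ∃ B, 3 / 4 < ∑' k, ind (bl k = B) * p k := by
  by_contra hc
  push Not at hc
  have h1 : ∑' r : D × D, ind (bl r.2 = bl r.1) * (p r.1 * p r.2) ≤ 3 / 4 := by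
    rw [ENNReal.tsum_prod']
    calc ∑' k, ∑' k', ind (bl k' = bl k) * (p k * p k')
        = ∑' k, p k * ∑' k', ind (bl k' = bl k) * p k' := by
          refine tsum_congr fun k => ?_
          rw [← ENNReal.tsum_mul_left]
          exact tsum_congr fun k' => by ring
      _ ≤ ∑' k, p k * (3 / 4) := ENNReal.tsum_le_tsum fun k => by gcongr; exact hc _
      _ = 3 / 4 := by rw [ENNReal.tsum_mul_right, hp, one_mul]
  have h2 : ∑' r : D × D, p r.1 * p r.2 = 1 := by
    rw [ENNReal.tsum_prod']
    simp only [ENNReal.tsum_mul_left, hp, mul_one]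
  have h3 := tsum_ind_add (fun r : D × D => bl r.2 = bl r.1) h2
  have h5 : ∑' r : D × D, ind (¬ bl r.2 = bl r.1) * (p r.1 * p r.2) < 1 / 4 := by
    refine lt_of_le_of_lt (le_of_eq ?_) h
    refine tsum_congr fun r => ?_
    rw [show (¬ bl r.2 = bl r.1) = (bl r.1 ≠ bl r.2) from propext ⟨fun h => Ne.symm h, fun h => Ne.symm h⟩]
  have h4 := ENNReal.add_lt_add_of_le_of_lt (ne_top_of_le_ne_top (by finiteness) h1) h1 h5
  rw [h3] at h4
  rw [← ENNReal.add_div, show (3 + 1 : ℝ≥0∞) = 4 by norm_num,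
    ENNReal.div_self (by norm_num) (by norm_num)] at h4
  exact lt_irrefl _ h4

theorem heavy_step (bl : D → Bl) {p p' : D → ℝ≥0∞} (hp : ∑' k, p k = 1) {B : Bl}
    (hB : 3 / 4 < ∑' k, ind (bl k = B) * p' k)
    (h : ∑' r : D × D, ind (bl r.1 ≠ bl r.2) * (p r.1 * p' r.2) < 1 / 8) :
    3 / 4 < ∑' k, ind (bl k = B) * p k := by
  by_contra hc
  push Not at hc
  have h1 := tsum_ind_add (fun k => bl k = B) hp
  have h2 : (1 : ℝ≥0∞) / 4 ≤ ∑' k, ind (bl k ≠ B) * p k := by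
    have : (3 : ℝ≥0∞) / 4 + 1 / 4 ≤ 3 / 4 + ∑' k, ind (bl k ≠ B) * p k := by
      rw [← ENNReal.add_div, show (3 + 1 : ℝ≥0∞) = 4 by norm_num,
        ENNReal.div_self (by norm_num) (by norm_num), ← h1]
      gcongr
    exact (ENNReal.add_le_add_iff_left (by finiteness)).1 this
  have h3 := (out_mul_le bl p p' B).trans_lt h
  have h4 : (1 : ℝ≥0∞) / 4 * (3 / 4) < 1 / 8 := lt_of_le_of_lt (by gcongr) h3
  have h5 : ENNReal.toReal (1 / 4 * (3 / 4)) < ENNReal.toReal (1 / 8) :=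
    (ENNReal.toReal_lt_toReal (by finiteness) (by finiteness)).2 h4
  norm_num at h5

theorem eventually_heavy (bl : D → Bl) (p : ℕ → D → ℝ≥0∞) (hp : ∀ i, ∑' k, p i k = 1)
    (h : Filter.Tendsto (fun i => ∑' r : D × D, ind (bl r.1 ≠ bl r.2) * (p i r.1 * p i r.2))
      Filter.atTop (nhds 0))
    (h' : Filter.Tendsto (fun i => ∑' r : D × D, ind (bl r.1 ≠ bl r.2) * (p (i + 1) r.1 * p i r.2))
      Filter.atTop (nhds 0)) :
    ∃ B, ∀ᶠ i in Filter.atTop, 3 / 4 < ∑' k, ind (bl k = B) * p i k := by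
  have h1 := h.eventually_lt_const (show (0 : ℝ≥0∞) < 1 / 4 by norm_num)
  have h2 := h'.eventually_lt_const (show (0 : ℝ≥0∞) < 1 / 8 by norm_num)
  obtain ⟨n, hn⟩ := Filter.eventually_atTop.1 (h1.and h2)
  obtain ⟨B, hB⟩ := exists_heavy bl (hp n) (hn n le_rfl).1
  refine ⟨B, Filter.eventually_atTop.2 ⟨n, fun i hi => ?_⟩⟩
  induction i, hi using Nat.le_induction with
  | base => exact hB
  | succ i hi ih => exact heavy_step bl (hp _) ih (hn i hi).2

end Pointwise

theorem exists_antitone_le (δ : ℕ → ℝ≥0∞) (h : ∀ i, 0 < δ i) :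
    ∃ δ' : ℕ → ℝ≥0∞, Antitone δ' ∧ (∀ i, 0 < δ' i) ∧ ∀ i, δ' i ≤ δ i := by
  refine ⟨fun i => (Finset.range (i + 1)).inf δ, fun i j hij => ?_, fun i => ?_, fun i => ?_⟩
  · exact Finset.inf_mono (Finset.range_subset_range.2 (by omega))
  · exact (Finset.lt_inf_iff (by simp)).2 fun j _ => h j
  · exact Finset.inf_le (by simp)

theorem ae_tendsto_zero_of_summable {X : Type*} [MeasurableSpace X] {μ : Measure X}
    {f : ℕ → X → ℝ≥0∞} (hf : ∀ i, Measurable (f i)) (h : ∑' i, ∫⁻ x, f i x ∂μ ≠ ⊤) :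
    ∀ᵐ x ∂μ, Filter.Tendsto (fun i => f i x) Filter.atTop (nhds 0) := by
  rw [← lintegral_tsum fun i => (hf i).aemeasurable] at h
  filter_upwards [ae_lt_top (Measurable.tsum hf) h] with x hx
  exact ENNReal.tendsto_atTop_zero_of_tsum_ne_top hx.ne

section Concentration

variable {X : Type} [MeasurableSpace X] {μ : Measure X} {𝔾 : Type} [Group 𝔾] [MulAction 𝔾 X]
  {H : Type} [Group H] {D Bl : Type*}

/-- The mean of a weight against a random measure. -/
noncomputable abbrev rk (μ : Measure X) (w : D → ℕ) (ζ : X → D → ℝ≥0∞) : ℝ≥0∞ :=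
  wt μ (fun _ k => (w k : ℝ≥0∞)) ζ

/-- The probability that two independent samples lie in different blocks. -/
noncomputable abbrev off (μ : Measure X) (bl : D → Bl) (ζ ξ : X → D → ℝ≥0∞) : ℝ≥0∞ :=
  wt μ (fun _ r => ind (bl r.1 ≠ bl r.2)) (prd ζ ξ)

theorem exists_cm_choice {B : Type*} [Countable B] [Nonempty B] {P : X → B → Prop}
    (hP : ∀ b, MeasurableSet {x | P x b}) (h : ∀ᵐ x ∂μ, ∃ b, P x b) :
    ∃ β : X → B, Cm β ∧ ∀ᵐ x ∂μ, P x (β x) := by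
  classical
  obtain ⟨f, hf⟩ := Countable.exists_injective_nat B
  have key : ∀ x, ∃ b, ((∃ b, P x b) → P x b ∧ ∀ b', P x b' → f b ≤ f b') ∧
      ((¬ ∃ b, P x b) → b = Classical.arbitrary B) := by
    intro x
    by_cases hx : ∃ b, P x b
    · have hS : ∃ n, ∃ b, P x b ∧ f b = n := let ⟨b, hb⟩ := hx; ⟨f b, b, hb, rfl⟩
      obtain ⟨b, hb, hb'⟩ := Nat.find_spec hS
      refine ⟨b, fun _ => ⟨hb, fun b' h' => ?_⟩, fun h => absurd hx h⟩
      rw [hb']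
      exact Nat.find_min' hS ⟨b', h', rfl⟩
    · exact ⟨_, fun h => absurd h hx, fun _ => rfl⟩
  choose β h1 h2 using key
  refine ⟨β, fun b => ?_, h.mono fun x hx => (h1 x hx).1⟩
  have : {x | β x = b} = ({x | P x b} ∩ ⋂ b', {x | P x b' → f b ≤ f b'}) ∪
      ((⋂ b', {x | P x b'}ᶜ) ∩ {_x | b = Classical.arbitrary B}) := by
    ext x
    simp only [Set.mem_ofPred_eq, Set.mem_union, Set.mem_inter_iff, Set.mem_iInter, Set.mem_compl_iff]
    constructor
    · rintro rfl
      by_cases hx : ∃ b, P x b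
      · exact .inl (h1 x hx)
      · exact .inr ⟨fun b hb => hx ⟨b, hb⟩, h2 x hx⟩
    · rintro (⟨h3, h4⟩ | ⟨h3, h4⟩)
      · have h5 := h1 x ⟨b, h3⟩
        exact hf (le_antisymm (h5.2 b h3) (h4 _ h5.1))
      · rw [h4]; exact h2 x fun ⟨b, hb⟩ => h3 b hb
  rw [this]
  refine ((hP b).inter (MeasurableSet.iInter fun b' => ?_)).union
    ((MeasurableSet.iInter fun b' => (hP b').compl).inter (.const _))
  by_cases hb : f b ≤ f b'
  · simp [hb]
  · simp only [hb, imp_false]; exact (hP b').compl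

theorem exists_minimal_rank [IsProbabilityMeasure μ] (c : 𝔾 → X → H) (A : Set 𝔾)
    (τ : H →* Equiv.Perm D) (w : D → ℕ) {N : ℕ} (hN : ∀ k, w k ≤ N) (h : HasReiter μ c A τ) :
    ∃ ρ : ℝ≥0∞, ρ ≤ N ∧ ∀ ε > 0, (∃ δ > 0, ∀ ζ, AInv μ c A τ δ ζ → ρ ≤ rk μ w ζ + ε) ∧
      ∀ δ > 0, ∃ ζ, AInv μ c A τ δ ζ ∧ rk μ w ζ ≤ ρ + ε := by
  let r : ℝ≥0∞ → ℝ≥0∞ := fun δ => ⨅ ζ : {ζ // AInv μ c A τ δ ζ}, rk μ w ζ.1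
  have hrN : ∀ δ > 0, r δ ≤ N := fun δ hδ => by
    obtain ⟨ζ, hζ⟩ := h δ hδ
    refine (iInf_le (fun ζ : {ζ // AInv μ c A τ δ ζ} => rk μ w ζ.1) ⟨ζ, hζ⟩).trans ?_
    refine (wt_mono (g := fun _ _ => (N : ℝ≥0∞)) (.of_forall fun x k => ?_) ζ).trans
      (wt_const hζ.rm _).le
    exact_mod_cast hN k
  refine ⟨⨆ δ : {δ : ℝ≥0∞ // 0 < δ}, r δ.1, iSup_le fun δ => hrN _ δ.2, fun ε hε => ⟨?_, ?_⟩⟩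
  · rcases eq_or_ne (⨆ δ : {δ : ℝ≥0∞ // 0 < δ}, r δ.1) 0 with h0 | h0
    · exact ⟨1, one_pos, fun ζ _ => by rw [h0]; exact zero_le⟩
    · have hfin : (⨆ δ : {δ : ℝ≥0∞ // 0 < δ}, r δ.1) ≠ ⊤ :=
        ne_top_of_le_ne_top (by finiteness) (iSup_le fun δ => hrN _ δ.2 : _ ≤ (N : ℝ≥0∞))
      obtain ⟨δ, hδ⟩ := lt_iSup_iff.1 (ENNReal.sub_lt_self hfin h0 hε.ne')
      refine ⟨δ.1, δ.2, fun ζ hζ => ?_⟩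
      rw [← tsub_le_iff_right]
      exact hδ.le.trans (iInf_le (fun ζ : {ζ // AInv μ c A τ δ.1 ζ} => rk μ w ζ.1) ⟨ζ, hζ⟩)
  · intro δ hδ
    have h1 : r δ < (⨆ δ : {δ : ℝ≥0∞ // 0 < δ}, r δ.1) + ε := by
      refine lt_of_le_of_lt (le_iSup (fun δ : {δ : ℝ≥0∞ // 0 < δ} => r δ.1) ⟨δ, hδ⟩) ?_
      refine ENNReal.lt_add_right ?_ hε.ne'
      exact ne_top_of_le_ne_top (by finiteness) (iSup_le fun δ => hrN _ δ.2 : _ ≤ (N : ℝ≥0∞))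
    obtain ⟨ζ, hζ⟩ := iInf_lt_iff.1 h1
    exact ⟨ζ.1, ζ.2, hζ.le⟩

theorem concentration [IsProbabilityMeasure μ] [Countable D] [Countable Bl] [Countable H]
    (hG : PmpAction 𝔾 X μ) {c : 𝔾 → X → H} (hc : IsCocycle 𝔾 X H μ c) {A : Set 𝔾}
    {τ : H →* Equiv.Perm D} {τB : H →* Equiv.Perm Bl} {bl : D → Bl}
    (hbl : ∀ h k, bl (τ h k) = τB h (bl k)) {w : D → ℕ} (hw : ∀ h k, w (τ h k) = w k)
    {N : ℕ} (hN : ∀ k, w k ≤ N) {κ : D × D → D} (hκ : ∀ h p, κ (prodPerm τ τ h p) = τ h (κ p))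
    (hκw : ∀ p, 2 * w (κ p) ≤ w p.1 + w p.2)
    (hκb : ∀ p, bl p.1 ≠ bl p.2 → 2 * w (κ p) + 1 ≤ w p.1 + w p.2) (h : HasReiter μ c A τ) :
    ∃ β : X → Bl, Cm β ∧
      (∀ g, (g ∈ A ∨ ∀ a ∈ A, Commute g a) → ∀ᵐ x ∂μ, β (g • x) = τB (c g x) (β x)) ∧
      ∃ ρ : ℝ≥0∞, ρ ≤ N ∧ ∀ ε > 0, (∃ δ > 0, ∀ ζ, AInv μ c A τ δ ζ → ρ ≤ rk μ w ζ + ε) ∧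
        ∀ δ > 0, ∃ ζ, AInv μ c A τ δ ζ ∧ rk μ w ζ ≤ ρ + ε ∧
          wt μ (fun x k => ind (bl k ≠ β x)) ζ ≤ ε := by
  obtain ⟨ρ, hρN, hρ⟩ := exists_minimal_rank c A τ w hN h
  have hρt : ρ ≠ ⊤ := ne_top_of_le_ne_top (by finiteness) hρN
  have hcA : ∀ a ∈ A, Cm (c a) := fun a _ => hc.cm a
  have hoff : ∀ ε > 0, ∃ δ > 0, ∀ ζ ξ, AInv μ c A τ δ ζ → AInv μ c A τ δ ξ → rk μ w ζ ≤ ρ + ε →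
      rk μ w ξ ≤ ρ + ε → off μ bl ζ ξ ≤ 4 * ε := by
    intro ε hε
    rcases eq_or_ne ε ⊤ with rfl | hεt
    · exact ⟨1, one_pos, by simp⟩
    obtain ⟨δ, hδ, hδ'⟩ := (hρ ε hε).1
    refine ⟨δ / 2, ENNReal.half_pos hδ.ne', fun ζ ξ hζ hξ h1 h2 => ?_⟩
    have h3 := hζ.prd hG hcA hξ
    rw [ENNReal.add_halves] at h3
    have h4 := h3.push (c' := c) (τ' := τ) (j := fun _ p => κ p) hG hcA (fun k => Cm.const _)
      fun a _ => .of_forall fun x k => hκ _ _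
    have h5 := hδ' _ h4
    rw [rk, wt_push] at h5
    have h6 : 2 * wt μ (fun _ p => (w (κ p) : ℝ≥0∞)) (prd ζ ξ) + off μ bl ζ ξ ≤
        rk μ w ζ + rk μ w ξ := by
      rw [← wt_const_mul (f := fun _ p => (w (κ p) : ℝ≥0∞)) (fun _ => measurable_const) h3.rm, off,
        ← wt_add (f := fun _ p => 2 * (w (κ p) : ℝ≥0∞)) (fun _ => measurable_const) h3.rm]
      have e1 : rk μ w ζ = wt μ (fun _ p => (w p.1 : ℝ≥0∞)) (prd ζ ξ) := by
        refine lintegral_congr_ae ?_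
        filter_upwards [hξ.rm.sum] with x hx
        rw [tsum_prd]
        simp only [ENNReal.tsum_mul_left, hx, mul_one]
      have e2 : rk μ w ξ = wt μ (fun _ p => (w p.2 : ℝ≥0∞)) (prd ζ ξ) := by
        refine lintegral_congr_ae ?_
        filter_upwards [hζ.rm.sum] with x hx
        simp only [tsum_prd, ENNReal.tsum_mul_left, hx, mul_one]
      rw [e1, e2, ← wt_add (f := fun _ p => (w p.1 : ℝ≥0∞)) (fun _ => measurable_const) h3.rm]
      refine wt_mono (.of_forall fun x p => ?_) _
      by_cases hp : bl p.1 ≠ bl p.2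
      · rw [ind_true hp]; exact_mod_cast hκb p hp
      · rw [ind_false hp, add_zero]; exact_mod_cast hκw p
    have h7 : 2 * ρ + off μ bl ζ ξ ≤ 2 * ρ + 4 * ε := by
      calc 2 * ρ + off μ bl ζ ξ
          ≤ 2 * (wt μ (fun _ p => (w (κ p) : ℝ≥0∞)) (prd ζ ξ) + ε) + off μ bl ζ ξ := by gcongr
        _ = (2 * wt μ (fun _ p => (w (κ p) : ℝ≥0∞)) (prd ζ ξ) + off μ bl ζ ξ) + 2 * ε := by ring
        _ ≤ (ρ + ε + (ρ + ε)) + 2 * ε := add_le_add (h6.trans (add_le_add h1 h2)) le_rfl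
        _ = _ := by ring
    exact (ENNReal.add_le_add_iff_left (by finiteness)).1 h7
  let ε : ℕ → ℝ≥0∞ := fun i => 2⁻¹ ^ i
  have hε0 : ∀ i, 0 < ε i := fun i => ENNReal.pow_pos (by simp) i
  have hεa : Antitone ε := fun i j hij => pow_le_pow_right_of_le_one' (by simp) hij
  have hεs : ∑' i, ε i ≠ ⊤ := by simp only [ε]; rw [ENNReal.tsum_geometric]; simp
  have hεt : Filter.Tendsto ε Filter.atTop (nhds 0) := ENNReal.tendsto_atTop_zero_of_tsum_ne_top hεs
  choose δ₀ hδ₀ hδ₀' using fun i => hoff (ε i) (hε0 i)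
  obtain ⟨δ, hδa, hδp, hδle⟩ := exists_antitone_le (fun i => min (δ₀ i) (ε i))
    fun i => lt_min (hδ₀ i) (hε0 i)
  choose ζ hζ hζr using fun i => (hρ (ε i) (hε0 i)).2 (δ i) (hδp i)
  have hoff' : ∀ i ξ ξ', AInv μ c A τ (δ i) ξ → AInv μ c A τ (δ i) ξ' → rk μ w ξ ≤ ρ + ε i →
      rk μ w ξ' ≤ ρ + ε i → off μ bl ξ ξ' ≤ 4 * ε i := fun i ξ ξ' h1 h2 =>
    hδ₀' i ξ ξ' (h1.mono ((hδle i).trans (min_le_left _ _))) (h2.mono ((hδle i).trans (min_le_left _ _)))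
  have hj : ∀ i j, i ≤ j → AInv μ c A τ (δ i) (ζ j) ∧ rk μ w (ζ j) ≤ ρ + ε i := fun i j hij =>
    ⟨(hζ j).mono (hδa hij), (hζr j).trans (by gcongr; exact hεa hij)⟩
  have hmo : ∀ ξ ξ', RM μ ξ → RM μ ξ' →
      Measurable fun x => ∑' r : D × D, ind (bl r.1 ≠ bl r.2) * prd ξ ξ' x r :=
    fun ξ ξ' h1 h2 => measurable_wt (f := fun (_ : X) (r : D × D) => ind (bl r.1 ≠ bl r.2))
      (fun _ => measurable_const) (h1.prd h2)
  have hsum : ∀ s : ℕ → ℝ≥0∞, (∀ i, s i ≤ 4 * ε i) → ∑' i, s i ≠ ⊤ := fun s hs => by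
    refine ne_top_of_le_ne_top ?_ (ENNReal.tsum_le_tsum hs)
    rw [ENNReal.tsum_mul_left]
    exact ENNReal.mul_ne_top (by finiteness) hεs
  have hheavy : ∀ᵐ x ∂μ, ∃ B, ∀ᶠ i in Filter.atTop, 3 / 4 < ∑' k, ind (bl k = B) * ζ i x k := by
    filter_upwards [ae_all_iff.2 fun i => (hζ i).rm.sum,
      ae_tendsto_zero_of_summable (fun i => hmo (ζ i) (ζ i) (hζ i).rm (hζ i).rm) (hsum _ fun i =>
        hoff' i _ _ (hζ i) (hζ i) (hζr i) (hζr i)),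
      ae_tendsto_zero_of_summable (fun i => hmo (ζ (i + 1)) (ζ i) (hζ _).rm (hζ i).rm) (hsum _ fun i =>
        hoff' i _ _ (hj i (i + 1) (by omega)).1 (hζ i) (hj i (i + 1) (by omega)).2 (hζr i))]
      with x h1 h2 h3
    exact eventually_heavy bl (fun i => ζ i x) h1 h2 h3
  have hBm : ∀ B, MeasurableSet {x | ∀ᶠ i in Filter.atTop, 3 / 4 < ∑' k, ind (bl k = B) * ζ i x k} :=
    fun B => by
      have : ∀ i, MeasurableSet {x | 3 / 4 < ∑' k, ind (bl k = B) * ζ i x k} := fun i =>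
        measurableSet_lt measurable_const
          (measurable_wt (f := fun (_ : X) k => ind (bl k = B)) (fun _ => measurable_const) (hζ i).rm)
      have h2 : {x | ∀ᶠ i in Filter.atTop, 3 / 4 < ∑' k, ind (bl k = B) * ζ i x k} =
          ⋃ n : ℕ, ⋂ i : ℕ, ⋂ _ : n ≤ i, {x | 3 / 4 < ∑' k, ind (bl k = B) * ζ i x k} := by
        ext x; simp [Filter.eventually_atTop]
      rw [h2]
      exact MeasurableSet.iUnion fun n => MeasurableSet.iInter fun i => MeasurableSet.iInter fun _ => this i
  obtain ⟨β, hβ, hβ'⟩ : ∃ β : X → Bl, Cm β ∧ ∀ᵐ x ∂μ, ∀ᶠ i in Filter.atTop,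
      3 / 4 < ∑' k, ind (bl k = β x) * ζ i x k := by
    obtain ⟨x, B, -⟩ := hheavy.exists
    have : Nonempty Bl := ⟨B⟩
    exact exists_cm_choice hBm hheavy
  have hind : ∀ k, Measurable fun x => ind (bl k ≠ β x) := fun k =>
    measurable_ind (hβ.set₂ hβ fun B _ => bl k ≠ B)
  have hconc : ∀ i ξ, AInv μ c A τ (δ i) ξ → rk μ w ξ ≤ ρ + ε i →
      wt μ (fun x k => ind (bl k ≠ β x)) ξ ≤ 8 * ε i := by
    intro i ξ hξ hξr
    have h1 : ∀ᵐ x ∂μ, 3 / 4 * (∑' k, ind (bl k ≠ β x) * ξ x k) ≤ Filter.liminf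
        (fun j => ∑' r : D × D, ind (bl r.1 ≠ bl r.2) * prd ξ (ζ j) x r) Filter.atTop := by
      filter_upwards [hβ'] with x hx
      refine Filter.le_liminf_of_le (by isBoundedDefault) ?_
      filter_upwards [hx] with j hj
      refine le_trans ?_ (out_mul_le bl (ξ x) (ζ j x) (β x))
      rw [mul_comm]
      gcongr
    have h2 : 3 / 4 * wt μ (fun x k => ind (bl k ≠ β x)) ξ ≤ 4 * ε i := by
      rw [wt, ← lintegral_const_mul _ (measurable_wt hind hξ.rm)]
      refine (lintegral_mono_ae h1).trans ((lintegral_liminf_le fun j =>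
        hmo ξ (ζ j) hξ.rm (hζ j).rm).trans ?_)
      refine Filter.liminf_le_of_frequently_le' ?_
      refine (Filter.eventually_atTop.2 ⟨i, fun j hij => ?_⟩ :
        ∀ᶠ j in Filter.atTop, _).frequently
      exact hoff' i ξ (ζ j) hξ (hj i j hij).1 hξr (hj i j hij).2
    calc wt μ (fun x k => ind (bl k ≠ β x)) ξ
        ≤ 2 * (3 / 4) * wt μ (fun x k => ind (bl k ≠ β x)) ξ := by
          refine le_mul_of_one_le_left zero_le ?_
          rw [← ENNReal.toReal_le_toReal (by finiteness) (by finiteness)]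
          norm_num
      _ ≤ 2 * (4 * ε i) := by rw [mul_assoc]; gcongr
      _ = 8 * ε i := by ring
  refine ⟨β, hβ, ?_, ρ, hρN, fun η hη => ⟨(hρ η hη).1, fun δ' hδ' => ?_⟩⟩
  · intro g hg
    have hτm : ∀ k, Cm fun x => τ (c g x) k := cm_perm (hc.cm g) τ
    have hb : ∀ i, wt μ (fun x k => ind (bl (τ (c g x) k) ≠ β (g • x))) (ζ i) ≤ 9 * ε i := by
      intro i
      have h8 := hconc i (ζ i) (hζ i) (hζr i)
      rcases hg with hg | hg
      · refine (wt_transport_le (f := fun x k => ind (bl k ≠ β x)) (hG g) hτm (hζ i).rm hind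
          fun _ _ => ind_le_one _).trans ?_
        calc _ ≤ ε i + 8 * ε i := add_le_add (((hζ i).err_le g hg).trans
              ((hδle i).trans (min_le_right _ _))) h8
          _ = 9 * ε i := by ring
      · have hm : ∀ k, Cm fun x => (τ (c g x))⁻¹ k := fun k => (hc.cm g).comp fun h => (τ h)⁻¹ k
        have h9 := hconc i _ ((hζ i).translate hG hc hg) (by
          rw [rk, wt_tr (f := fun _ k => (w k : ℝ≥0∞)) (hG g) (hG g⁻¹) (fun x => inv_smul_smul g x) hm (hζ i).rm
            fun _ => measurable_const]
          simp only [hw]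
          exact hζr i)
        rw [wt_tr (hG g) (hG g⁻¹) (fun x => inv_smul_smul g x) hm (hζ i).rm hind] at h9
        exact h9.trans (by gcongr; norm_num)
    have hms : MeasurableSet {x | β (g • x) ≠ τB (c g x) (β x)} :=
      ((hβ.comp_meas (hG g).measurable).set₂ (hβ.comp₂ (hc.cm g) fun B h => τB h B)
        fun a b => a ≠ b)
    have h0 : ∀ i, μ {x | β (g • x) ≠ τB (c g x) (β x)} ≤ 17 * ε i := by
      intro i
      rw [← lintegral_ind hms, ← wt_fiberwise (hζ i).rm]
      have h10 : wt μ (fun x _ => ind (β (g • x) ≠ τB (c g x) (β x))) (ζ i) ≤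
          wt μ (fun x k => ind (bl (τ (c g x) k) ≠ β (g • x)) + ind (bl k ≠ β x)) (ζ i) := by
        refine wt_mono (.of_forall fun x k => ind_le_add fun h => ?_) _
        by_contra hn
        push Not at hn
        exact h (by rw [← hn.1, ← hn.2, hbl])
      refine h10.trans ?_
      rw [wt_add (f := fun x k => ind (bl (τ (c g x) k) ≠ β (g • x))) (fun k => measurable_ind
        ((hβ.comp_meas (hG g).measurable).set₂ (hτm k) fun B k => bl k ≠ B)) (hζ i).rm]
      calc _ ≤ 9 * ε i + 8 * ε i := add_le_add (hb i) (hconc i (ζ i) (hζ i) (hζr i))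
        _ = 17 * ε i := by ring
    have h17 : Filter.Tendsto (fun i => 17 * ε i) Filter.atTop (nhds 0) := by
      simpa using ENNReal.Tendsto.const_mul hεt (.inr (by finiteness : (17 : ℝ≥0∞) ≠ ⊤))
    have := le_antisymm (ge_of_tendsto' h17 h0) zero_le
    rw [ae_iff]
    exact this
  · obtain ⟨i, hi⟩ : ∃ i, 8 * ε i < η := by
      have h8 : Filter.Tendsto (fun i => 8 * ε i) Filter.atTop (nhds 0) := by
        simpa using ENNReal.Tendsto.const_mul hεt (.inr (by finiteness : (8 : ℝ≥0∞) ≠ ⊤))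
      exact (h8.eventually_lt_const hη).exists
    obtain ⟨ξ, hξ, hξr⟩ := (hρ (ε i) (hε0 i)).2 (min (δ i) δ') (lt_min (hδp i) hδ')
    refine ⟨ξ, hξ.mono (min_le_right _ _), hξr.trans ?_,
      (hconc i ξ (hξ.mono (min_le_left _ _)) hξr).trans hi.le⟩
    gcongr
    exact (le_mul_of_one_le_left zero_le (by norm_num)).trans hi.le

end Concentration

section LemmaT

variable {X : Type} [MeasurableSpace X] {μ : Measure X} {𝔾 : Type} [Group 𝔾] [MulAction 𝔾 X]
  {W : Type} {Λ : SimpleGraph W}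

/-- The set of parabolic cosets. -/
abbrev Par (Λ : SimpleGraph W) : Type := Σ R : Set W, RAAG Λ ⧸ standardSub Λ R

/-- The set of cosets of normalizers of standard subgroups. -/
abbrev Blk (Λ : SimpleGraph W) : Type := Σ R : Set W, RAAG Λ ⧸ standardSub Λ (R ∪ perp Λ R)

instance [Finite W] : Countable (Par Λ) := by
  have : Countable (Set W) := Finite.to_countable
  have : ∀ R : Set W, Countable (RAAG Λ ⧸ standardSub Λ R) := fun R => Quotient.countable
  infer_instance

instance [Finite W] : Countable (Blk Λ) := by
  have : Countable (Set W) := Finite.to_countable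
  have : ∀ R : Set W, Countable (RAAG Λ ⧸ standardSub Λ (R ∪ perp Λ R)) := fun R => Quotient.countable
  infer_instance

/-- The block containing a parabolic coset. -/
def blk (k : Par Λ) : Blk Λ :=
  ⟨k.1, Quotient.map' id (fun a b h => by
    rw [QuotientGroup.leftRel_apply] at h ⊢
    exact standardSub_mono Set.subset_union_left h) k.2⟩

/-- The action of a group on a set by permutations. -/
abbrev perm (H D : Type*) [Group H] [MulAction H D] : H →* Equiv.Perm D := MulAction.toPermHom H D

theorem perm_apply {H D : Type*} [Group H] [MulAction H D] (h : H) (k : D) : perm H D h k = h • k :=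
  rfl

theorem blk_smul (h : RAAG Λ) (k : Par Λ) : blk (h • k) = h • blk k := by
  obtain ⟨R, q⟩ := k
  induction q using QuotientGroup.induction_on with
  | H g => rfl

theorem sigma_smul_eq_iff {ι H : Type*} [Group H] {D : ι → Type*} [∀ i, MulAction H (D i)] (h : H)
    {i : ι} (q q' : D i) : h • (⟨i, q⟩ : Σ i, D i) = ⟨i, q'⟩ ↔ h • q = q' :=
  sigma_mk_injective.eq_iff

theorem coset_smul_eq_iff {H : Type*} [Group H] (P : Subgroup H) (m g g' : H) :
    m • (QuotientGroup.mk g : H ⧸ P) = QuotientGroup.mk g' ↔ g⁻¹ * m⁻¹ * g' ∈ P := by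
  rw [MulAction.Quotient.smul_mk, QuotientGroup.eq]
  simp [mul_assoc]

theorem coset_smul_eq_self_iff {H : Type*} [Group H] (P : Subgroup H) (m g : H) :
    m • (QuotientGroup.mk g : H ⧸ P) = QuotientGroup.mk g ↔ g⁻¹ * m * g ∈ P := by
  rw [coset_smul_eq_iff, ← inv_mem_iff]
  simp [mul_assoc]

theorem exists_meet [Finite W] : ∃ κ : Par Λ × Par Λ → Par Λ,
    (∀ h p, κ (prodPerm (perm (RAAG Λ) (Par Λ)) (perm (RAAG Λ) (Par Λ)) h p) =
      perm (RAAG Λ) (Par Λ) h (κ p)) ∧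
    ∀ p, 2 * (κ p).1.ncard ≤ p.1.1.ncard + p.2.1.ncard ∧
      (blk p.1 ≠ blk p.2 → 2 * (κ p).1.ncard + 1 ≤ p.1.1.ncard + p.2.1.ncard) := by
  refine exists_equivariant (prodPerm (perm (RAAG Λ) (Par Λ)) (perm (RAAG Λ) (Par Λ)))
    (perm (RAAG Λ) (Par Λ)) (fun p z => 2 * z.1.ncard ≤ p.1.1.ncard + p.2.1.ncard ∧
      (blk p.1 ≠ blk p.2 → 2 * z.1.ncard + 1 ≤ p.1.1.ncard + p.2.1.ncard)) ?_ ?_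
  · intro m p z hp
    refine ⟨hp.1, fun h => hp.2 fun h' => h ?_⟩
    simp only [prodPerm_apply, perm_apply, blk_smul, h']
  · rintro ⟨⟨R, q⟩, ⟨R', q'⟩⟩
    induction q using QuotientGroup.induction_on with
    | H g =>
    induction q' using QuotientGroup.induction_on with
    | H g' =>
    obtain ⟨Z, hZ, k, hk, hN⟩ := parabolic_inter R R' (g⁻¹ * g')
    have h1 : Z.ncard ≤ R.ncard := Set.ncard_le_ncard (hZ.trans Set.inter_subset_left)
    have h2 : Z.ncard ≤ R'.ncard := Set.ncard_le_ncard (hZ.trans Set.inter_subset_right)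
    refine ⟨⟨Z, QuotientGroup.mk (g * k)⟩, ⟨by simp only; omega, fun hb => ?_⟩, fun m hm => ?_⟩
    · by_contra hc
      have h3 : Z = R := Set.eq_of_subset_of_ncard_le (hZ.trans Set.inter_subset_left)
        (by simp only at hc; omega)
      have h4 : Z = R' := Set.eq_of_subset_of_ncard_le (hZ.trans Set.inter_subset_right)
        (by simp only at hc; omega)
      refine hb ?_
      have h5 := hN h3 (h3.symm.trans h4)
      obtain rfl := h3
      obtain rfl := h4
      exact congrArg (Sigma.mk Z) (QuotientGroup.eq.2 h5)
    · rw [prodPerm_apply, Prod.mk.injEq] at hm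
      simp only [perm_apply, sigma_smul_eq_iff, coset_smul_eq_self_iff] at hm ⊢
      have h6 := hk _ hm.1 (by convert hm.2 using 1; group)
      convert h6 using 1; group

/-- The base block of a given type. -/
def blk₀ (Λ : SimpleGraph W) (R : Set W) : Blk Λ := ⟨R, QuotientGroup.mk 1⟩

/-- `c` takes values in the normalizer of `standardSub Λ R`, the latter being minimal among the
parabolic subgroups with almost invariant means. -/
structure Minimizing (μ : Measure X) (c : 𝔾 → X → RAAG Λ) (A : Set 𝔾) (R : Set W) : Prop where
  norm : ∀ g, (g ∈ A ∨ ∀ a ∈ A, Commute g a) →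
    ∀ᵐ x ∂μ, c g x ∈ standardSub Λ (R ∪ perp Λ R)
  reiter : ∀ δ > 0, ∃ ζ, AInv μ c A (perm (RAAG Λ) (Par Λ)) δ ζ ∧
    wt μ (fun _ k => ind (blk k ≠ blk₀ Λ R)) ζ ≤ δ
  minimal : ∃ δ > 0, ∀ ζ, AInv μ c A (perm (RAAG Λ) (Par Λ)) δ ζ →
    (R.ncard : ℝ≥0∞) ≤ rk μ (fun k => k.1.ncard) ζ + 1 / 2

theorem HasReiter.of_fixed [IsProbabilityMeasure μ] [Countable W] (hG : PmpAction 𝔾 X μ)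
    {H D : Type} [Group H] [Countable H] [Countable D] {c : 𝔾 → X → H}
    {A : Set 𝔾} (hc : ∀ a ∈ A, Cm (c a)) {τ : H →* Equiv.Perm D} {k : D} (hk : ∀ h, τ h k = k) :
    HasReiter μ c A τ := by
  have h1 : AInv μ c A (1 : H →* Equiv.Perm Unit) 0 (fun (_ : X) _ => (1 : ℝ≥0∞)) :=
    ⟨⟨fun _ => measurable_const, .of_forall fun x => by simp⟩, fun a _ => by simp [err, ad_self]⟩
  intro δ hδ
  exact ⟨_, (h1.push (c' := c) (τ' := τ) (j := fun _ _ => k) hG hc (fun _ => Cm.const _)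
    fun a _ => .of_forall fun x _ => (hk _).symm).mono zero_le⟩

theorem exists_minimizing [IsProbabilityMeasure μ] [Finite W] (hG : PmpAction 𝔾 X μ)
    {c : 𝔾 → X → RAAG Λ} (hc : IsCocycle 𝔾 X (RAAG Λ) μ c) {A : Set 𝔾} {a₀ : 𝔾} (ha₀ : a₀ ∈ A)
    (he : Ergodic (fun x : X => a₀ • x) μ) :
    ∃ φ : X → RAAG Λ, Cm φ ∧ ∃ R, Minimizing μ (gauge φ c) A R := by
  have hcA : ∀ a ∈ A, Cm (c a) := fun a _ => hc.cm a
  obtain ⟨κ, hκ, hκw⟩ := exists_meet (Λ := Λ)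
  have huniv : ∀ h : RAAG Λ, perm (RAAG Λ) (Par Λ) h ⟨Set.univ, QuotientGroup.mk 1⟩ =
      ⟨Set.univ, QuotientGroup.mk 1⟩ := fun h => by
    rw [perm_apply, sigma_smul_eq_iff, coset_smul_eq_self_iff, standardSub_univ]
    exact Subgroup.mem_top _
  have hR := HasReiter.of_fixed (W := W) hG hcA huniv
  obtain ⟨β, hβ, hβe, ρ, hρ, hρ'⟩ := concentration hG hc (τB := perm (RAAG Λ) (Blk Λ)) (bl := blk)
    blk_smul (w := fun k => k.1.ncard) (fun h k => rfl) (N := Nat.card W)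
    (fun k => Set.ncard_le_card k.1) hκ
    (fun p => (hκw p).1) (fun p => (hκw p).2) hR
  obtain ⟨R, hRβ⟩ := (hβ.comp fun B => B.1).ergodic_const he (by
    filter_upwards [hβe a₀ (.inl ha₀)] with x hx
    rw [hx]; rfl)
  have hlift : ∀ B : Blk Λ, ∃ g : RAAG Λ, B.1 = R → g • B = blk₀ Λ R := by
    rintro ⟨R', q⟩
    induction q using QuotientGroup.induction_on with
    | H g =>
      refine ⟨g⁻¹, ?_⟩
      rintro rfl
      refine (sigma_smul_eq_iff _ _ _).2 ?_
      rw [coset_smul_eq_iff]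
      simp [one_mem]
  choose s hs using hlift
  have hφ : Cm fun x => s (β x) := hβ.comp s
  have hst : ∀ᵐ x ∂μ, s (β x) • β x = blk₀ Λ R := hRβ.mono fun x hx => hs _ hx
  have hpush : ∀ ζ, rk μ (fun k => k.1.ncard) (push (fun x k => perm (RAAG Λ) (Par Λ) (s (β x)) k) ζ) =
      rk μ (fun k => k.1.ncard) ζ := fun ζ => wt_push _ _ _
  have hr : ∀ ε > 0, ∀ δ > 0, ∃ ζ, AInv μ (gauge (fun x => s (β x)) c) A (perm (RAAG Λ) (Par Λ)) δ ζ ∧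
      rk μ (fun k => k.1.ncard) ζ ≤ ρ + ε ∧ wt μ (fun _ k => ind (blk k ≠ blk₀ Λ R)) ζ ≤ ε := by
    intro ε hε δ hδ
    obtain ⟨ζ, h1, h2, h3⟩ := (hρ' ε hε).2 δ hδ
    refine ⟨_, h1.gauge hG hcA hφ, (hpush ζ).trans_le h2, ?_⟩
    rw [wt_push]
    refine (wt_mono ?_ ζ).trans h3
    filter_upwards [hst] with x hx k
    refine ind_mono fun h h' => h ?_
    rw [perm_apply, blk_smul, h', hx]
  have hRρ : ∀ ε > 0, (R.ncard : ℝ≥0∞) ≤ ρ + (1 + R.ncard) * ε := by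
    intro ε hε
    obtain ⟨ζ, h1, h2, h3⟩ := hr ε hε 1 one_pos
    have h4 : wt μ (fun _ _ => (R.ncard : ℝ≥0∞)) ζ ≤
        wt μ (fun _ k => (k.1.ncard : ℝ≥0∞) + R.ncard * ind (blk k ≠ blk₀ Λ R)) ζ := by
      refine wt_mono (.of_forall fun x k => ?_) ζ
      by_cases hk : blk k = blk₀ Λ R
      · have : k.1 = R := congrArg Sigma.fst hk
        rw [this]; exact le_self_add
      · rw [ind_true hk, mul_one]; exact le_add_self
    rw [wt_const h1.rm, wt_add (f := fun _ k => (k.1.ncard : ℝ≥0∞)) (fun _ => measurable_const) h1.rm,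
      wt_const_mul (f := fun _ k => ind (blk k ≠ blk₀ Λ R)) (fun _ => measurable_const) h1.rm] at h4
    refine h4.trans ((add_le_add h2 (mul_le_mul_right h3 _)).trans_eq ?_)
    ring
  refine ⟨_, hφ, R, ⟨fun g hg => ?_, fun δ hδ => ?_, ?_⟩⟩
  · filter_upwards [hβe g hg, hst, hG.ae hst g] with x h1 h2 h3
    have h4 : gauge (fun x => s (β x)) c g x • blk₀ Λ R = blk₀ Λ R := by
      have h5 : (s (β x))⁻¹ • blk₀ Λ R = β x := by rw [← h2, inv_smul_smul]
      rw [perm_apply] at h1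
      rw [gauge, mul_smul, mul_smul, h5, ← h1, h3]
    have h5 := (sigma_smul_eq_iff _ _ _).1 h4
    rw [coset_smul_eq_self_iff] at h5
    simpa using h5
  · obtain ⟨ζ, h1, -, h3⟩ := hr δ hδ δ hδ
    exact ⟨ζ, h1, h3⟩
  · set ε : ℝ≥0∞ := 1 / 4 / (1 + R.ncard) with hε
    have hε0 : 0 < ε := ENNReal.div_pos (by simp) (by finiteness)
    obtain ⟨δ, hδ, h1⟩ := (hρ' (1 / 4) (by simp)).1
    refine ⟨δ, hδ, fun ζ hζ => ?_⟩
    have h2 := h1 _ (by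
      have := hζ.gauge hG (fun a _ => (gauge_isCocycle hG hφ hc).cm a) (hφ.comp (·⁻¹))
      rwa [gauge_inv_gauge] at this)
    rw [rk, wt_push] at h2
    refine (hRρ ε hε0).trans ?_
    rw [hε, ENNReal.mul_div_cancel (by simp) (by finiteness)]
    calc ρ + 1 / 4 ≤ (rk μ (fun k => k.1.ncard) ζ + 1 / 4) + 1 / 4 := add_le_add_left h2 _
      _ = rk μ (fun k => k.1.ncard) ζ + 1 / 2 := by
        rw [add_assoc]; congr 1
        rw [← ENNReal.toReal_eq_toReal_iff' (by finiteness) (by finiteness),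
          ENNReal.toReal_add (by finiteness) (by finiteness)]
        norm_num

end LemmaT

section Drop

variable {X : Type} [MeasurableSpace X] {μ : Measure X} {𝔾 : Type} [Group 𝔾] [MulAction 𝔾 X]
  {W : Type} {Λ : SimpleGraph W} {D E : Type*}

instance [Countable W] : Countable (Wall Λ) := by
  have : ∀ v, Countable (RAAG Λ ⧸ lkSub Λ v) := fun v => Quotient.countable
  infer_instance

theorem wt_prd_snd [Countable D] [Countable E] {ζ : X → D → ℝ≥0∞} {ξ : X → E → ℝ≥0∞} (hζ : RM μ ζ)
    (f : X → E → ℝ≥0∞) : wt μ (fun x p => f x p.2) (prd ζ ξ) = wt μ f ξ := by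
  refine lintegral_congr_ae ?_
  filter_upwards [hζ.sum] with x hx
  simp only [tsum_prd, ENNReal.tsum_mul_left, hx, mul_one]

theorem blk_eq_iff {k : Par Λ} {R : Set W} : blk k = blk₀ Λ R ↔
    ∃ g ∈ standardSub Λ (R ∪ perp Λ R), k = ⟨R, QuotientGroup.mk g⟩ := by
  constructor
  · intro h
    obtain ⟨R', q⟩ := k
    obtain rfl : R' = R := congrArg Sigma.fst h
    induction q using QuotientGroup.induction_on with
    | H g =>
      have h2 := sigma_mk_injective h
      refine ⟨g, ?_, rfl⟩
      have h3 := QuotientGroup.eq.1 h2.symm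
      simpa using h3
  · rintro ⟨g, hg, rfl⟩
    exact congrArg (Sigma.mk R) (QuotientGroup.eq.2 (by simpa using hg))

theorem smul_blk₀ {R : Set W} {g : RAAG Λ} (hg : g ∈ standardSub Λ (R ∪ perp Λ R)) :
    g • blk₀ Λ R = blk₀ Λ R := by
  refine (sigma_smul_eq_iff _ _ _).2 ?_
  rw [coset_smul_eq_self_iff]
  simpa using hg

theorem Minimizing.false_of_hasReiter [IsProbabilityMeasure μ] [Finite W] [Countable E]
    (hG : PmpAction 𝔾 X μ) {c : 𝔾 → X → RAAG Λ} {A : Set 𝔾} (hc : ∀ a ∈ A, Cm (c a)) {R : Set W}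
    (hm : Minimizing μ c A R) {τ : RAAG Λ →* Equiv.Perm E} (hτ : HasReiter μ c A τ)
    (hE : ∀ e, ∃ Z ⊂ R, ∃ k, ∀ g ∈ standardSub Λ R, τ g e = e → k⁻¹ * g * k ∈ standardSub Λ Z) :
    False := by
  let N := standardSub Λ (R ∪ perp Λ R)
  obtain ⟨j, hj, hj'⟩ := exists_equivariant (M := N) (A := E × Par Λ) (B := Par Λ)
    ((prodPerm τ (perm (RAAG Λ) (Par Λ))).comp N.subtype) ((perm (RAAG Λ) (Par Λ)).comp N.subtype)
    (fun p z => blk p.2 = blk₀ Λ R → z.1.ncard + 1 ≤ R.ncard) (by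
      rintro ⟨m, hm⟩ p z h1 h2
      refine h1 ?_
      rw [← smul_blk₀ (inv_mem hm), ← h2]
      simp [blk_smul]) (by
      rintro ⟨e, k⟩
      by_cases hk : blk k = blk₀ Λ R
      · obtain ⟨g, hg, rfl⟩ := blk_eq_iff.1 hk
        obtain ⟨Z, hZ, k', hk'⟩ := hE (τ g⁻¹ e)
        refine ⟨⟨Z, QuotientGroup.mk (g * k')⟩, fun _ => Set.ncard_lt_ncard hZ, ?_⟩
        rintro ⟨m, hm⟩ h2
        rw [MonoidHom.comp_apply, prodPerm_apply, Prod.mk.injEq] at h2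
        obtain ⟨h2, h3⟩ := h2
        simp only [perm_apply, sigma_smul_eq_iff, coset_smul_eq_self_iff, MonoidHom.comp_apply,
          Subgroup.coe_subtype] at h2 h3 ⊢
        have h4 := hk' _ h3 (by
          rw [← Equiv.Perm.mul_apply, ← map_mul, mul_assoc, mul_inv_cancel, mul_one, map_mul,
            Equiv.Perm.mul_apply, h2])
        convert h4 using 1; group
      · exact ⟨k, fun h => absurd h hk, fun m hm => by
          rw [MonoidHom.comp_apply, prodPerm_apply, Prod.mk.injEq] at hm
          exact hm.2⟩)
  obtain ⟨δ, hδ, hmin⟩ := hm.minimal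
  let N : ℕ := Nat.card W + 1
  let δ' : ℝ≥0∞ := min (δ / 2) (1 / 4 / N)
  have hδ' : 0 < δ' := lt_min (ENNReal.half_pos hδ.ne') (ENNReal.div_pos (by simp) (by finiteness))
  obtain ⟨ξ, hξ⟩ := hτ δ' hδ'
  obtain ⟨ζ, hζ, hζb⟩ := hm.reiter δ' hδ'
  have h1 := (hξ.prd hG hc hζ).push (c' := c) (τ' := perm (RAAG Λ) (Par Λ)) (j := fun _ p => j p)
    hG hc (fun _ => Cm.const _) fun a ha => by
      filter_upwards [hm.norm a (.inl ha)] with x hx p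
      exact hj ⟨c a x, hx⟩ p
  have h2 := hmin _ (h1.mono ((add_le_add (min_le_left _ _) (min_le_left _ _)).trans_eq
    (ENNReal.add_halves δ)))
  rw [rk, wt_push] at h2
  have hrm := hξ.rm.prd hζ.rm
  have h3 : wt μ (fun _ p => ((j p).1.ncard : ℝ≥0∞)) (prd ξ ζ) + 1 ≤ R.ncard + 1 / 4 := by
    calc wt μ (fun _ p => ((j p).1.ncard : ℝ≥0∞)) (prd ξ ζ) + 1
        = wt μ (fun _ p => ((j p).1.ncard : ℝ≥0∞) + 1) (prd ξ ζ) := by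
          rw [wt_add (f := fun _ p => ((j p).1.ncard : ℝ≥0∞)) (fun _ => measurable_const) hrm,
            wt_const hrm]
      _ ≤ wt μ (fun _ p => (R.ncard : ℝ≥0∞) + N * ind (blk p.2 ≠ blk₀ Λ R)) (prd ξ ζ) := by
          refine wt_mono (.of_forall fun x p => ?_) _
          by_cases hp : blk p.2 = blk₀ Λ R
          · refine le_trans ?_ le_self_add
            exact_mod_cast hj' p hp
          · rw [ind_true hp, mul_one]
            refine le_trans ?_ le_add_self
            have := Set.ncard_le_card (j p).1
            simp only [N]
            push_cast
            gcongr
      _ = R.ncard + N * wt μ (fun _ k => ind (blk k ≠ blk₀ Λ R)) ζ := by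
          rw [wt_add (f := fun _ _ => (R.ncard : ℝ≥0∞)) (fun _ => measurable_const) hrm,
            wt_const hrm, wt_const_mul (f := fun _ p => ind (blk p.2 ≠ blk₀ Λ R))
              (fun _ => measurable_const) hrm,
            wt_prd_snd hξ.rm (fun _ k => ind (blk k ≠ blk₀ Λ R))]
      _ ≤ R.ncard + N * (1 / 4 / N) := by
          gcongr
          exact hζb.trans (min_le_right _ _)
      _ = R.ncard + 1 / 4 := by
          rw [ENNReal.mul_div_cancel (by simp [N]) (by finiteness)]
  have h4 : (R.ncard : ℝ≥0∞) + 1 ≤ R.ncard + (1 / 4 + 1 / 2) := by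
    calc (R.ncard : ℝ≥0∞) + 1 ≤ _ + 1 / 2 + 1 := add_le_add_left h2 1
      _ = _ + 1 + 1 / 2 := by ring
      _ ≤ R.ncard + 1 / 4 + 1 / 2 := add_le_add_left h3 _
      _ = _ := add_assoc _ _ _
  rw [ENNReal.add_le_add_iff_left (by finiteness)] at h4
  have h5 := ENNReal.toReal_mono (by finiteness) h4
  rw [ENNReal.toReal_add (by finiteness) (by finiteness)] at h5
  norm_num at h5

theorem Minimizing.not_hasReiter_wall [IsProbabilityMeasure μ] [Finite W]
    (hG : PmpAction 𝔾 X μ) {c : 𝔾 → X → RAAG Λ} {A : Set 𝔾} (hc : ∀ a ∈ A, Cm (c a)) {R : Set W}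
    (hm : Minimizing μ c A R) : ¬ HasReiter μ c A
      ((perm (RAAG (Λ.induce R)) (Wall (Λ.induce R))).comp (proj Λ R)) := by
  intro h
  refine hm.false_of_hasReiter hG hc h ?_
  rintro ⟨v, q⟩
  induction q using QuotientGroup.induction_on with
  | H q =>
    refine ⟨{r | r ∈ R ∧ Λ.Adj v r}, ⟨fun r hr => hr.1, fun h => Λ.irrefl (h v.2).2⟩,
      incl Λ R q, fun g hg h => ?_⟩
    rw [MonoidHom.comp_apply, perm_apply, sigma_smul_eq_iff, coset_smul_eq_self_iff] at h
    have h1 := Subgroup.mem_map_of_mem (incl Λ R) h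
    rw [map_incl_standardSub, map_mul, map_mul, incl_proj_of_mem hg, map_inv] at h1
    refine standardSub_mono ?_ h1
    rintro _ ⟨r, hr, rfl⟩
    exact ⟨r.2, hr⟩

theorem mem_of_expo_eq_one {R : Set W} {r : W} (hr : r ∈ R) (hadj : ∀ s ∈ R, s ≠ r → Λ.Adj r s)
    {g : RAAG Λ} (hg : g ∈ standardSub Λ R) (h : expo Λ r g = 1) :
    g ∈ standardSub Λ (R \ {r}) := by
  have h1 := join_decomp (Γ := Λ) (S := {r}) (T := R \ {r}) (by
    rintro u rfl v hv; exact hadj v hv.1 hv.2) (g := g) (by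
    rwa [Set.singleton_union, Set.insert_sdiff_singleton, Set.insert_eq_of_mem hr])
  have h2 : incl Λ {r} (proj Λ {r} g) ∈ Subgroup.zpowers (gen Λ r) := by
    have h2 := incl_mem (Γ := Λ) (S := {r}) (proj Λ {r} g)
    rwa [standardSub, Set.image_singleton, ← Subgroup.zpowers_eq_closure] at h2
  obtain ⟨n, hn⟩ := h2
  have h3 := incl_mem (Γ := Λ) (S := R \ {r}) (proj Λ (R \ {r}) g)
  rw [h1, map_mul, expo_eq_one_of_mem (by simp) h3, mul_one] at h
  simp only at hn
  rw [← hn, map_zpow, expo_gen_self] at h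
  have h4 : n = 0 := by
    have := congrArg Multiplicative.toAdd h
    simpa using this
  rw [h4, zpow_zero] at hn
  rw [h1, ← hn, one_mul]
  exact h3

/-- The translation action of a group on itself through a homomorphism. -/
def transl {H K : Type*} [Group H] [Group K] (f : H →* K) : H →* Equiv.Perm K :=
  (perm K K).comp f

theorem Minimizing.not_hasReiter_expo [IsProbabilityMeasure μ] [Finite W]
    (hG : PmpAction 𝔾 X μ) {c : 𝔾 → X → RAAG Λ} {A : Set 𝔾} (hc : ∀ a ∈ A, Cm (c a)) {R : Set W}
    (hm : Minimizing μ c A R) {r : W} (hr : r ∈ R) (hadj : ∀ s ∈ R, s ≠ r → Λ.Adj r s) :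
    ¬ HasReiter μ c A (transl (expo Λ r)) := by
  intro h
  refine hm.false_of_hasReiter hG hc h fun e => ⟨R \ {r}, ⟨Set.sdiff_subset, fun h => (h hr).2 rfl⟩,
    1, fun g hg h => ?_⟩
  rw [inv_one, one_mul, mul_one]
  refine mem_of_expo_eq_one hr hadj hg ?_
  simpa [transl, perm_apply] using h

end Drop

section Spread

variable {V : Type} {Γ : SimpleGraph V}

/-- The absolute value of the Fox derivative. -/
noncomputable def afox (g : RAAG Γ) (e : Wall Γ) : ℝ≥0∞ := ((fox g e).natAbs : ℝ≥0∞)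

theorem tsum_afox (g : RAAG Γ) : ∑' e, afox g e = len g := by
  rw [← fox_norm, Finsupp.sum, tsum_eq_sum (s := (fox g).support)]
  · push_cast; rfl
  · intro e he
    rw [afox, Finsupp.notMem_support_iff.1 he]; simp

theorem tsum_afox_smul (g h : RAAG Γ) : ∑' e : Wall Γ, afox g (h • e) = len g := by
  rw [← tsum_afox g]
  exact (MulAction.toPerm h).tsum_eq (afox g)

theorem ad_natAbs_le (a b c : ℤ) : ad ((a + b + c).natAbs : ℝ≥0∞) (b.natAbs : ℝ≥0∞) ≤
    a.natAbs + c.natAbs := by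
  rw [ad_le_iff]
  constructor
  · exact_mod_cast (by omega : (a + b + c).natAbs ≤ a.natAbs + c.natAbs + b.natAbs)
  · exact_mod_cast (by omega : b.natAbs ≤ a.natAbs + c.natAbs + (a + b + c).natAbs)

theorem tsum_ad_afox_le (s g t : RAAG Γ) :
    ∑' e, ad (afox (s * g * t⁻¹) (s • e)) (afox g e) ≤ len s + len t := by
  calc ∑' e, ad (afox (s * g * t⁻¹) (s • e)) (afox g e)
      ≤ ∑' e : Wall Γ, (afox s (s • e) + afox t⁻¹ (g⁻¹ • e)) := by
        refine ENNReal.tsum_le_tsum fun e => ?_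
        simp only [afox]
        rw [fox_mul, fox_mul, inv_smul_smul, mul_inv_rev, mul_smul, inv_smul_smul]
        exact ad_natAbs_le _ _ _
    _ = len s + len t := by rw [ENNReal.tsum_add, tsum_afox_smul, tsum_afox_smul, len_inv]

/-- The normalized Fox derivative, a probability measure on walls. -/
noncomputable def foxMeas (e₀ : Wall Γ) (g : RAAG Γ) (e : Wall Γ) : ℝ≥0∞ :=
  open Classical in if len g = 0 then ind (e₀ = e) else afox g e / len g

theorem tsum_foxMeas (e₀ : Wall Γ) (g : RAAG Γ) : ∑' e, foxMeas e₀ g e = 1 := by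
  unfold foxMeas
  split_ifs with h
  · simpa using tsum_mul_ind (fun _ => 1) e₀
  · simp_rw [div_eq_mul_inv]
    rw [ENNReal.tsum_mul_right, tsum_afox, ENNReal.mul_inv_cancel] <;> simp [h]

theorem tsum_ad_le_two {ι : Type*} {f g : ι → ℝ≥0∞} (hf : ∑' i, f i = 1) (hg : ∑' i, g i = 1) :
    ∑' i, ad (f i) (g i) ≤ 2 := by
  refine (ENNReal.tsum_le_tsum fun i => ad_le_add _ _).trans ?_
  rw [ENNReal.tsum_add, hf, hg]; norm_num

theorem tsum_ad_normalize_le {ι : Type*} {a b : ι → ℝ≥0∞} {L L' M : ℝ≥0∞} (ha : ∑' i, a i = L)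
    (hb : ∑' i, b i = L') (hM : ∑' i, ad (a i) (b i) ≤ M) (hL : L ≠ 0) (hLt : L ≠ ⊤) (hL' : L' ≠ 0)
    (hLt' : L' ≠ ⊤) : ∑' i, ad (a i / L) (b i / L') ≤ 2 * M / L' := by
  have h1 : ad L⁻¹ L'⁻¹ * L ≤ M / L' := by
    have h2 : ad L L' ≤ M := by rw [← ha, ← hb]; exact (ad_tsum_le _ _).trans hM
    have h3 := ad_le_iff.1 h2
    have h4 : L⁻¹ * L = 1 := ENNReal.inv_mul_cancel hL hLt
    have h4' : L' * L'⁻¹ = 1 := ENNReal.mul_inv_cancel hL' hLt'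
    rw [ad, max_mul, ENNReal.sub_mul (by simp [hLt]), ENNReal.sub_mul (by simp [hLt]), h4, max_le_iff,
      tsub_le_iff_right, tsub_le_iff_right, ENNReal.div_eq_inv_mul, mul_comm L'⁻¹ M, mul_comm L'⁻¹ L,
      ← add_mul, ← h4']
    constructor
    · gcongr; exact h3.2
    · rw [← add_mul]; gcongr; exact h3.1
  calc ∑' i, ad (a i / L) (b i / L')
      ≤ ∑' i, (ad (a i) (b i) * L'⁻¹ + a i * ad L⁻¹ L'⁻¹) := by
        refine ENNReal.tsum_le_tsum fun i => ?_
        simp only [div_eq_mul_inv]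
        refine (ad_triangle _ (a i * L'⁻¹) _).trans ?_
        rw [add_comm]
        refine add_le_add (ad_mul_right_le _ _ _) ?_
        rw [mul_comm (a i), mul_comm (a i), mul_comm (a i)]
        exact ad_mul_right_le _ _ _
    _ ≤ M * L'⁻¹ + M / L' := by
        rw [ENNReal.tsum_add, ENNReal.tsum_mul_right, ENNReal.tsum_mul_right, ha]
        gcongr
        rw [mul_comm]; exact h1
    _ = 2 * M / L' := by rw [div_eq_mul_inv, div_eq_mul_inv]; ring

theorem tsum_ad_foxMeas_le (e₀ : Wall Γ) (s g t : RAAG Γ) (hg : len g ≠ 0) :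
    ∑' e, ad (foxMeas e₀ (s * g * t⁻¹) (s • e)) (foxMeas e₀ g e) ≤
      2 * (len s + len t) / len g := by
  by_cases h : len (s * g * t⁻¹) = 0
  · have h1 : ∑' e, foxMeas e₀ (s * g * t⁻¹) (s • e) = 1 := by
      rw [← tsum_foxMeas e₀ (s * g * t⁻¹)]
      exact (MulAction.toPerm s).tsum_eq _
    refine (tsum_ad_le_two h1 (tsum_foxMeas e₀ g)).trans ?_
    have h2 : len g ≤ len s + len t := by
      have h3 := len_eq_zero h
      have h4 : g = s⁻¹ * t := by
        rw [mul_inv_eq_one] at h3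
        rw [← h3]; group
      rw [h4]
      refine (len_mul_le _ _).trans ?_
      rw [len_inv]
    rw [ENNReal.le_div_iff_mul_le (by simp [hg]) (by simp)]
    gcongr
    exact_mod_cast h2
  · simp only [foxMeas, if_neg h, if_neg hg]
    exact tsum_ad_normalize_le (tsum_afox_smul _ _) (tsum_afox _) (tsum_ad_afox_le s g t)
      (by simpa using h) (by simp) (by simpa using hg) (by simp)

end Spread

section Spread

variable {X : Type} [MeasurableSpace X] {μ : Measure X} {𝔾 : Type} [Group 𝔾] [MulAction 𝔾 X]
  {V : Type} {Γ : SimpleGraph V}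

theorem exists_tail_le [IsFiniteMeasure μ] {N : X → ℕ} (hN : Cm N) {ε : ℝ≥0∞} (hε : 0 < ε) :
    ∃ C, μ {x | C < N x} ≤ ε := by
  have h1 := tendsto_measure_iInter_atTop (μ := μ) (s := fun C : ℕ => {x | C < N x})
    (fun C => (hN.preimage {n | C < n}).nullMeasurableSet)
    (fun C C' h x (hx : C' < N x) => lt_of_le_of_lt h hx) ⟨0, measure_ne_top _ _⟩
  have h2 : (⋂ C, {x | C < N x}) = ∅ := by
    ext x
    simp only [Set.mem_iInter, Set.mem_empty_iff_false, iff_false, not_forall]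
    exact ⟨N x, lt_irrefl (N x)⟩
  rw [h2, measure_empty] at h1
  exact (h1.eventually_le_const hε).exists

theorem exists_tail_le_of_finite [IsFiniteMeasure μ] {ι : Type*} {A : Set ι} (hA : A.Finite)
    {N : ι → X → ℕ} (hN : ∀ a ∈ A, Cm (N a)) {ε : ℝ≥0∞} (hε : 0 < ε) :
    ∃ C, ∀ a ∈ A, μ {x | C < N a x} ≤ ε := by
  choose! C hC using fun a (ha : a ∈ A) => exists_tail_le (μ := μ) (hN a ha) hε
  obtain ⟨C', hC'⟩ := (hA.image C).bddAbove
  refine ⟨C', fun a ha => (measure_mono fun x hx => ?_).trans (hC a ha)⟩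
  exact lt_of_le_of_lt (hC' ⟨a, ha, rfl⟩) hx

/-- If the cocycle is not tight along the powers of an element commuting with `A`, then there are
almost invariant random measures on the set of walls. -/
theorem hasReiter_wall_of_not_tight [IsProbabilityMeasure μ] [Countable V] [Nonempty V]
    (hG : PmpAction 𝔾 X μ) {c : 𝔾 → X → RAAG Γ} (hc : IsCocycle 𝔾 X (RAAG Γ) μ c) {A : Set 𝔾}
    (hA : A.Finite) {b : 𝔾} (hb : ∀ a ∈ A, Commute b a)
    (ht : ∀ C : ℕ, ∀ ε > 0, ∃ n : ℕ, μ {x | len (c (b ^ n) x) ≤ C} < ε) :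
    HasReiter μ c A (perm (RAAG Γ) (Wall Γ)) := by
  intro δ hδ
  obtain ⟨r, hr0, hrδ⟩ : ∃ r : ℝ≥0∞, 0 < r ∧ 7 * r ≤ δ ∧ r ≠ ⊤ := by
    refine ⟨min (δ / 7) 1, lt_min (ENNReal.div_pos hδ.ne' (by simp)) one_pos, ?_, by simp⟩
    exact (mul_le_mul_right (min_le_left _ _) _).trans (ENNReal.mul_div_le)
  obtain ⟨C₀, hC₀⟩ := exists_tail_le_of_finite (μ := μ) hA (N := fun a x => len (c a x))
    (fun a _ => (hc.cm a).comp len) hr0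
  obtain ⟨C, hC⟩ : ∃ C : ℕ, 4 * (C₀ : ℝ≥0∞) / (C + 1) ≤ r := by
    obtain ⟨C, hC⟩ := ENNReal.exists_nat_gt (r := 4 * C₀ / r) (by
      exact ENNReal.div_ne_top (by finiteness) hr0.ne')
    refine ⟨C, ENNReal.div_le_of_le_mul ?_⟩
    have := (ENNReal.div_le_iff_le_mul (.inl hr0.ne') (.inl hrδ.2)).1 hC.le
    refine this.trans ?_
    rw [mul_comm]
    gcongr
    exact le_self_add
  obtain ⟨n, hn⟩ := ht C r hr0
  let p : X → RAAG Γ := fun x => c (b ^ n) ((b ^ n)⁻¹ • x)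
  have hp : Cm p := (hc.cm _).comp_meas (hG _).measurable
  have hpμ : μ {x | len (p x) ≤ C} ≤ r := by
    have hms : MeasurableSet {x | len (c (b ^ n) x) ≤ C} := (hc.cm _).preimage {g | len g ≤ C}
    have := (hG (b ^ n)⁻¹).measure_preimage hms.nullMeasurableSet
    rw [← this] at hn
    exact hn.le
  obtain ⟨v⟩ := ‹Nonempty V›
  let e₀ : Wall Γ := ⟨v, QuotientGroup.mk 1⟩
  have hrm : RM μ fun x => foxMeas e₀ (p x) :=
    ⟨fun k => hp.measurable fun g => foxMeas e₀ g k, .of_forall fun x => tsum_foxMeas _ _⟩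
  refine ⟨fun x => foxMeas e₀ (p x), hrm, fun a ha => ?_⟩
  have hcm : Cm fun x => c a ((b ^ n)⁻¹ • x) := (hc.cm a).comp_meas (hG _).measurable
  have hpa : ∀ᵐ x ∂μ, p (a • x) = c a x * p x * (c a ((b ^ n)⁻¹ • x))⁻¹ := by
    have hcomm : Commute (b ^ n) a := (hb a ha).pow_left n
    filter_upwards [hG.ae (hc.2 (b ^ n) a) (b ^ n)⁻¹, hG.ae (hc.2 a (b ^ n)) (b ^ n)⁻¹] with x h1 h2
    rw [← hcomm.eq, h1, smul_inv_smul] at h2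
    have h3 : (b ^ n)⁻¹ • a • x = a • (b ^ n)⁻¹ • x := by
      rw [← mul_smul, ← mul_smul, hcomm.inv_left.eq]
    simp only [p]
    rw [h3, ← h2]; group
  have hptw : ∀ᵐ x ∂μ, ∑' e, ad (foxMeas e₀ (p (a • x)) (c a x • e)) (foxMeas e₀ (p x) e) ≤
      2 * ind (len (p x) ≤ C) + 2 * ind (C₀ < len (c a x)) +
        2 * ind (C₀ < len (c a ((b ^ n)⁻¹ • x))) + r := by
    filter_upwards [hpa] with x hx
    have h2 : ∑' e, ad (foxMeas e₀ (p (a • x)) (c a x • e)) (foxMeas e₀ (p x) e) ≤ 2 := by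
      refine tsum_ad_le_two ?_ (tsum_foxMeas e₀ _)
      rw [← tsum_foxMeas e₀ (p (a • x))]
      exact (MulAction.toPerm (c a x)).tsum_eq _
    by_cases h3 : len (p x) ≤ C
    · refine h2.trans ?_
      rw [ind_true h3, mul_one, add_assoc, add_assoc]; exact le_self_add
    by_cases h4 : C₀ < len (c a x)
    · refine h2.trans ?_
      rw [ind_true h4, mul_one, add_right_comm, add_right_comm _ 2, add_right_comm _ 2]; exact le_add_self
    by_cases h5 : C₀ < len (c a ((b ^ n)⁻¹ • x))
    · refine h2.trans ?_
      rw [ind_true h5, mul_one, add_right_comm]; exact le_add_self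
    refine le_trans ?_ le_add_self
    rw [hx]
    refine (tsum_ad_foxMeas_le e₀ _ _ _ (by omega)).trans (le_trans ?_ hC)
    have h6 : ((len (c a x) : ℝ≥0∞) + len (c a ((b ^ n)⁻¹ • x))) ≤ 2 * C₀ := by
      exact_mod_cast (by omega : len (c a x) + len (c a ((b ^ n)⁻¹ • x)) ≤ 2 * C₀)
    have h7 : (C : ℝ≥0∞) + 1 ≤ len (p x) := by
      exact_mod_cast (by omega : C + 1 ≤ len (p x))
    calc _ ≤ 2 * (2 * (C₀ : ℝ≥0∞)) / (C + 1) := by gcongr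
      _ = _ := by rw [← mul_assoc]; norm_num
  have hm1 : MeasurableSet {x | len (p x) ≤ C} := hp.preimage {g | len g ≤ C}
  have hm2 : MeasurableSet {x | C₀ < len (c a x)} := (hc.cm a).preimage {g | C₀ < len g}
  have hm3 : MeasurableSet {x | C₀ < len (c a ((b ^ n)⁻¹ • x))} := hcm.preimage {g | C₀ < len g}
  have h3r : μ {x | C₀ < len (c a ((b ^ n)⁻¹ • x))} ≤ r := by
    have := (hG (b ^ n)⁻¹).measure_preimage hm2.nullMeasurableSet
    exact this.trans_le (hC₀ a ha)
  refine (lintegral_mono_ae hptw).trans ?_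
  rw [lintegral_add_right _ measurable_const,
    lintegral_add_right _ ((measurable_ind hm3).const_mul _),
    lintegral_add_right _ ((measurable_ind hm2).const_mul _),
    lintegral_const_mul _ (measurable_ind hm1), lintegral_const_mul _ (measurable_ind hm2),
    lintegral_const_mul _ (measurable_ind hm3), lintegral_ind hm1, lintegral_ind hm2,
    lintegral_ind hm3, lintegral_const, measure_univ, mul_one]
  calc _ ≤ 2 * r + 2 * r + 2 * r + r := by gcongr; exact hC₀ a ha
    _ = 7 * r := by ring
    _ ≤ δ := hrδ.1

end Spread

section Amen

variable {X : Type} [MeasurableSpace X] {μ : Measure X} {𝔾 : Type} [Group 𝔾] [MulAction 𝔾 X]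
  {H : Type} [Group H] {W : Type} {Λ : SimpleGraph W}

theorem not_hasReiter_freeGroup [IsProbabilityMeasure μ] [Countable H] (hG : PmpAction 𝔾 X μ)
    {c : 𝔾 → X → H} {A : Set 𝔾} (hc : ∀ a ∈ A, Cm (c a)) (f : H →* FreeGroup Bool) {s : Bool → 𝔾}
    (hs : ∀ i, s i ∈ A) (hf : ∀ i, ∀ᵐ x ∂μ, f (c (s i) x) = FreeGroup.of i) :
    ¬ HasReiter μ c A (transl f) := by
  intro h
  have : Countable (FreeGroup Bool) := FreeGroup.toWord_injective.countable
  obtain ⟨ζ, hζ⟩ := h (1 / 4) (by simp)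
  let m : Bool × Bool → ℝ≥0∞ := fun w => wt μ (fun _ k => ind (k ∈ FreeGroup.startsWith w)) ζ
  have hpair : ∀ i, 1 ≤ m (i, false) + (1 / 4 + m (i, true)) := fun i => by
    have h1 := wt_transport_le (hG (s i)) (cm_perm (hc _ (hs i)) (transl f)) hζ.rm
      (f := fun _ k => ind (k ∈ FreeGroup.startsWith (i, true))) (fun _ => measurable_const)
      fun _ _ => ind_le_one _
    have h2 : wt μ (fun _ k => ind (k ∉ FreeGroup.startsWith (i, false))) ζ ≤
        1 / 4 + m (i, true) := by
      refine le_trans (wt_mono ?_ ζ) (h1.trans (add_le_add_left (hζ.err_le _ (hs i)) _))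
      filter_upwards [hf i] with x hx k
      refine ind_mono fun hk => ?_
      have : transl f (c (s i) x) k = FreeGroup.mk [(i, true)] * k := by
        simp [transl, hx, FreeGroup.of]
      rw [this]
      exact FreeGroup.startsWith_mk_mul (w := (i, true)) k hk
    refine le_trans ?_ (add_le_add_right h2 _)
    simp only [m]
    rw [← wt_add (f := fun _ k => ind (k ∈ FreeGroup.startsWith (i, false)))
      (fun _ => measurable_const) hζ.rm]
    simp only [ind_add_not]
    exact (wt_const hζ.rm 1).ge
  have htot : m (true, false) + m (true, true) + (m (false, false) + m (false, true)) ≤ 1 := by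
    simp only [m]
    rw [← wt_add (f := fun _ k => ind (k ∈ FreeGroup.startsWith (true, false)))
        (fun _ => measurable_const) hζ.rm,
      ← wt_add (f := fun _ k => ind (k ∈ FreeGroup.startsWith (false, false)))
        (fun _ => measurable_const) hζ.rm,
      ← wt_add (f := fun _ k => ind (k ∈ FreeGroup.startsWith (true, false)) +
          ind (k ∈ FreeGroup.startsWith (true, true)))
        (fun _ => measurable_const) hζ.rm]
    refine le_trans (wt_mono (.of_forall fun x k => ?_) ζ) (wt_const hζ.rm 1).le
    simp only [ind, FreeGroup.startsWith, Set.mem_ofPred_eq]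
    obtain ⟨o, ho⟩ : ∃ o, k.toWord[0]? = o := ⟨_, rfl⟩
    rcases o with _ | ⟨_ | _, _ | _⟩ <;> simp [ho]
  have h3 := add_le_add (hpair true) (hpair false)
  have h4 : m (true, false) + (1 / 4 + m (true, true)) + (m (false, false) + (1 / 4 + m (false, true)))
      = m (true, false) + m (true, true) + (m (false, false) + m (false, true)) + (1 / 4 + 1 / 4) := by
    ring
  rw [h4] at h3
  have h5 := h3.trans (add_le_add_left htot _)
  have h6 : (1 : ℝ≥0∞) / 4 + 1 / 4 < 1 := by
    rw [← ENNReal.toReal_lt_toReal (by finiteness) (by finiteness),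
      ENNReal.toReal_add (by finiteness) (by finiteness)]
    norm_num
  exact absurd h5 (not_le.2 (ENNReal.add_lt_add_left (by simp) h6))

theorem tsum_ind_finset {D : Type*} (S : Finset D) : ∑' k, ind (k ∈ S) = S.card := by
  rw [tsum_eq_sum (s := S) fun k hk => ind_false hk, Finset.sum_congr rfl fun k hk => ind_true hk]
  simp

theorem tsum_ad_interval_le (n m : ℤ) :
    ∑' k : ℤ, ad (ind (k + m ∈ Finset.Ico 0 n)) (ind (k ∈ Finset.Ico 0 n)) ≤
      4 * (m.natAbs : ℝ≥0∞) := by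
  let B := Finset.Ico (-(m.natAbs : ℤ)) m.natAbs
  let B' := Finset.Ico (n - (m.natAbs : ℤ)) (n + m.natAbs)
  calc _ ≤ ∑' k : ℤ, (ind (k ∈ B) + ind (k ∈ B')) := by
        refine ENNReal.tsum_le_tsum fun k => ?_
        rw [ad_le_iff]
        constructor <;>
        · by_cases h : k ∈ B ∨ k ∈ B'
          · refine (ind_le_one _).trans (le_trans ?_ le_self_add)
            rcases h with h | h
            · rw [ind_true h]; exact le_self_add
            · rw [ind_true h]; exact le_add_self
          · refine le_trans (ind_mono fun hk => ?_) le_add_self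
            simp only [B, B', Finset.mem_Ico, not_or] at *
            omega
    _ = _ := by
      rw [ENNReal.tsum_add, tsum_ind_finset, tsum_ind_finset]
      simp only [B, B', Int.card_Ico]
      exact_mod_cast (by omega : ((m.natAbs : ℤ) - -(m.natAbs : ℤ)).toNat +
        (n + (m.natAbs : ℤ) - (n - (m.natAbs : ℤ))).toNat = 4 * m.natAbs)

/-- Homomorphisms to `ℤ` on which the cocycle is constant give almost invariant measures. -/
theorem hasReiter_transl_of_const [IsProbabilityMeasure μ] {c : 𝔾 → X → H} {A : Set 𝔾}
    (hA : A.Finite) (f : H →* Multiplicative ℤ) (hf : ∀ a ∈ A, ∃ m, ∀ᵐ x ∂μ, f (c a x) = m) :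
    HasReiter μ c A (transl f) := by
  choose! m hm using hf
  intro δ hδ
  obtain ⟨M, hM⟩ := (hA.image fun a => (m a).toAdd.natAbs).bddAbove
  obtain ⟨n, hn⟩ := ENNReal.exists_nat_gt (r := 4 * M / δ)
    (ENNReal.div_ne_top (by finiteness) hδ.ne')
  have hn0 : (n : ℝ≥0∞) ≠ 0 := fun h => by simp [h] at hn
  let p : ℤ → ℝ≥0∞ := fun k => ind (k ∈ Finset.Ico 0 (n : ℤ))
  refine ⟨fun _ k => p k.toAdd * (n : ℝ≥0∞)⁻¹, ⟨fun _ => measurable_const, .of_forall fun _ => ?_⟩,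
    fun a ha => ?_⟩
  · rw [ENNReal.tsum_mul_right, Multiplicative.toAdd.tsum_eq p, tsum_ind_finset]
    simpa using ENNReal.mul_inv_cancel hn0 (by simp)
  · have h1 : ∀ᵐ x ∂μ, ∑' k : Multiplicative ℤ, ad (p (transl f (c a x) k).toAdd * (n : ℝ≥0∞)⁻¹)
        (p k.toAdd * (n : ℝ≥0∞)⁻¹) ≤ δ := by
      filter_upwards [hm a ha] with x hx
      calc _ ≤ ∑' k : Multiplicative ℤ, ad (p (k.toAdd + (m a).toAdd)) (p k.toAdd) *
              (n : ℝ≥0∞)⁻¹ := by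
            refine ENNReal.tsum_le_tsum fun k => ?_
            have : (transl f (c a x) k).toAdd = k.toAdd + (m a).toAdd := by
              simp [transl, hx, add_comm]
            rw [this]
            exact ad_mul_right_le _ _ _
        _ ≤ 4 * M * (n : ℝ≥0∞)⁻¹ := by
            rw [ENNReal.tsum_mul_right, Multiplicative.toAdd.tsum_eq
              (fun k => ad (p (k + (m a).toAdd)) (p k))]
            gcongr
            refine (tsum_ad_interval_le n _).trans ?_
            gcongr
            exact hM ⟨a, ha, rfl⟩
        _ ≤ δ := by
            rw [← div_eq_mul_inv]
            rcases eq_or_ne δ ⊤ with h | h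
            · simp [h]
            refine ENNReal.div_le_of_le_mul ?_
            rw [mul_comm δ]
            exact (ENNReal.div_le_iff_le_mul (.inl hδ.ne') (.inl h)).1 hn.le
    refine (lintegral_mono_ae h1).trans ?_
    simp

/-- The retraction of a right-angled Artin group onto the free group on two nonadjacent
generators. -/
noncomputable def toFree {u v : W} (h : ¬ Λ.Adj u v) : RAAG Λ →* FreeGroup Bool :=
  open Classical in
  raagLift (fun w => if w = u then FreeGroup.of true else if w = v then FreeGroup.of false else 1)
    fun a b hab => by
      by_cases h1 : a = u <;> by_cases h2 : b = u <;> by_cases h3 : a = v <;> by_cases h4 : b = v <;>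
        simp_all [SimpleGraph.adj_comm]

theorem toFree_gen_left {u v : W} (h : ¬ Λ.Adj u v) :
    toFree h (gen Λ u) = FreeGroup.of true := by simp [toFree]

theorem toFree_gen_right {u v : W} (h : ¬ Λ.Adj u v) (hne : u ≠ v) :
    toFree h (gen Λ v) = FreeGroup.of false := by simp [toFree, hne.symm]

end Amen

section MeanErgodic

variable {Z : Type*} [MeasurableSpace Z] {m : Measure Z}

theorem exists_invariant_of_return {Φ : Z → Z} (hΦ : MeasurePreserving Φ m m) {S S' : Set Z}
    (hS : MeasurableSet S) (hS' : MeasurableSet S') (hSm : m S ≠ ⊤) (hSm' : m S' ≠ ⊤) {ε : ℝ}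
    (hε : 0 < ε) (h : ∀ n, ε ≤ m.real (S' ∩ Φ^[n] ⁻¹' S)) :
    ∃ w : Z → ℝ, Measurable w ∧ MemLp w 2 m ∧ w ∘ Φ =ᵐ[m] w ∧ ¬ w =ᵐ[m] 0 := by
  let U : Lp ℝ 2 m →L[ℝ] Lp ℝ 2 m :=
    (Lp.compMeasurePreservingₗᵢ ℝ Φ hΦ (E := ℝ) (p := 2)).toContinuousLinearMap
  have hU : ‖U‖ ≤ 1 := LinearIsometry.norm_toContinuousLinearMap_le _
  have hUapp : ∀ f, U f = Lp.compMeasurePreserving Φ hΦ f := fun f => rfl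
  let f : Lp ℝ 2 m := indicatorConstLp 2 hS hSm 1
  let g : Lp ℝ 2 m := indicatorConstLp 2 hS' hSm' 1
  have hiter : ∀ n, ∃ (hn : MeasurableSet (Φ^[n] ⁻¹' S)) (hn' : m (Φ^[n] ⁻¹' S) ≠ ⊤),
      U^[n] f = indicatorConstLp 2 hn hn' 1 := fun n => by
    induction n with
    | zero => exact ⟨hS, hSm, rfl⟩
    | succ n ih =>
      obtain ⟨hn, hn', ih⟩ := ih
      have h1 : Φ^[n + 1] ⁻¹' S = Φ ⁻¹' (Φ^[n] ⁻¹' S) := by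
        rw [Function.iterate_succ]; rfl
      refine ⟨h1 ▸ hΦ.measurable hn, ?_, ?_⟩
      · rw [h1, hΦ.measure_preimage hn.nullMeasurableSet]; exact hn'
      · rw [Function.iterate_succ_apply', ih, hUapp, Lp.indicatorConstLp_compMeasurePreserving]
        congr 1
  have hinner : ∀ n, ε ≤ inner ℝ g (U^[n] f) := fun n => by
    obtain ⟨hn, hn', h1⟩ := hiter n
    rw [h1, L2.real_inner_indicatorConstLp_one_indicatorConstLp_one]
    exact h n
  let w := ((U.eqLocus (1 : Lp ℝ 2 m →L[ℝ] Lp ℝ 2 m)).orthogonalProjectionOnto f)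
  have hw : Filter.Tendsto (birkhoffAverage ℝ U _root_.id · f) Filter.atTop (nhds (w : Lp ℝ 2 m)) :=
    U.tendsto_birkhoffAverage_orthogonalProjection hU f
  have hwg : ε ≤ inner ℝ g (w : Lp ℝ 2 m) := by
    refine ge_of_tendsto (Filter.Tendsto.inner tendsto_const_nhds hw) ?_
    filter_upwards [Filter.eventually_gt_atTop 0] with n hn
    rw [birkhoffAverage, birkhoffSum, inner_smul_right, inner_sum]
    simp only [_root_.id]
    have h1 : (n : ℝ) * ε ≤ ∑ i ∈ Finset.range n, inner ℝ g (U^[i] f) := by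
      calc (n : ℝ) * ε = ∑ i ∈ Finset.range n, ε := by simp
        _ ≤ _ := Finset.sum_le_sum fun i _ => hinner i
    have hn' : (0 : ℝ) < n := by exact_mod_cast hn
    rw [inv_mul_eq_div, le_div_iff₀ hn', mul_comm]
    exact h1
  have hwU : U w = w := w.2
  refine ⟨(w : Lp ℝ 2 m), (Lp.stronglyMeasurable _).measurable, Lp.memLp _, ?_, fun h0 => ?_⟩
  · have := Lp.coeFn_compMeasurePreserving (w : Lp ℝ 2 m) hΦ
    rw [← hUapp, hwU] at this
    exact this.symm
  · have : (w : Lp ℝ 2 m) = 0 := Lp.eq_zero_iff_ae_eq_zero.2 h0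
    rw [this, inner_zero_right] at hwg
    exact absurd hwg (not_le.2 hε)

end MeanErgodic

section Coboundary

variable {X : Type} [MeasurableSpace X] {μ : Measure X} {𝔾 : Type} [Group 𝔾] [MulAction 𝔾 X]
  {K : Type} [Group K]

theorem IsCocycle.pow_skew {c : 𝔾 → X → K} (hc : IsCocycle 𝔾 X K μ c)
    (b : 𝔾) (n : ℕ) : ∀ᵐ x ∂μ, ∀ k,
      (fun p : X × K => (b • p.1, c b p.1 * p.2))^[n] (x, k) = (b ^ n • x, c (b ^ n) x * k) := by
  induction n with
  | zero =>
    filter_upwards [hc.one] with x hx k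
    simp [hx]
  | succ n ih =>
    filter_upwards [ih, hc.2 b (b ^ n)] with x hx h1 k
    rw [Function.iterate_succ_apply', hx, pow_succ', h1, mul_smul, mul_assoc]

theorem exists_invariant_of_tight [IsProbabilityMeasure μ] [Countable K] {c : 𝔾 → X → K}
    (hG : PmpAction 𝔾 X μ) (hc : IsCocycle 𝔾 X K μ c) {b : 𝔾} {B : Set K} (hB : B.Finite)
    {ε : ℝ≥0∞} (hε : 0 < ε) (ht : ∀ n : ℕ, ε ≤ μ {x | c (b ^ n) x ∈ B}) :
    ∃ w : K → X → ℝ, (∀ k, Measurable (w k)) ∧ (∀ᵐ x ∂μ, ∑' k, ENNReal.ofReal (w k x ^ 2) ≠ ⊤) ∧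
      (∀ᵐ x ∂μ, ∀ k, w (c b x * k) (b • x) = w k x) ∧ ¬ ∀ᵐ x ∂μ, ∀ k, w k x = 0 := by
  let _ : MeasurableSpace K := ⊤
  let m : Measure (X × K) := μ.prod .count
  let Φ : X × K → X × K := fun p => (b • p.1, c b p.1 * p.2)
  have hΦ : MeasurePreserving Φ m m := by
    refine (hG b).skew_product (g := fun x k => c b x * k) ?_ (.of_forall fun x => ?_)
    · exact measurable_from_prod_countable_left fun k => (hc.cm b).measurable fun h => h * k
    · exact map_mul_left_eq_self _ _
  have hms : ∀ P : K → Prop, MeasurableSet {p : X × K | P p.2} := fun P =>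
    measurable_snd (MeasurableSet.of_discrete (s := {k | P k}))
  have hm : ∀ s : Set K, m {p | p.2 ∈ s} = Measure.count s := fun s => by
    have : {p : X × K | p.2 ∈ s} = Set.univ ×ˢ s := by ext; simp
    rw [this, Measure.prod_prod]; simp
  have hεt : ε ≠ ⊤ := ne_top_of_le_ne_top (measure_ne_top _ _) (ht 0)
  obtain ⟨w, hwm, hw2, hwi, hw0⟩ := exists_invariant_of_return hΦ (S := {p | p.2 ∈ ({1} : Set K)})
    (S' := {p | p.2 ∈ B⁻¹}) (hms _) (hms _) (by rw [hm]; simp)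
    (by rw [hm]; exact (Measure.count_apply_lt_top.2 hB.inv).ne) (ENNReal.toReal_pos hε.ne' hεt)
    fun n => by
      have hms' : MeasurableSet ({p : X × K | p.2 ∈ B⁻¹} ∩ Φ^[n] ⁻¹' {p | p.2 ∈ ({1} : Set K)}) :=
        (hms _).inter ((hΦ.iterate n).measurable (hms _))
      refine ENNReal.toReal_mono ?_ ?_
      · refine ne_top_of_le_ne_top ?_ (measure_mono Set.inter_subset_left)
        rw [hm]; exact (Measure.count_apply_lt_top.2 hB.inv).ne
      · refine (ht n).trans ?_
        rw [Measure.prod_apply hms', ← lintegral_ind ((hc.cm _).preimage B)]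
        refine lintegral_mono_ae ?_
        filter_upwards [hc.pow_skew b n] with x hx
        by_cases hxB : c (b ^ n) x ∈ B
        · rw [ind_true hxB]
          refine le_trans ?_ (measure_mono (s := {(c (b ^ n) x)⁻¹})
            (Set.singleton_subset_iff.2 ?_))
          · simp
          · simp [Φ, hx, hxB]
        · rw [ind_false hxB]; exact zero_le
  refine ⟨fun k x => w (x, k), fun k => hwm.comp (by fun_prop), ?_, ?_, fun h => hw0 ?_⟩
  · have h1 : ∫⁻ z, ENNReal.ofReal (w z ^ 2) ∂m ≠ ⊤ := by
      have h1 := hw2.integrable_sq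
      rw [← ofReal_integral_eq_lintegral_ofReal h1 (.of_forall fun z => sq_nonneg _)]
      exact ENNReal.ofReal_ne_top
    rw [lintegral_prod _ (by fun_prop)] at h1
    simp_rw [lintegral_count] at h1
    filter_upwards [ae_lt_top' (by fun_prop) h1] with x hx
    exact hx.ne
  · filter_upwards [Measure.ae_ae_of_ae_prod hwi] with x hx
    rw [Measure.ae_count_iff] at hx
    exact hx
  · refine (Measure.ae_prod_iff_ae_ae (hwm (measurableSet_singleton 0))).2 ?_
    filter_upwards [h] with x hx
    rw [Measure.ae_count_iff]
    exact hx

theorem finite_le_of_tsum {f : K → ℝ} (hf : ∑' k, ENNReal.ofReal (f k ^ 2) ≠ ⊤) {t : ℝ}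
    (ht : 0 < t) : {k | t ≤ |f k|}.Finite := by
  refine (ENNReal.finite_const_le_of_tsum_ne_top hf (ε := ENNReal.ofReal (t ^ 2))
    (by simp; positivity)).subset fun k hk => ?_
  refine ENNReal.ofReal_le_ofReal ?_
  rw [← sq_abs (f k)]
  gcongr
  exact hk

open Classical in
/-- A tight cocycle over an ergodic transformation with values in a torsion-free group is a
coboundary. -/
theorem exists_coboundary_of_tight [IsProbabilityMeasure μ] [Countable K] {c : 𝔾 → X → K}
    (hK : ∀ (k : K) (n : ℕ), 0 < n → k ^ n = 1 → k = 1)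
    (hG : PmpAction 𝔾 X μ) (hc : IsCocycle 𝔾 X K μ c) {b : 𝔾} (hb : Ergodic (b • · : X → X) μ)
    {B : Set K} (hB : B.Finite)
    {ε : ℝ≥0∞} (hε : 0 < ε) (ht : ∀ n : ℕ, ε ≤ μ {x | c (b ^ n) x ∈ B}) :
    ∃ ψ : X → K, Cm ψ ∧ ∀ᵐ x ∂μ, ψ (b • x) = c b x * ψ x := by
  obtain ⟨w, hwm, hwt, hwi, hw0⟩ := exists_invariant_of_tight hG hc hB hε ht
  obtain ⟨n, hn⟩ : ∃ n : ℕ, ¬ ∀ᵐ x ∂μ, ∀ k, |w k x| < 1 / ((n : ℝ) + 1) := by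
    by_contra! h
    refine hw0 ?_
    filter_upwards [ae_all_iff.2 h] with x hx k
    by_contra h0
    obtain ⟨n, hn⟩ := exists_nat_one_div_lt (abs_pos.2 h0)
    exact absurd (hx n k) (not_lt.2 hn.le)
  let t : ℝ := 1 / ((n : ℝ) + 1)
  have ht0 : 0 < t := by positivity
  let F : X → Finset K := fun x =>
    if h : {k | t ≤ |w k x|}.Finite then h.toFinset else ∅
  have hF : Cm F := by
    have h1 : ∀ S : Set K, MeasurableSet {x | {k | t ≤ |w k x|} = S} := fun S => by
      have : {x | {k | t ≤ |w k x|} = S} = ⋂ k, {x | t ≤ |w k x| ↔ k ∈ S} := by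
        ext x; simp [Set.ext_iff]
      rw [this]
      refine MeasurableSet.iInter fun k => ?_
      have h2 : MeasurableSet {x | t ≤ |w k x|} := measurableSet_le measurable_const (hwm k).abs
      by_cases hk : k ∈ S
      · simpa only [hk, iff_true] using h2
      · simp only [hk, iff_false]
        exact h2.compl
    have h2 : ∀ S : Finset K, S.Nonempty → MeasurableSet {x | F x = S} := fun S hS => by
      have : {x | F x = S} = {x | {k | t ≤ |w k x|} = (S : Set K)} := by
        ext x
        simp only [F, Set.mem_ofPred_eq]
        split_ifs with h
        · rw [← Finset.coe_inj, Set.Finite.coe_toFinset]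
        · refine ⟨fun h' => absurd hS (by simp [← h']), fun h' => absurd ?_ h⟩
          rw [h']; exact S.finite_toSet
      rw [this]
      exact h1 S
    intro S
    rcases S.eq_empty_or_nonempty with rfl | hS
    · have : {x | F x = ∅} = (⋃ S : {S : Finset K // S.Nonempty}, {x | F x = S})ᶜ := by
        ext x
        simp only [Set.mem_ofPred_eq, Set.mem_compl_iff, Set.mem_iUnion, Subtype.exists,
          exists_prop, exists_eq_right', Finset.not_nonempty_iff_eq_empty]
      rw [this]
      exact (MeasurableSet.iUnion fun S : {S : Finset K // S.Nonempty} => h2 S.val S.property).compl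
    · exact h2 S hS
  have hFi : ∀ᵐ x ∂μ, F (b • x) = c b x • F x := by
    filter_upwards [hwi, hwt, hG.ae hwt b] with x hx h1 h2
    simp only [F]
    rw [dif_pos (finite_le_of_tsum h1 ht0), dif_pos (finite_le_of_tsum h2 ht0)]
    ext k
    rw [← Finset.inv_smul_mem_iff]
    simp [← hx]
  obtain ⟨d, hd⟩ := Cm.ergodic_const hb (hF.comp fun S => S.Nonempty) (by
    filter_upwards [hFi] with x hx
    simp [hx])
  have hne : d := by
    by_contra hd'
    refine hn ?_
    filter_upwards [hd, hwt] with x hx h1 k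
    have h3 : ¬ (F x).Nonempty := by simpa [hd'] using hx
    by_contra hk
    refine h3 ⟨k, ?_⟩
    simp only [F]
    rw [dif_pos (finite_le_of_tsum h1 ht0)]
    simpa [t] using hk
  obtain ⟨j, hj, -⟩ := exists_equivariant (M := K) (A := {S : Finset K // S.Nonempty}) (B := K)
    { toFun := fun m => ⟨fun S => ⟨m • S.1, S.2.smul_finset⟩, fun S => ⟨m⁻¹ • S.1, S.2.smul_finset⟩,
        fun S => by simp, fun S => by simp⟩
      map_one' := by ext S : 2; simp
      map_mul' := fun a b => by ext S : 2; simp [mul_smul] }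
    (perm K K) (fun S k => k ∈ S.1) (fun m S k hk => Finset.smul_mem_smul_finset hk)
    (fun S => by
      obtain ⟨k, hk⟩ := S.2
      refine ⟨k, hk, fun m hm => ?_⟩
      have hm' : m • S.1 = S.1 := congrArg Subtype.val hm
      have h1 : ∀ n : ℕ, m ^ n * k ∈ S.1 := fun n => by
        induction n with
        | zero => simpa
        | succ n ih =>
          rw [pow_succ', mul_assoc, ← hm']
          exact Finset.smul_mem_smul_finset ih
      obtain ⟨a, b, hab, h2⟩ : ∃ a b : ℕ, a < b ∧ m ^ a * k = m ^ b * k := by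
        have : ¬ Function.Injective fun n : ℕ => (⟨m ^ n * k, h1 n⟩ : S.1) :=
          not_injective_infinite_finite _
        simp only [Function.Injective, not_forall] at this
        obtain ⟨a, b, h, hab⟩ := this
        rcases lt_or_gt_of_ne hab with h' | h'
        · exact ⟨a, b, h', congrArg Subtype.val h⟩
        · exact ⟨b, a, h', congrArg Subtype.val h.symm⟩
      have h3 : m ^ (b - a) = 1 := by
        have h4 := mul_right_cancel h2
        rw [← Nat.add_sub_of_le hab.le, pow_add] at h4
        simpa using h4.symm
      rw [hK m _ (by omega) h3]
      simp)
  have hF' : Cm fun x => if h : (F x).Nonempty then j ⟨F x, h⟩ else 1 :=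
    hF.comp fun S => if h : S.Nonempty then j ⟨S, h⟩ else 1
  refine ⟨_, hF', ?_⟩
  filter_upwards [hFi, hd] with x hx h1
  have h2 : (F x).Nonempty := by rw [h1]; exact hne
  have h3 : (F (b • x)).Nonempty := by rw [hx]; exact h2.smul_finset
  rw [dif_pos h2, dif_pos h3]
  have := hj (c b x) ⟨F x, h2⟩
  rw [perm_apply] at this
  rw [← smul_eq_mul, ← this]
  congr 1
  exact Subtype.ext hx

end Coboundary

section TheoremS

variable {X : Type} [MeasurableSpace X] {μ : Measure X} {𝔾 : Type} [Group 𝔾] [MulAction 𝔾 X]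
  {W : Type} {Λ : SimpleGraph W}

theorem IsCocycle.map {H K : Type} [Group H] [Group K] [Countable H] {c : 𝔾 → X → H}
    (hc : IsCocycle 𝔾 X H μ c) (f : H →* K) : IsCocycle 𝔾 X K μ fun g x => f (c g x) := by
  refine ⟨fun g => (hc.cm g).comp f, fun g g' => ?_⟩
  filter_upwards [hc.2 g g'] with x hx
  rw [hx, map_mul]

theorem disjoint_perp (R : Set W) : Disjoint R (perp Λ R) :=
  Set.disjoint_left.2 fun _ h h' => h'.1 h

theorem proj_perp_eq_one {R : Set W} {g : RAAG Λ} (hg : g ∈ standardSub Λ R) :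
    proj Λ (perp Λ R) g = 1 := proj_eq_one (disjoint_perp R).symm hg

theorem Minimizing.hasReiter_perp [IsProbabilityMeasure μ] [Finite W] (hG : PmpAction 𝔾 X μ)
    {c : 𝔾 → X → RAAG Λ} {A : Set 𝔾} (hc : ∀ a ∈ A, Cm (c a)) {R : Set W}
    (hm : Minimizing μ c A R) : HasReiter μ c A (transl (proj Λ (perp Λ R))) := by
  classical
  have h1 : ∀ k : Par Λ, ∃ l : RAAG (Λ.induce (perp Λ R)), ∀ g ∈ standardSub Λ (R ∪ perp Λ R),
      k = ⟨R, QuotientGroup.mk g⟩ → l = proj Λ (perp Λ R) g := fun k => by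
    by_cases hk : blk k = blk₀ Λ R
    · obtain ⟨g, hg, rfl⟩ := blk_eq_iff.1 hk
      refine ⟨proj Λ (perp Λ R) g, fun g' hg' h => ?_⟩
      have h1 : (QuotientGroup.mk g : RAAG Λ ⧸ standardSub Λ R) = QuotientGroup.mk g' :=
        sigma_mk_injective (β := fun R : Set W => RAAG Λ ⧸ standardSub Λ R) h
      have h2 := proj_perp_eq_one (QuotientGroup.eq.1 h1)
      rw [map_mul, map_inv, inv_mul_eq_one] at h2
      exact h2
    · exact ⟨1, fun g hg h => absurd (blk_eq_iff.2 ⟨g, hg, h⟩) hk⟩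
  choose j hj using h1
  intro δ hδ
  obtain ⟨ζ, hζ, hw⟩ := hm.reiter (δ / 3) (ENNReal.div_pos hδ.ne' (by simp))
  have := hζ.push_of_le (c' := c) (τ' := transl (proj Λ (perp Λ R))) (j := fun _ => j) hG hc
    (fun k => Cm.const _) (δ' := δ / 3) fun a ha => by
      refine le_trans (wt_mono ?_ ζ) hw
      filter_upwards [hm.norm a (.inl ha)] with x hx k
      refine ind_mono fun h hk => h ?_
      obtain ⟨g, hg, rfl⟩ := blk_eq_iff.1 hk
      rw [hj _ g hg rfl]
      refine (hj _ (c a x * g) (mul_mem hx hg) rfl).trans ?_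
      simp [transl]
  refine ⟨_, this.mono (le_of_eq ?_)⟩
  rw [show δ / 3 + 2 * (δ / 3) = 3 * (δ / 3) by ring]
  exact ENNReal.mul_div_cancel (by simp) (by simp)

/-- The conclusion of the separation theorem: modulo its normalizer, the parabolic subgroup of
type `R` is not seen by `B`, and is acted upon by constants by `A`. -/
structure Separated (μ : Measure X) (c : 𝔾 → X → RAAG Λ) (A B : Set 𝔾) (R : Set W) : Prop where
  norm : ∀ g ∈ A ∪ B, ∀ᵐ x ∂μ, c g x ∈ standardSub Λ (R ∪ perp Λ R)
  triv : ∀ b ∈ B, ∀ᵐ x ∂μ, proj Λ R (c b x) = 1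
  const : ∀ a ∈ A, ∃ t, ∀ᵐ x ∂μ, proj Λ R (c a x) = t
  reiter : HasReiter μ c A (transl (proj Λ (perp Λ R)))
  nonadj : ∃ u ∈ R, ∃ v ∈ R, u ≠ v ∧ ¬ Λ.Adj u v

/-- Commuting elements with a constant in the value of the cocycle. -/
theorem const_of_commute [IsProbabilityMeasure μ] [Countable W] (hG : PmpAction 𝔾 X μ)
    {c : 𝔾 → X → RAAG Λ} (hc : IsCocycle 𝔾 X (RAAG Λ) μ c) {a b : 𝔾} (hab : Commute a b)
    (ha : Ergodic (a • · : X → X) μ) {t : RAAG Λ} (ht : ∀ᵐ x ∂μ, c a x = t) :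
    ∃ s, Commute s t ∧ ∀ᵐ x ∂μ, c b x = s := by
  have h1 : ∀ᵐ x ∂μ, c b (a • x) = t * c b x * t⁻¹ := by
    filter_upwards [hc.2 a b, hc.2 b a, ht, hG.ae ht b] with x h1 h2 h3 h4
    rw [← hab.eq, h1, h3, h4] at h2
    rw [h2, mul_inv_cancel_right]
  have h2 : ∀ n : ℕ, ∀ s, (fun s => t * s * t⁻¹)^[n] s = t ^ n * s * (t ^ n)⁻¹ := fun n s => by
    induction n with
    | zero => simp
    | succ n ih => rw [Function.iterate_succ_apply', ih, pow_succ']; group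
  have h3 : ∀ᵐ x ∂μ, Commute (c b x) t := by
    filter_upwards [(hc.cm b).recurrent (hG a) (fun s => t * s * t⁻¹) h1] with x ⟨n, hn, h⟩
    rw [h2, mul_inv_eq_iff_eq_mul] at h
    exact raag_commute_of_pow hn h.symm
  obtain ⟨s, hs⟩ := (hc.cm b).ergodic_const ha (by
    filter_upwards [h1, h3] with x h1 h3
    rw [h1, ← h3.eq, mul_inv_cancel_right])
  obtain ⟨x, hx, hx'⟩ := (h3.and hs).exists
  exact ⟨s, hx' ▸ hx, hs⟩

theorem Minimizing.exists_coboundary [IsProbabilityMeasure μ] [Finite W] (hG : PmpAction 𝔾 X μ)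
    {c : 𝔾 → X → RAAG Λ} (hc : IsCocycle 𝔾 X (RAAG Λ) μ c) {A : Set 𝔾} (hA : A.Finite) {R : Set W}
    (hm : Minimizing μ c A R) (hR : R.Nonempty) {b : 𝔾} (hb : Ergodic (b • · : X → X) μ)
    (hbA : ∀ a ∈ A, Commute b a) :
    ∃ ψ : X → RAAG (Λ.induce R), Cm ψ ∧ ∀ᵐ x ∂μ, ψ (b • x) = proj Λ R (c b x) * ψ x := by
  have := hR.to_subtype
  have hc' := hc.map (proj Λ R)
  have hn : ¬ HasReiter μ (fun g x => proj Λ R (c g x)) A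
      (perm (RAAG (Λ.induce R)) (Wall (Λ.induce R))) := fun h =>
    hm.not_hasReiter_wall hG (fun a _ => hc.cm a) fun δ hδ =>
      let ⟨ζ, hζ⟩ := h δ hδ
      ⟨ζ, hζ.rm, hζ.err_le⟩
  obtain ⟨C, ε, hε, hC⟩ : ∃ C : ℕ, ∃ ε > (0 : ℝ≥0∞), ∀ n : ℕ,
      ε ≤ μ {x | len (proj Λ R (c (b ^ n) x)) ≤ C} := by
    by_contra! h
    exact hn (hasReiter_wall_of_not_tight hG hc' hA hbA h)
  exact exists_coboundary_of_tight (fun k n hn h => raag_torsionFree hn h) hG hc' hb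
    (finite_len_le C) hε hC

theorem exists_separated [IsProbabilityMeasure μ] [Finite W] (hG : PmpAction 𝔾 X μ)
    {c : 𝔾 → X → RAAG Λ} (hc : IsCocycle 𝔾 X (RAAG Λ) μ c) {A B : Set 𝔾} (hA : A.Finite)
    (hA0 : A.Nonempty) (hB0 : B.Nonempty) (hAe : ∀ a ∈ A, Ergodic (a • · : X → X) μ)
    (hBe : ∀ b ∈ B, Ergodic (b • · : X → X) μ) (hBA : ∀ b ∈ B, ∀ a ∈ A, Commute b a)
    (hn : ¬ HasReiter μ c A (transl (MonoidHom.id (RAAG Λ)))) :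
    ∃ φ : X → RAAG Λ, Cm φ ∧ ∃ R, Separated μ (gauge φ c) A B R := by
  obtain ⟨a₀, ha₀⟩ := hA0
  obtain ⟨b₀, hb₀⟩ := hB0
  obtain ⟨φ, hφ, R, hm⟩ := exists_minimizing hG hc ha₀ (hAe a₀ ha₀)
  have hc' := gauge_isCocycle hG hφ hc
  set c' := gauge φ c with hc'd
  have hR : R.Nonempty := by
    by_contra! h
    subst h
    have h1 := hm.hasReiter_perp hG fun a _ => hc'.cm a
    have h2 := h1.push (c' := c') (τ' := transl (MonoidHom.id (RAAG Λ))) hG (fun a _ => hc'.cm a)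
      (j := fun _ => incl Λ (perp Λ ∅)) (fun k => Cm.const _) fun a _ => .of_forall fun x k => by
        have : c' a x ∈ standardSub Λ (perp Λ ∅) := by simp [perp, standardSub_univ]
        simp [transl, incl_proj_of_mem this]
    have h3 := h2.gauge hG (fun a _ => hc'.cm a) (φ := fun x => (φ x)⁻¹) (hφ.comp _)
    rw [hc'd, gauge_inv_gauge] at h3
    exact hn h3
  have hψ := fun b (hb : b ∈ B) => hm.exists_coboundary hG hc' hA hR (hBe b hb) (hBA b hb)
  obtain ⟨ψ, hψm, hψ₀⟩ := hψ b₀ hb₀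
  have hχ : Cm fun x => incl Λ R (ψ x)⁻¹ := hψm.comp fun k => incl Λ R k⁻¹
  have hc'' := gauge_isCocycle hG hχ hc'
  set c'' := gauge (fun x => incl Λ R (ψ x)⁻¹) c' with hc''d
  have hp : ∀ g x, proj Λ R (c'' g x) = (ψ (g • x))⁻¹ * proj Λ R (c' g x) * ψ x := fun g x => by
    simp [hc''d, gauge]
  have hb1 : ∀ᵐ x ∂μ, proj Λ R (c'' b₀ x) = 1 := by
    filter_upwards [hψ₀] with x hx
    rw [hp, hx]; group
  have hcR := hc''.map (proj Λ R)
  have ha1 : ∀ a ∈ A, ∃ t, ∀ᵐ x ∂μ, proj Λ R (c'' a x) = t := fun a ha =>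
    let ⟨t, _, ht⟩ := const_of_commute hG hcR (hBA b₀ hb₀ a ha) (hBe b₀ hb₀) hb1
    ⟨t, ht⟩
  have hN : ∀ g ∈ A ∪ B, ∀ᵐ x ∂μ, c'' g x ∈ standardSub Λ (R ∪ perp Λ R) := fun g hg => by
    filter_upwards [hm.norm g (hg.imp_right fun hg a ha => hBA g hg a ha)] with x hx
    have h1 : ∀ k : RAAG (Λ.induce R), incl Λ R k ∈ standardSub Λ (R ∪ perp Λ R) := fun k =>
      standardSub_mono Set.subset_union_left (incl_mem k)
    exact mul_mem (mul_mem (h1 _) hx) (inv_mem (h1 _))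
  refine ⟨_, hχ.comp₂ hφ (· * ·), R, ?_⟩
  rw [← gauge_gauge, ← hc'd, ← hc''d]
  refine ⟨hN, fun b hb => ?_, ha1, ?_, ?_⟩
  · obtain ⟨t, ht⟩ := ha1 a₀ ha₀
    obtain ⟨s, -, hs⟩ := const_of_commute hG hcR (hBA b hb a₀ ha₀).symm (hAe a₀ ha₀) ht
    obtain ⟨ψ', hψ'm, hψ'⟩ := hψ b hb
    have h1 : ∀ᵐ x ∂μ, (ψ (b • x))⁻¹ * ψ' (b • x) = s * ((ψ x)⁻¹ * ψ' x) := by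
      filter_upwards [hψ', hs] with x h1 h2
      rw [h1, ← h2, hp]; group
    have h2 := (hψm.comp₂ hψ'm fun a b => a⁻¹ * b).recurrent (hG b) _ h1
    obtain ⟨x, n, hn0, hx⟩ := h2.exists
    have h3 : ∀ (n : ℕ) k, (fun k => s * k)^[n] k = s ^ n * k := fun n k => by
      rw [mul_left_iterate]
    rw [h3, mul_eq_right] at hx
    rw [raag_torsionFree hn0 hx] at hs
    exact hs
  · have h1 := hm.hasReiter_perp hG fun a _ => hc'.cm a
    have h2 := h1.gauge hG (fun a _ => hc'.cm a) hχ
    exact h2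
  · by_contra! h
    obtain ⟨r, hr⟩ := hR
    refine hm.not_hasReiter_expo hG (fun a _ => hc'.cm a) hr (fun s hs hsr => h r hr s hs hsr.symm) ?_
    have h1 : HasReiter μ c'' A (transl (expo Λ r)) := hasReiter_transl_of_const hA _ fun a ha => by
      obtain ⟨t, ht⟩ := ha1 a ha
      refine ⟨expo Λ r (incl Λ R t), ?_⟩
      filter_upwards [ht, hN a (.inl ha)] with x hx hx'
      rw [join_decomp (fun u hu v hv => ((hv.2 u hu).symm)) hx', map_mul, hx,
        expo_eq_one_of_mem (S := perp Λ R) (fun h => h.1 hr) (incl_mem _), mul_one]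
    have h2 := h1.gauge hG (fun a _ => hc''.cm a) (φ := fun x => incl Λ R (ψ x)) (hψm.comp _)
    rw [hc''d, gauge_gauge] at h2
    have h3 : gauge (fun x => incl Λ R (ψ x) * incl Λ R (ψ x)⁻¹) c' = c' := by
      ext g x; simp [gauge]
    rwa [h3] at h2

end TheoremS

section Coupling

variable {G H X Y : Type} [Group G] [Group H] [MeasurableSpace X] [MulAction G X]
  [MeasurableSpace Y] [MulAction H Y] {μ : Measure X} {ν : Measure Y}

/-- A pair of cocycles, realized by equivariant maps in both directions that are inverse to each
other up to translations. -/
structure Cpl (G H : Type) {X Y : Type} [Group G] [Group H] [MeasurableSpace X] [MulAction G X]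
    [MeasurableSpace Y] [MulAction H Y] (μ : Measure X) (ν : Measure Y) where
  c : G → X → H
  d : H → Y → G
  F : X → Y
  E : Y → X
  η : X → G
  θ : Y → H
  hG : PmpAction G X μ
  hH : PmpAction H Y ν
  hc : IsCocycle G X H μ c
  hd : IsCocycle H Y G ν d
  hF : Measure.QuasiMeasurePreserving F μ ν
  hE : Measure.QuasiMeasurePreserving E ν μ
  hη : Cm η
  hθ : Cm θ
  F_eq : ∀ g, ∀ᵐ x ∂μ, F (g • x) = c g x • F x
  E_eq : ∀ h, ∀ᵐ y ∂ν, E (h • y) = d h y • E y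
  EF : ∀ᵐ x ∂μ, E (F x) = η x • x
  FE : ∀ᵐ y ∂ν, F (E y) = θ y • y
  η_eq : ∀ g, ∀ᵐ x ∂μ, d (c g x) (F x) * η x = η (g • x) * g
  θ_eq : ∀ h, ∀ᵐ y ∂ν, c (d h y) (E y) * θ y = θ (h • y) * h

namespace Cpl

/-- The coupling with exchanged roles. -/
def swap (C : Cpl G H μ ν) : Cpl H G ν μ where
  c := C.d
  d := C.c
  F := C.E
  E := C.F
  η := C.θ
  θ := C.η
  hG := C.hH
  hH := C.hG
  hc := C.hd
  hd := C.hc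
  hF := C.hE
  hE := C.hF
  hη := C.hθ
  hθ := C.hη
  F_eq := C.E_eq
  E_eq := C.F_eq
  EF := C.FE
  FE := C.EF
  η_eq := C.θ_eq
  θ_eq := C.η_eq

theorem _root_.OEPaper.Cm.preimage_countable [Countable H] {φ : X → H} (hφ : Cm φ) {F : X → Y}
    (hF : Measurable F) (hH : ∀ h : H, Measurable fun y : Y => h • y) :
    Measurable fun x => φ x • F x := by
  intro N hN
  have : (fun x => φ x • F x) ⁻¹' N = ⋃ h, {x | φ x = h} ∩ (fun x => h • F x) ⁻¹' N := by
    ext x; simp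
  rw [this]
  exact .iUnion fun h => (hφ h).inter (((hH h).comp hF) hN)

theorem _root_.OEPaper.quasiMeasurePreserving_smul [Countable H] (hH : PmpAction H Y ν) {φ : X → H}
    (hφ : Cm φ) {F : X → Y} (hF : Measure.QuasiMeasurePreserving F μ ν) :
    Measure.QuasiMeasurePreserving (fun x => φ x • F x) μ ν := by
  refine ⟨hφ.preimage_countable hF.measurable fun h => (hH h).measurable, ?_⟩
  refine Measure.AbsolutelyContinuous.mk fun N hN h0 => ?_
  rw [Measure.map_apply (hφ.preimage_countable hF.measurable fun h => (hH h).measurable) hN]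
  have : (fun x => φ x • F x) ⁻¹' N ⊆ ⋃ h : H, F ⁻¹' ((h • ·) ⁻¹' N) := fun x hx =>
    Set.mem_iUnion.2 ⟨φ x, hx⟩
  refine measure_mono_null this (measure_iUnion_null fun h => ?_)
  exact hF.preimage_null ((hH h).quasiMeasurePreserving.preimage_null h0)

/-- Twisting the first cocycle of a coupling. -/
def gauge [Countable G] [Countable H] (C : Cpl G H μ ν) (φ : X → H) (hφ : Cm φ) :
    Cpl G H μ ν where
  c := OEPaper.gauge φ C.c
  d := C.d
  F x := φ x • C.F x
  E := C.E
  η x := C.d (φ x) (C.F x) * C.η x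
  θ y := φ (C.E y) * C.θ y
  hG := C.hG
  hH := C.hH
  hc := gauge_isCocycle C.hG hφ C.hc
  hd := C.hd
  hF := quasiMeasurePreserving_smul C.hH hφ C.hF
  hE := C.hE
  hη := by
    have : Cm fun x => C.d (φ x) (C.F x) := hφ.bind fun h => (C.hd.cm h).comp_meas C.hF.measurable
    exact this.comp₂ C.hη (· * ·)
  hθ := (hφ.comp_meas C.hE.measurable).comp₂ C.hθ (· * ·)
  F_eq g := by
    filter_upwards [C.F_eq g] with x hx
    simp only [OEPaper.gauge, hx, mul_smul, inv_smul_smul]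
  E_eq := C.E_eq
  EF := by
    filter_upwards [C.EF, C.hF.ae (ae_all_iff.2 C.E_eq)] with x h1 h2
    rw [h2, h1, mul_smul]
  FE := by
    filter_upwards [C.FE] with x hx
    rw [hx, mul_smul]
  η_eq g := by
    filter_upwards [C.F_eq g, C.η_eq g, C.hF.ae (ae_all_iff.2 fun h => ae_all_iff.2 (C.hd.2 h))]
      with x h1 h2 h3
    have h4 := h3 (OEPaper.gauge φ C.c g x) (φ x)
    rw [← mul_assoc, ← h4, OEPaper.gauge, inv_mul_cancel_right, h3, mul_assoc, h2, h1, mul_assoc]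
  θ_eq h := by
    filter_upwards [C.E_eq h, C.θ_eq h] with y h1 h2
    simp only [OEPaper.gauge]
    rw [h1, mul_assoc (φ _), mul_assoc, mul_assoc, inv_mul_cancel_left, h2, mul_assoc]

/-- A set of generators containing two non-commuting ones has no almost invariant random measures
on the target of the cocycle. -/
theorem hasReiter_id [Countable G] [Countable H] (C : Cpl G H μ ν) {A : Set G}
    (h : HasReiter μ C.c A (transl (MonoidHom.id H))) :
    HasReiter μ (fun g _ => g) A (transl (MonoidHom.id G)) := by
  refine h.push (j := fun x k => (C.d k⁻¹ (C.F x) * C.η x)⁻¹) C.hG (fun a _ => C.hc.cm a)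
    (fun k => ?_) fun a _ => ?_
  · exact ((C.hd.cm k⁻¹).comp_meas C.hF.measurable).comp₂ C.hη fun a b => (a * b)⁻¹
  · filter_upwards [C.F_eq a, C.η_eq a, C.hF.ae (ae_all_iff.2 fun h => ae_all_iff.2 (C.hd.2 h))]
      with x h1 h2 h3 k
    have h5 : C.d (C.c a x * k)⁻¹ (C.c a x • C.F x) = C.d k⁻¹ (C.F x) * (C.d (C.c a x) (C.F x))⁻¹ := by
      rw [eq_mul_inv_iff_mul_eq, ← h3, mul_inv_rev, inv_mul_cancel_right]
    rw [← eq_mul_inv_iff_mul_eq] at h2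
    simp only [transl, MonoidHom.comp_id, MulAction.toPermHom_apply,
      MulAction.toPerm_apply, smul_eq_mul, perm]
    rw [h1, h5, h2]
    group

/-- Almost invariant random measures for the second cocycle yield almost invariant random measures
for the group itself. -/
theorem hasReiter_pull [Countable G] [Countable H] {D : Type*} [Countable D]
    [IsProbabilityMeasure μ] (C : Cpl G H μ ν) {A : Set G} (hA : A.Finite) {B : Set H}
    (hAB : ∀ a ∈ A, ∀ᵐ x ∂μ, C.c a x ∈ Subgroup.closure B) {τ : G →* Equiv.Perm D}
    (h : HasReiter ν C.d B τ) : HasReiter μ (fun g _ => g) A τ := by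
  suffices h' : HasReiter μ (fun g x => C.d (C.c g x) (C.F x)) A τ by
    refine h'.push (j := fun x k => (τ (C.η x))⁻¹ k) C.hG (fun a _ => ?_) (fun k => ?_)
      fun a _ => ?_
    · exact (C.hc.cm a).bind fun h => (C.hd.cm h).comp_meas C.hF.measurable
    · exact C.hη.comp fun h => (τ h)⁻¹ k
    · filter_upwards [C.η_eq a] with x h1 k
      rw [← eq_mul_inv_iff_mul_eq] at h1
      rw [h1]
      simp only [← map_inv, ← Equiv.Perm.mul_apply, ← map_mul]
      congr 2; group
  choose ζ hζ using fun n : ℕ => h (2⁻¹ ^ n) (ENNReal.pow_pos (by simp) n)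
  have hm : ∀ n h, Measurable fun y => ∑' k, ad (ζ n (h • y) (τ (C.d h y) k)) (ζ n y k) :=
    fun n h => measurable_errInt (C.hH h).measurable (cm_perm (C.hd.cm h) τ) (hζ n).rm
  have h1 : ∀ h ∈ Subgroup.closure B, ∀ᵐ y ∂ν, Filter.Tendsto
      (fun n => ∑' k, ad (ζ n (h • y) (τ (C.d h y) k)) (ζ n y k)) Filter.atTop (nhds 0) := by
    intro h hh
    obtain ⟨N, hN⟩ := err_closure C.hH C.hd τ hh
    refine ae_tendsto_zero_of_summable (fun n => hm n h) (ne_top_of_le_ne_top ?_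
      (ENNReal.tsum_le_tsum fun n => hN _ _ (hζ n)))
    rw [ENNReal.tsum_mul_left, ENNReal.tsum_geometric, ENNReal.one_sub_inv_two, inv_inv]
    exact ENNReal.mul_ne_top (by simp) (by simp)
  have hrm : ∀ n, RM μ fun x => ζ n (C.F x) := fun n =>
    ⟨fun k => ((hζ n).rm.meas k).comp C.hF.measurable, C.hF.ae (hζ n).rm.sum⟩
  have hs : ∀ a k, Cm fun x => τ (C.d (C.c a x) (C.F x)) k := fun a k =>
    ((C.hc.cm a).bind fun h => (C.hd.cm h).comp_meas C.hF.measurable).comp fun g => τ g k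
  have h2 : ∀ a ∈ A, Filter.Tendsto
      (fun n => err μ (a • ·) (fun x => τ (C.d (C.c a x) (C.F x))) fun x => ζ n (C.F x))
      Filter.atTop (nhds 0) := by
    intro a ha
    have := tendsto_lintegral_of_dominated_convergence (μ := μ) (fun _ => 2) (f := fun _ => 0)
      (F := fun n x => ∑' k, ad (ζ n (C.F (a • x)) (τ (C.d (C.c a x) (C.F x)) k)) (ζ n (C.F x) k))
      (fun n => measurable_errInt (C.hG a).measurable (hs a) (hrm n)) (fun n => ?_) (by simp) ?_
    · simpa [err] using this
    · filter_upwards [(hrm n).sum, C.hG.ae (hrm n).sum a] with x h1 h2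
      calc _ ≤ ∑' k, (ζ n (C.F (a • x)) (τ (C.d (C.c a x) (C.F x)) k) + ζ n (C.F x) k) :=
            ENNReal.tsum_le_tsum fun k => ad_le_add _ _
        _ = 2 := by
            rw [ENNReal.tsum_add, h1, (τ _).tsum_eq (fun k => ζ n (C.F (a • x)) k), h2]; norm_num
    · have h3 : ∀ᵐ y ∂ν, ∀ h ∈ Subgroup.closure B, Filter.Tendsto
          (fun n => ∑' k, ad (ζ n (h • y) (τ (C.d h y) k)) (ζ n y k)) Filter.atTop (nhds 0) :=
        ae_all_iff.2 fun h => by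
          by_cases hh : h ∈ Subgroup.closure B
          · filter_upwards [h1 h hh] with y hy _ using hy
          · exact .of_forall fun y hy => absurd hy hh
      filter_upwards [C.hF.ae h3, hAB a ha, C.F_eq a] with x h3 h4 h5
      have := h3 _ h4
      rwa [← h5] at this
  intro δ hδ
  have h3 : ∀ᶠ n in Filter.atTop, ∀ a ∈ A,
      err μ (a • ·) (fun x => τ (C.d (C.c a x) (C.F x))) (fun x => ζ n (C.F x)) ≤ δ :=
    (Filter.eventually_all_finite hA).2 fun a ha => (h2 a ha).eventually_le_const hδ
  obtain ⟨n, hn⟩ := h3.exists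
  exact ⟨_, hrm n, hn⟩

end Cpl

end Coupling

section CocycleMem

variable {X : Type} [MeasurableSpace X] {μ : Measure X} {𝔾 : Type} [Group 𝔾] [MulAction 𝔾 X]
  {H : Type} [Group H]

/-- A cocycle that agrees with a homomorphism on a set agrees with it on the subgroup generated by
this set. -/
theorem IsCocycle.eq_of_closure (hG : PmpAction 𝔾 X μ) {c : 𝔾 → X → H}
    (hc : IsCocycle 𝔾 X H μ c) (Ψ : 𝔾 →* H) {B : Set 𝔾} (h : ∀ b ∈ B, ∀ᵐ x ∂μ, c b x = Ψ b)
    {g : 𝔾} (hg : g ∈ Subgroup.closure B) : ∀ᵐ x ∂μ, c g x = Ψ g := by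
  induction hg using Subgroup.closure_induction with
  | mem b hb => exact h b hb
  | one => simpa using hc.one
  | mul g g' _ _ ih ih' =>
    filter_upwards [hc.2 g g', hG.ae ih g', ih'] with x h1 h2 h3
    rw [h1, h2, h3, map_mul]
  | inv g _ ih =>
    filter_upwards [hG.ae (hc.inv g) g⁻¹, hG.ae ih g⁻¹] with x h1 h2
    rw [h2, smul_inv_smul] at h1
    rw [h1, map_inv]

/-- A cocycle with values in a subgroup on a set has values in this subgroup on the subgroup
generated by this set. -/
theorem IsCocycle.mem_of_closure (hG : PmpAction 𝔾 X μ) {c : 𝔾 → X → H}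
    (hc : IsCocycle 𝔾 X H μ c) {P : Subgroup H} {B : Set 𝔾} (h : ∀ b ∈ B, ∀ᵐ x ∂μ, c b x ∈ P)
    {g : 𝔾} (hg : g ∈ Subgroup.closure B) : ∀ᵐ x ∂μ, c g x ∈ P := by
  induction hg using Subgroup.closure_induction with
  | mem b hb => exact h b hb
  | one => filter_upwards [hc.one] with x hx; rw [hx]; exact one_mem P
  | mul g g' _ _ ih ih' =>
    filter_upwards [hc.2 g g', hG.ae ih g', ih'] with x h1 h2 h3
    rw [h1]; exact mul_mem h2 h3
  | inv g _ ih =>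
    filter_upwards [hG.ae (hc.inv g) g⁻¹, hG.ae ih g⁻¹] with x h1 h2
    rw [smul_inv_smul] at h1
    rw [h1]; exact inv_mem h2

end CocycleMem

section CouplingRAAG

variable {X Y V W : Type} [Finite V] [Finite W] {Γ : SimpleGraph V} {Λ : SimpleGraph W}
  [MeasurableSpace X] [MulAction (RAAG Γ) X] [MeasurableSpace Y] [MulAction (RAAG Λ) Y]
  {μ : Measure X} {ν : Measure Y} [IsProbabilityMeasure μ] [IsProbabilityMeasure ν]

theorem not_hasReiter_gen (hG : PmpAction (RAAG Γ) X μ) {A : Set (RAAG Γ)} {S : Set V} {u v : V}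
    (hu : u ∈ S) (hv : v ∈ S) (hne : u ≠ v) (huv : ¬ Γ.Adj u v) (huA : gen Γ u ∈ A)
    (hvA : gen Γ v ∈ A) : ¬ HasReiter μ (fun g _ => g) A (transl (proj Γ S)) := by
  intro h
  have huv' : ¬ (Γ.induce S).Adj ⟨u, hu⟩ ⟨v, hv⟩ := huv
  have hne' : (⟨u, hu⟩ : S) ≠ ⟨v, hv⟩ := fun h => hne (congrArg Subtype.val h)
  have : Countable (FreeGroup Bool) := FreeGroup.toWord_injective.countable
  have h1 := h.push (c' := fun g _ => g) (τ' := transl ((toFree huv').comp (proj Γ S))) hG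
    (fun a _ => Cm.const a) (j := fun _ => toFree huv') (fun k => Cm.const _) fun a _ =>
      .of_forall fun x k => by simp [transl]
  refine not_hasReiter_freeGroup hG (fun a _ => Cm.const a) ((toFree huv').comp (proj Γ S))
    (s := fun i => if i then gen Γ u else gen Γ v) (fun i => ?_) (fun i => ?_) h1
  · cases i <;> simp [huA, hvA]
  · cases i
    · simp [proj_gen_mem hv, toFree_gen_right huv' hne']
    · simp [proj_gen_mem hu, toFree_gen_left huv']

theorem Cpl.not_hasReiter (C : Cpl (RAAG Γ) (RAAG Λ) μ ν) {A : Set (RAAG Γ)} {u v : V}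
    (hne : u ≠ v) (huv : ¬ Γ.Adj u v) (huA : gen Γ u ∈ A) (hvA : gen Γ v ∈ A) :
    ¬ HasReiter μ C.c A (transl (MonoidHom.id (RAAG Λ))) := by
  intro h
  have h1 := (C.hasReiter_id h).push (c' := fun g _ => g) (τ' := transl (proj Γ Set.univ)) C.hG
    (fun a _ => Cm.const a) (j := fun _ => proj Γ Set.univ) (fun k => Cm.const _) fun a _ =>
      .of_forall fun x k => by simp [transl]
  exact not_hasReiter_gen C.hG (Set.mem_univ u) (Set.mem_univ v) hne huv huA hvA h1

theorem Cpl.subset_of_mem (C : Cpl (RAAG Γ) (RAAG Λ) μ ν) {S Q : Set V} {T : Set W}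
    (hc : ∀ p ∈ S, ∀ᵐ x ∂μ, C.c (gen Γ p) x ∈ standardSub Λ T)
    (hd : ∀ t ∈ T, ∀ᵐ y ∂ν, C.d (gen Λ t) y ∈ standardSub Γ Q) : S ⊆ Q := by
  intro p hp
  have h1 : ∀ᵐ y ∂ν, ∀ h ∈ standardSub Λ T, C.d h y ∈ standardSub Γ Q := ae_all_iff.2 fun h => by
    by_cases hh : h ∈ standardSub Λ T
    · filter_upwards [C.hd.mem_of_closure C.hH (Set.forall_mem_image.2 hd) hh] with y hy _ using hy
    · exact .of_forall fun y hy => absurd hy hh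
  have : Countable (RAAG Γ ⧸ standardSub Γ Q) := QuotientGroup.mk_surjective.countable
  have h2 := (C.hη.comp fun k => (QuotientGroup.mk k⁻¹ : RAAG Γ ⧸ standardSub Γ Q)).recurrent
    (C.hG (gen Γ p)) (fun k => gen Γ p • k) (by
      filter_upwards [hc p hp, C.hF.ae h1, C.η_eq (gen Γ p)] with x h1 h2 h3
      rw [eq_comm, coset_smul_eq_iff, inv_inv]
      rw [← eq_mul_inv_iff_mul_eq] at h3
      have h4 := inv_mem (h2 _ h1)
      rw [h3] at h4
      convert h4 using 1; group)
  obtain ⟨x, n, hn, hx⟩ := h2.exists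
  rw [smul_iterate_apply, coset_smul_eq_self_iff] at hx
  exact gen_pow_conj_mem hn hx

theorem Cpl.exists_pow_eq_one (C : Cpl (RAAG Γ) (RAAG Λ) μ ν) {b : RAAG Γ}
    (hb : ∀ᵐ x ∂μ, C.c b x = 1) : ∃ n, 0 < n ∧ b ^ n = 1 := by
  have h2 := C.hη.recurrent (C.hG b) (fun k => k * b⁻¹) (by
    filter_upwards [hb, C.hF.ae C.hd.one, C.η_eq b] with x h1 h2 h3
    rw [h1, h2, one_mul] at h3
    rw [h3, mul_inv_cancel_right])
  obtain ⟨x, n, hn, hx⟩ := h2.exists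
  rw [mul_right_iterate] at hx
  exact ⟨n, hn, by simpa using hx⟩

theorem Cpl.exists_gauge (C : Cpl (RAAG Γ) (RAAG Λ) μ ν)
    (he : ∀ v, Ergodic (gen Γ v • · : X → X) μ) {A B : Set V} (hB : B.Nonempty)
    (hAB : ∀ a ∈ A, ∀ b ∈ B, Γ.Adj a b ∨ a = b)
    (hA : ∃ u ∈ A, ∃ v ∈ A, u ≠ v ∧ ¬ Γ.Adj u v) :
    ∃ (φ : X → RAAG Λ) (_ : Cm φ) (R : Set W),
      Separated μ (OEPaper.gauge φ C.c) (gen Γ '' A) (gen Γ '' B) R ∧ (perp Λ R).Nonempty := by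
  obtain ⟨u, hu, v, hv, hne, huv⟩ := hA
  obtain ⟨φ, hφ, R, hR⟩ := exists_separated C.hG C.hc (A := gen Γ '' A) (B := gen Γ '' B)
    (Set.toFinite A |>.image _) ⟨_, u, hu, rfl⟩ (hB.image _) (Set.forall_mem_image.2 fun a _ => he a)
    (Set.forall_mem_image.2 fun a _ => he a)
    (Set.forall_mem_image.2 fun b hb => Set.forall_mem_image.2 fun a ha => by
      rcases hAB a ha b hb with h | rfl
      · exact gen_comm h.symm
      · exact Commute.refl _)
    (C.not_hasReiter hne huv ⟨u, hu, rfl⟩ ⟨v, hv, rfl⟩)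
  refine ⟨φ, hφ, R, hR, ?_⟩
  by_contra! h0
  obtain ⟨b, hb⟩ := hB
  obtain ⟨n, hn, h⟩ := (C.gauge φ hφ).exists_pow_eq_one (b := gen Γ b) (by
    filter_upwards [hR.triv _ ⟨b, hb, rfl⟩, hR.norm _ (.inr ⟨b, hb, rfl⟩)] with x h1 h2
    rw [h0, Set.union_empty] at h2
    exact (incl_proj_of_mem h2).symm.trans (by rw [h1, map_one]))
  exact gen_pow_ne_one hn h

theorem Cpl.exists_gauge_eq (C : Cpl (RAAG Γ) (RAAG Λ) μ ν)
    (he : ∀ v, Ergodic (gen Γ v • · : X → X) μ) {A B : Set V} (hB : B.Nonempty)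
    (hAB : ∀ a ∈ A, ∀ b ∈ B, Γ.Adj a b ∨ a = b)
    (hA : ∃ u ∈ A, ∃ v ∈ A, u ≠ v ∧ ¬ Γ.Adj u v) {S : Set W} (hS : IsMaxJoin Λ S)
    (hd : ∀ s ∈ S, ∀ᵐ y ∂ν, C.d (gen Λ s) y ∈ standardSub Γ (A ∪ B)) :
    ∃ (φ : X → RAAG Λ) (_ : Cm φ) (R : Set W),
      Separated μ (OEPaper.gauge φ C.c) (gen Γ '' A) (gen Γ '' B) R ∧ (perp Λ R).Nonempty ∧
        S = R ∪ perp Λ R := by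
  obtain ⟨φ, hφ, R, hR, h0⟩ := C.exists_gauge he hB hAB hA
  refine ⟨φ, hφ, R, hR, h0, hS.2 _ ?_ ?_⟩
  · obtain ⟨u, hu, -⟩ := hR.nonadj
    exact ⟨R, perp Λ R, ⟨u, hu⟩, h0, rfl, fun u hu v hv => (hv.2 u hu).symm⟩
  · refine (C.gauge φ hφ).swap.subset_of_mem hd fun t ht => hR.norm _ ?_
    exact ht.imp (Set.mem_image_of_mem _) (Set.mem_image_of_mem _)

theorem exists_isMaxJoin {S : Set W} (hS : IsJoin Λ S) : ∃ T, IsMaxJoin Λ T ∧ S ⊆ T := by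
  obtain ⟨T, hST, hT⟩ := (Set.toFinite {T : Set W | IsJoin Λ T}).exists_le_maximal hS
  exact ⟨T, ⟨hT.1, fun T' h h' => h'.antisymm (hT.2 h h')⟩, hST⟩

end CouplingRAAG

section MaxJoin

variable {X Y V W : Type} [Finite V] [Finite W] {Γ : SimpleGraph V} {Λ : SimpleGraph W}
  [MeasurableSpace X] [MulAction (RAAG Γ) X] [MeasurableSpace Y] [MulAction (RAAG Λ) Y]
  {μ : Measure X} {ν : Measure Y} [IsProbabilityMeasure μ] [IsProbabilityMeasure ν]

/-- No vertex of `S` is adjacent to all the others. -/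
def NoCone (Γ : SimpleGraph V) (S : Set V) : Prop := ∀ v ∈ S, ∃ w ∈ S, v ≠ w ∧ ¬ Γ.Adj v w

theorem NoCone.exists_nonadj {S₁ S₂ : Set V} (h : NoCone Γ (S₁ ∪ S₂)) (h₁ : S₁.Nonempty)
    (hadj : ∀ u ∈ S₁, ∀ v ∈ S₂, Γ.Adj u v) : ∃ u ∈ S₁, ∃ v ∈ S₁, u ≠ v ∧ ¬ Γ.Adj u v := by
  obtain ⟨u, hu⟩ := h₁
  obtain ⟨v, hv, hne, huv⟩ := h u (.inl hu)
  exact ⟨u, hu, v, hv.resolve_right fun hv => huv (hadj u hu v hv), hne, huv⟩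

/-- Adjacent sets one of which contains a given non-adjacent pair. -/
theorem exists_split {S₁ S₂ : Set V} (h₁ : S₁.Nonempty) (h₂ : S₂.Nonempty)
    (hadj : ∀ u ∈ S₁, ∀ v ∈ S₂, Γ.Adj u v) {u v : V} (hu : u ∈ S₁ ∪ S₂) (hv : v ∈ S₁ ∪ S₂)
    (huv : ¬ Γ.Adj u v) : ∃ A B : Set V, A ∪ B = S₁ ∪ S₂ ∧ B.Nonempty ∧
      (∀ a ∈ A, ∀ b ∈ B, Γ.Adj a b ∨ a = b) ∧ u ∈ A ∧ v ∈ A := by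
  rcases hu with hu | hu
  · exact ⟨S₁, S₂, rfl, h₂, fun a ha b hb => .inl (hadj a ha b hb), hu,
      hv.resolve_right fun hv => huv (hadj u hu v hv)⟩
  · exact ⟨S₂, S₁, Set.union_comm _ _, h₁, fun a ha b hb => .inl (hadj b hb a ha).symm, hu,
      hv.resolve_left fun hv => huv (hadj v hv u hu).symm⟩

theorem Separated.isJoin {𝔾 : Type} [Group 𝔾] [MulAction 𝔾 X] {c : 𝔾 → X → RAAG Λ} {A B : Set 𝔾}
    {R : Set W} (h : Separated μ c A B R) (h0 : (perp Λ R).Nonempty) :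
    IsJoin Λ (R ∪ perp Λ R) :=
  let ⟨u, hu, _⟩ := h.nonadj
  ⟨R, perp Λ R, ⟨u, hu⟩, h0, rfl, fun u hu _ hv => (hv.2 u hu).symm⟩

theorem Cpl.exists_isMaxJoin (C : Cpl (RAAG Γ) (RAAG Λ) μ ν)
    (heX : ∀ v, Ergodic (gen Γ v • · : X → X) μ) (heY : ∀ w, Ergodic (gen Λ w • · : Y → Y) ν)
    {S₁ S₂ : Set V} (h₁ : S₁.Nonempty) (h₂ : S₂.Nonempty) (hadj : ∀ u ∈ S₁, ∀ v ∈ S₂, Γ.Adj u v)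
    (hS : IsMaxJoin Γ (S₁ ∪ S₂)) (hcone : NoCone Γ (S₁ ∪ S₂)) :
    ∃ (φ : X → RAAG Λ) (_ : Cm φ) (φ' : Y → RAAG Γ) (_ : Cm φ') (R : Set W),
      Separated μ (OEPaper.gauge φ C.c) (gen Γ '' S₂) (gen Γ '' S₁) R ∧ (perp Λ R).Nonempty ∧
        IsMaxJoin Λ (R ∪ perp Λ R) ∧ NoCone Λ (R ∪ perp Λ R) ∧
        ∀ t ∈ R ∪ perp Λ R, ∀ᵐ y ∂ν, OEPaper.gauge φ' C.d (gen Λ t) y ∈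
          standardSub Γ (S₁ ∪ S₂) := by
  have hadj' : ∀ u ∈ S₂, ∀ v ∈ S₁, Γ.Adj u v := fun u hu v hv => (hadj v hv u hu).symm
  obtain ⟨φ, hφ, R, hR, h0⟩ := C.exists_gauge heX h₁ (fun a ha b hb => .inl (hadj' a ha b hb))
    ((Set.union_comm S₁ S₂ ▸ hcone).exists_nonadj h₂ hadj')
  have hcS : ∀ p ∈ S₁ ∪ S₂, ∀ᵐ x ∂μ, OEPaper.gauge φ C.c (gen Γ p) x ∈
      standardSub Λ (R ∪ perp Λ R) := fun p hp =>
    hR.norm _ (hp.symm.imp (Set.mem_image_of_mem _) (Set.mem_image_of_mem _))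
  obtain ⟨T, hT, hRT⟩ := OEPaper.exists_isMaxJoin (hR.isJoin h0)
  obtain ⟨T₁, T₂, hT₁, hT₂, rfl, hTadj⟩ := id hT.1
  obtain ⟨u, hu, v, hv, hne, huv⟩ := hR.nonadj
  obtain ⟨A, B, hAB, hB, hABadj, huA, hvA⟩ := exists_split hT₁ hT₂ hTadj (hRT (.inl hu))
    (hRT (.inl hv)) huv
  obtain ⟨φ', hφ', R', hR', h0', hSR'⟩ := (C.gauge φ hφ).swap.exists_gauge_eq heY hB hABadj
    ⟨u, huA, v, hvA, hne, huv⟩ hS fun s hs => by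
      filter_upwards [hcS s hs] with x hx
      rw [hAB]; exact standardSub_mono hRT hx
  have hdT : ∀ t ∈ T₁ ∪ T₂, ∀ᵐ y ∂ν, OEPaper.gauge φ' C.d (gen Λ t) y ∈
      standardSub Γ (S₁ ∪ S₂) := fun t ht => by
    rw [hSR']
    rw [← hAB] at ht
    exact hR'.norm _ (ht.imp (Set.mem_image_of_mem _) (Set.mem_image_of_mem _))
  have hTR : T₁ ∪ T₂ = R ∪ perp Λ R :=
    (((C.gauge φ hφ).swap.gauge φ' hφ').subset_of_mem hdT hcS).antisymm hRT
  rw [hTR] at hT hdT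
  refine ⟨φ, hφ, φ', hφ', R, hR, h0, hT, fun z hz => ?_, hdT⟩
  by_contra! hzT
  obtain ⟨φ₃, hφ₃, R₃, hR₃, ⟨w, hw⟩, hSR₃⟩ := (C.gauge φ hφ).swap.exists_gauge_eq heY
    (A := R ∪ perp Λ R) (B := {z}) ⟨z, rfl⟩
    (by
      rintro a ha b rfl
      by_cases h : b = a
      · exact .inr h.symm
      · exact .inl (hzT a ha h).symm)
    ⟨u, .inl hu, v, .inl hv, hne, huv⟩ hS fun s hs => by
      filter_upwards [hcS s hs] with x hx
      exact standardSub_mono Set.subset_union_left hx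
  obtain ⟨w', hw', hne', hww'⟩ := hcone w (hSR₃ ▸ .inr hw)
  have hw'2 : w' ∈ perp Γ R₃ := ((hSR₃ ▸ hw' : w' ∈ R₃ ∪ perp Γ R₃)).resolve_left
    fun h => hww' (hw.2 w' h)
  refine not_hasReiter_gen C.hG hw hw'2 hne' hww' (A := gen Γ '' (S₁ ∪ S₂))
    ⟨w, hSR₃ ▸ .inr hw, rfl⟩ ⟨w', hw', rfl⟩ ?_
  exact ((C.gauge φ hφ).swap.gauge φ₃ hφ₃).swap.hasReiter_pull (Set.toFinite (S₁ ∪ S₂) |>.image _)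
    (Set.forall_mem_image.2 hcS) hR₃.reiter

end MaxJoin

section MaxJoin

variable {X Y V W : Type} [Finite V] [Finite W] {Γ : SimpleGraph V} {Λ : SimpleGraph W}
  [MeasurableSpace X] [MulAction (RAAG Γ) X] [MeasurableSpace Y] [MulAction (RAAG Λ) Y]
  {μ : Measure X} {ν : Measure Y} [IsProbabilityMeasure μ] [IsProbabilityMeasure ν]

/-- The homomorphism induced by the constant values of a cocycle on generators. -/
theorem exists_hom_of_const {𝔾 H : Type} [Group 𝔾] [Group H] [MulAction 𝔾 X]
    (hG : PmpAction 𝔾 X μ) {c : 𝔾 → X → H} (hc : IsCocycle 𝔾 X H μ c) (f : W → 𝔾)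
    (hf : ∀ u v, Λ.Adj u v → Commute (f u) (f v)) (h : ∀ u, ∃ t, ∀ᵐ x ∂μ, c (f u) x = t) :
    ∃ Ψ : RAAG Λ →* H, ∀ u, ∀ᵐ x ∂μ, c (f u) x = Ψ (gen Λ u) := by
  choose t ht using h
  refine ⟨raagLift t fun u v huv => ?_, fun u => by simpa using ht u⟩
  obtain ⟨x, h1, h2, h3, h4, h5, h6⟩ := ((hc.2 (f u) (f v)).and <| (hc.2 (f v) (f u)).and <|
    (ht u).and <| (ht v).and <| (hG.ae (ht u) (f v)).and (hG.ae (ht v) (f u))).exists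
  rw [h5, h4, (hf u v huv).eq, h2, h6, h3] at h1
  exact h1.symm

theorem Cpl.false_of_reiter (C : Cpl (RAAG Γ) (RAAG Λ) μ ν) {S : Set V} {R : Set V} {K : Type}
    [Group K] [Countable K] (q : RAAG Λ →* K) (f : K →* RAAG (Γ.induce R))
    (hd : ∀ a ∈ S, ∀ᵐ x ∂μ, proj Γ R (C.d (C.c (gen Γ a) x) (C.F x)) = f (q (C.c (gen Γ a) x)))
    (h : HasReiter μ C.c (gen Γ '' S) (transl q)) {u v : V} (hu : u ∈ R) (hv : v ∈ R)
    (hne : u ≠ v) (huv : ¬ Γ.Adj u v) (huS : u ∈ S) (hvS : v ∈ S) : False := by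
  refine not_hasReiter_gen C.hG hu hv hne huv (A := gen Γ '' S) ⟨u, huS, rfl⟩ ⟨v, hvS, rfl⟩ ?_
  refine h.push (j := fun x k => (proj Γ R (C.η x))⁻¹ * f k) C.hG (fun a _ => C.hc.cm a)
    (fun k => C.hη.comp fun g => (proj Γ R g)⁻¹ * f k) (Set.forall_mem_image.2 fun a ha => ?_)
  filter_upwards [hd a ha, C.η_eq (gen Γ a)] with x h1 h2 k
  have h3 := congrArg (proj Γ R) h2
  rw [map_mul, map_mul, h1] at h3
  rw [← eq_mul_inv_iff_mul_eq] at h3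
  simp only [transl, perm, MonoidHom.coe_comp, Function.comp_apply, MulAction.toPermHom_apply,
    MulAction.toPerm_apply, smul_eq_mul, map_mul]
  rw [h3]
  group

theorem Cpl.exists_const (C : Cpl (RAAG Γ) (RAAG Λ) μ ν)
    (heX : ∀ v, Ergodic (gen Γ v • · : X → X) μ) (heY : ∀ w, Ergodic (gen Λ w • · : Y → Y) ν)
    {S₁ S₂ : Set V} (h₁ : S₁.Nonempty) (h₂ : S₂.Nonempty) (hadj : ∀ u ∈ S₁, ∀ v ∈ S₂, Γ.Adj u v)
    (hS : IsMaxJoin Γ (S₁ ∪ S₂)) (hcone : NoCone Γ (S₁ ∪ S₂)) {R : Set W}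
    (hR : Separated μ C.c (gen Γ '' S₂) (gen Γ '' S₁) R)
    (hcone' : NoCone Λ (R ∪ perp Λ R))
    (hd : ∀ t ∈ R ∪ perp Λ R, ∀ᵐ y ∂ν, C.d (gen Λ t) y ∈ standardSub Γ (S₁ ∪ S₂)) :
    ∃ φ : X → RAAG Λ, Cm φ ∧ ∃ v s, ∀ᵐ x ∂μ, OEPaper.gauge φ C.c (gen Γ v) x = s := by
  obtain ⟨u, hu, v, hv, hne, huv⟩ := hcone.exists_nonadj h₁ hadj
  have hRP : ∀ u ∈ R, ∀ v ∈ perp Λ R, Λ.Adj u v := fun u hu v hv => (hv.2 u hu).symm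
  have hdec : ∀ p ∈ S₁ ∪ S₂, ∀ᵐ x ∂μ, C.c (gen Γ p) x = incl Λ R (proj Λ R (C.c (gen Γ p) x)) *
      incl Λ (perp Λ R) (proj Λ (perp Λ R) (C.c (gen Γ p) x)) := fun p hp => by
    filter_upwards [hR.norm _ (hp.symm.imp (Set.mem_image_of_mem _) (Set.mem_image_of_mem _))]
      with x hx
    exact join_decomp hRP hx
  have hdec₁ : ∀ p ∈ S₁, ∀ᵐ x ∂μ, C.c (gen Γ p) x =
      incl Λ (perp Λ R) (proj Λ (perp Λ R) (C.c (gen Γ p) x)) := fun p hp => by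
    filter_upwards [hdec p (.inl hp), hR.triv _ ⟨p, hp, rfl⟩] with x h1 h2
    rwa [h2, map_one, one_mul] at h1
  have hcP := C.hc.map (proj Λ (perp Λ R))
  obtain ⟨φ, hφ, Q, hQ⟩ := exists_separated C.hG hcP (A := gen Γ '' S₁) (B := gen Γ '' S₂)
    (Set.toFinite S₁ |>.image _) (h₁.image _) (h₂.image _)
    (Set.forall_mem_image.2 fun a _ => heX a) (Set.forall_mem_image.2 fun a _ => heX a)
    (Set.forall_mem_image.2 fun b hb => Set.forall_mem_image.2 fun a ha =>
      gen_comm (hadj a ha b hb).symm) fun h => by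
      refine C.not_hasReiter hne huv (A := gen Γ '' S₁) ⟨u, hu, rfl⟩ ⟨v, hv, rfl⟩ ?_
      refine h.push (j := fun _ => incl Λ (perp Λ R)) C.hG (fun a _ => hcP.cm a)
        (fun k => Cm.const _) (Set.forall_mem_image.2 fun a ha => ?_)
      filter_upwards [hdec₁ a ha] with x hx k
      simp [transl, ← hx]
  set Z := perp (Λ.induce (perp Λ R)) Q with hZ
  have hχ : Cm fun x => incl Λ (perp Λ R) (φ x) := hφ.comp _
  set C' := C.gauge _ hχ with hC'
  have hC'c : C'.c = OEPaper.gauge (fun x => incl Λ (perp Λ R) (φ x)) C.c := rfl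
  have hproj : ∀ g x, proj Λ (perp Λ R) (C'.c g x) =
      OEPaper.gauge φ (fun g x => proj Λ (perp Λ R) (C.c g x)) g x := fun g x => by
    simp [hC'c, OEPaper.gauge]
  have hprojR : ∀ g x, proj Λ R (C'.c g x) = proj Λ R (C.c g x) := fun g x => by
    simp only [hC'c, OEPaper.gauge, map_mul, map_inv,
      proj_eq_one (disjoint_perp R) (incl_mem (φ _)), one_mul, inv_one, mul_one]
  have hdec' : ∀ p ∈ S₁ ∪ S₂, ∀ᵐ x ∂μ, C'.c (gen Γ p) x = incl Λ R (proj Λ R (C.c (gen Γ p) x)) *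
      incl Λ (perp Λ R) (proj Λ (perp Λ R) (C'.c (gen Γ p) x)) := fun p hp => by
    filter_upwards [hR.norm _ (hp.symm.imp (Set.mem_image_of_mem _) (Set.mem_image_of_mem _))]
      with x hx
    have : C'.c (gen Γ p) x ∈ standardSub Λ (R ∪ perp Λ R) := by
      have h1 : ∀ k, incl Λ (perp Λ R) k ∈ standardSub Λ (R ∪ perp Λ R) := fun k =>
        standardSub_mono Set.subset_union_right (incl_mem k)
      exact mul_mem (mul_mem (h1 _) hx) (inv_mem (h1 _))
    rw [← hprojR]
    exact join_decomp hRP this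
  rcases Z.eq_empty_or_nonempty with h0 | h0
  · obtain ⟨p, hp⟩ := h₁
    obtain ⟨t, ht⟩ := hQ.const _ ⟨p, hp, rfl⟩
    refine ⟨_, hχ, p, incl Λ (perp Λ R) (incl _ Q t), ?_⟩
    filter_upwards [hdec' p (.inl hp), hR.triv _ ⟨p, hp, rfl⟩, ht, hQ.norm _ (.inl ⟨p, hp, rfl⟩)]
      with x h1 h2 h3 h4
    rw [← hZ, h0, Set.union_empty] at h4
    rw [h2, map_one, one_mul, hproj, ← incl_proj_of_mem h4, h3] at h1
    exact h1
  exfalso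
  have hcS : ∀ p ∈ S₁ ∪ S₂, ∀ᵐ x ∂μ, C'.c (gen Γ p) x ∈
      standardSub Λ (Subtype.val '' Z ∪ (R ∪ Subtype.val '' Q)) := fun p hp => by
    filter_upwards [hdec' p hp,
      hQ.norm _ (hp.imp (Set.mem_image_of_mem _) (Set.mem_image_of_mem _))] with x h1 h2
    rw [h1]
    refine mul_mem (standardSub_mono ?_ (incl_mem _)) ?_
    · exact fun w hw => .inr (.inl hw)
    · have h3 : incl Λ (perp Λ R) (proj Λ (perp Λ R) (C'.c (gen Γ p) x)) ∈
          (standardSub (Λ.induce (perp Λ R)) (Q ∪ Z)).map (incl Λ (perp Λ R)) :=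
        ⟨_, by rw [hproj]; exact h2, rfl⟩
      rw [map_incl_standardSub, Set.image_union] at h3
      exact standardSub_mono (Set.union_subset (fun w hw => .inr (.inr hw)) fun w hw => .inl hw) h3
  have hTsub := C'.swap.subset_of_mem hd hcS
  have hZadj : ∀ z ∈ Subtype.val '' Z, ∀ b ∈ R ∪ Subtype.val '' Q, Λ.Adj z b := by
    rintro _ ⟨z, hz, rfl⟩ b (hb | ⟨b, hb, rfl⟩)
    · exact z.2.2 b hb
    · exact hz.2 b hb
  obtain ⟨z, hz⟩ := h0
  obtain ⟨z', hz', hzne, hzz'⟩ := hcone' z (.inr z.2)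
  have hz'Z : z' ∈ Subtype.val '' Z := (hTsub hz').resolve_right
    fun h => hzz' (hZadj z ⟨z, hz, rfl⟩ z' h)
  obtain ⟨r, hr, -⟩ := hR.nonadj
  obtain ⟨φ', hφ', R', hR', -, hSR'⟩ := C'.swap.exists_gauge_eq heY ⟨r, .inl hr⟩
    (fun a ha b hb => .inl (hZadj a ha b hb)) ⟨z, ⟨z, hz, rfl⟩, z', hz'Z, hzne, hzz'⟩ hS hcS
  set C₂ := (C'.swap.gauge φ' hφ').swap with hC₂
  have hdP := C₂.hd.map (proj Γ R')
  obtain ⟨f, hf⟩ := exists_hom_of_const (Λ := (Λ.induce (perp Λ R)).induce Z) C.hH hdP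
    (fun z => gen Λ z) (fun z z' h => gen_comm h) fun z => hR'.const _ ⟨z, ⟨z, z.2, rfl⟩, rfl⟩
  have hfq : ∀ h ∈ standardSub Λ (Subtype.val '' Z ∪ (R ∪ Subtype.val '' Q)), ∀ᵐ y ∂ν,
      proj Γ R' (C₂.d h y) = f (proj _ Z (proj Λ (perp Λ R) h)) := fun h hh =>
    hdP.eq_of_closure C.hH (f.comp ((proj _ Z).comp (proj Λ (perp Λ R))))
      (Set.forall_mem_image.2 (by
        rintro w (⟨w, hw, rfl⟩ | hw)
        · filter_upwards [hf ⟨w, hw⟩] with y hy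
          rw [hy, MonoidHom.comp_apply, MonoidHom.comp_apply, proj_gen_mem w.2, proj_gen_mem hw]
        · filter_upwards [hR'.triv _ ⟨w, hw, rfl⟩] with y hy
          refine hy.trans ?_
          rcases hw with hw | ⟨w, hw, rfl⟩
          · rw [MonoidHom.comp_apply, MonoidHom.comp_apply,
              proj_gen_notMem (Set.disjoint_left.1 (disjoint_perp R) hw), map_one, map_one]
          · rw [MonoidHom.comp_apply, MonoidHom.comp_apply, proj_gen_mem w.2,
              proj_gen_notMem (Set.disjoint_left.1 (disjoint_perp Q) hw), map_one])) hh
  have hfq' : ∀ p ∈ S₁ ∪ S₂, ∀ᵐ x ∂μ, proj Γ R' (C₂.d (C₂.c (gen Γ p) x) (C₂.F x)) =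
      f (((proj _ Z).comp (proj Λ (perp Λ R))) (C₂.c (gen Γ p) x)) := fun p hp => by
    have h1 : ∀ᵐ y ∂ν, ∀ h ∈ standardSub Λ (Subtype.val '' Z ∪ (R ∪ Subtype.val '' Q)),
        proj Γ R' (C₂.d h y) = f (proj _ Z (proj Λ (perp Λ R) h)) := ae_all_iff.2 fun h => by
      by_cases hh : h ∈ standardSub Λ (Subtype.val '' Z ∪ (R ∪ Subtype.val '' Q))
      · filter_upwards [hfq h hh] with y hy _ using hy
      · exact .of_forall fun y hy => absurd hy hh
    filter_upwards [C₂.hF.ae h1, hcS p hp] with x h1 h2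
    exact h1 _ h2
  have hreit₁ : HasReiter μ C₂.c (gen Γ '' S₁) (transl ((proj _ Z).comp (proj Λ (perp Λ R)))) :=
    hQ.reiter.push (j := fun _ k => k) C.hG (fun a _ => (gauge_isCocycle C.hG hφ hcP).cm a)
      (fun k => Cm.const _) fun a _ => .of_forall fun x k => by
        change proj _ Z _ * k = proj _ Z (proj Λ (perp Λ R) (C'.c a x)) * k
        rw [hproj]
  have hreit₂ : HasReiter μ C₂.c (gen Γ '' S₂) (transl ((proj _ Z).comp (proj Λ (perp Λ R)))) :=
    (hR.reiter.gauge C.hG (fun a _ => C.hc.cm a) hχ).push (j := fun _ k => proj _ Z k) C.hG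
      (fun a _ => C'.hc.cm a) (fun k => Cm.const _) fun a _ => .of_forall fun x k => by
        exact map_mul (proj _ Z) (proj Λ (perp Λ R) (C'.c a x)) k
  obtain ⟨u', hu', v', hv', hne', huv'⟩ := hR'.nonadj
  have hu'S : u' ∈ S₁ ∪ S₂ := hSR' ▸ .inl hu'
  have hv'S : v' ∈ S₁ ∪ S₂ := hSR' ▸ .inl hv'
  rcases hu'S with hu'S | hu'S
  · exact C₂.false_of_reiter _ f (fun a ha => hfq' a (.inl ha)) hreit₁ hu' hv' hne' huv' hu'S
      (hv'S.resolve_right fun h => huv' (hadj _ hu'S _ h))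
  · exact C₂.false_of_reiter _ f (fun a ha => hfq' a (.inr ha)) hreit₂ hu' hv' hne' huv' hu'S
      (hv'S.resolve_left fun h => huv' (hadj _ h _ hu'S).symm)

theorem Cpl.exists_const_of_isMaxJoin (C : Cpl (RAAG Γ) (RAAG Λ) μ ν)
    (heX : ∀ v, Ergodic (gen Γ v • · : X → X) μ) (heY : ∀ w, Ergodic (gen Λ w • · : Y → Y) ν)
    {S : Set V} (hS : IsMaxJoin Γ S) (hcone : NoCone Γ S) :
    (∃ T, IsMaxJoin Λ T ∧ NoCone Λ T) ∧
      ∃ φ : X → RAAG Λ, Cm φ ∧ ∃ v s, ∀ᵐ x ∂μ, OEPaper.gauge φ C.c (gen Γ v) x = s := by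
  obtain ⟨S₁, S₂, h₁, h₂, rfl, hadj⟩ := id hS.1
  obtain ⟨φ, hφ, φ', hφ', R, hR, -, hT, hT', hd⟩ := C.exists_isMaxJoin heX heY h₁ h₂ hadj hS hcone
  obtain ⟨ψ, hψ, v, s, h⟩ := ((C.gauge φ hφ).swap.gauge φ' hφ').swap.exists_const heX heY h₁ h₂ hadj
    hS hcone hR hT' hd
  refine ⟨⟨_, hT, hT'⟩, _, hψ.comp₂ hφ (· * ·), v, s, ?_⟩
  rw [← gauge_gauge]
  exact h

end MaxJoin

section Rigid

variable {X Y V W : Type} {Γ : SimpleGraph V} {Λ : SimpleGraph W}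
  [MeasurableSpace X] [MulAction (RAAG Γ) X] [MeasurableSpace Y] [MulAction (RAAG Λ) Y]
  {μ : Measure X} {ν : Measure Y} [IsProbabilityMeasure μ] [IsProbabilityMeasure ν]

theorem noCone_of_subCenter {S : Set V} {g : RAAG Γ}
    (h : ∀ x ∈ subCenter (conjSub g (standardSub Γ S)), x = 1) : NoCone Γ S := by
  intro v hv
  by_contra! hc
  have h1 : ∀ y ∈ standardSub Γ S, Commute (gen Γ v) y := by
    intro y hy
    have : standardSub Γ S ≤ Subgroup.centralizer {gen Γ v} :=
      standardSub_le fun w hw => by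
        rw [Subgroup.mem_centralizer_singleton_iff]
        by_cases hvw : v = w
        · rw [hvw]
        · exact (gen_comm (hc w hw hvw)).symm
    exact (Subgroup.mem_centralizer_singleton_iff.1 (this hy)).symm
  have h2 := h (g * gen Γ v * g⁻¹) ⟨⟨gen Γ v, gen_mem_standardSub hv, rfl⟩, ?_⟩
  · have h3 : gen Γ v = 1 := by
      rwa [mul_inv_eq_one, mul_eq_left] at h2
    exact gen_pow_ne_one (Γ := Γ) (v := v) one_pos (by rw [pow_one]; exact h3)
  · rintro _ ⟨y, hy, rfl⟩
    have := (h1 y hy).eq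
    simp only [MulEquiv.coe_toMonoidHom, MulAut.conj_apply]
    calc _ = g * (gen Γ v * y) * g⁻¹ := by group
      _ = g * (y * gen Γ v) * g⁻¹ := by rw [this]
      _ = _ := by group

/-- Group isomorphisms preserve the existence of a maximal join without cone vertex. -/
theorem exists_noCone_of_equiv [Finite V] [Finite W] (e : RAAG Γ ≃* RAAG Λ) {S : Set V}
    (hS : IsMaxJoin Γ S) (hcone : NoCone Γ S) : ∃ T, IsMaxJoin Λ T ∧ NoCone Λ T := by
  have hpmp : ∀ (G : Type) [Group G], PmpAction G Unit (Measure.dirac ()) := fun G _ g =>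
    MeasurePreserving.id _
  have herg : ∀ (G : Type) [Group G] (g : G), Ergodic (g • · : Unit → Unit) (Measure.dirac ()) :=
    fun G _ g => ⟨hpmp G g, ⟨fun _ _ _ => .of_subsingleton_left⟩⟩
  let C : Cpl (RAAG Γ) (RAAG Λ) (Measure.dirac ()) (Measure.dirac ()) :=
    { c := fun g _ => e g
      d := fun h _ => e.symm h
      F := id
      E := id
      η := fun _ => 1
      θ := fun _ => 1
      hG := hpmp _
      hH := hpmp _
      hc := ⟨fun _ _ => .of_discrete, fun _ _ => .of_forall fun _ => map_mul _ _ _⟩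
      hd := ⟨fun _ _ => .of_discrete, fun _ _ => .of_forall fun _ => map_mul _ _ _⟩
      hF := .id _
      hE := .id _
      hη := .const _
      hθ := .const _
      F_eq := fun _ => .of_forall fun _ => rfl
      E_eq := fun _ => .of_forall fun _ => rfl
      EF := .of_forall fun _ => rfl
      FE := .of_forall fun _ => rfl
      η_eq := fun _ => .of_forall fun _ => by simp
      θ_eq := fun _ => .of_forall fun _ => by simp }
  exact (C.exists_const_of_isMaxJoin (fun _ => herg _ _) (fun _ => herg _ _) hS hcone).1

/-- Constancy of a cocycle on one vertex propagates along a connected graph. -/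
theorem exists_hom_of_preconnected [Finite V] [Finite W] (hG : PmpAction (RAAG Γ) X μ)
    {c : RAAG Γ → X → RAAG Λ} (hc : IsCocycle (RAAG Γ) X (RAAG Λ) μ c)
    (he : ∀ v, Ergodic (gen Γ v • · : X → X) μ) (hΓ : Γ.Preconnected) {v : V} {s : RAAG Λ}
    (hs : ∀ᵐ x ∂μ, c (gen Γ v) x = s) : ∃ Ψ : RAAG Γ →* RAAG Λ, ∀ g, ∀ᵐ x ∂μ, c g x = Ψ g := by
  have h1 : ∀ u, ∃ t, ∀ᵐ x ∂μ, c (gen Γ u) x = t := by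
    intro u
    obtain ⟨p⟩ := hΓ v u
    induction p generalizing s with
    | nil => exact ⟨s, hs⟩
    | cons h p ih =>
      obtain ⟨t, -, ht⟩ := const_of_commute hG hc (gen_comm h) (he _) hs
      exact ih ht
  obtain ⟨Ψ, hΨ⟩ := exists_hom_of_const hG hc (gen Γ) (fun u v h => gen_comm h) h1
  refine ⟨Ψ, fun g => IsCocycle.eq_of_closure (B := gen Γ '' Set.univ) hG hc _ ?_ ?_⟩
  · rintro _ ⟨u, -, rfl⟩
    exact hΨ u
  · show g ∈ standardSub Γ Set.univ
    rw [standardSub_univ]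
    trivial

/-- A function intertwining an endomorphism with the identity is constant. -/
theorem exists_conj_of_intertwine [Finite V] (hG : PmpAction (RAAG Γ) X μ) {v : V} (hv : Ergodic (gen Γ v • · : X → X) μ)
    {η : X → RAAG Γ} (hη : Cm η) (σ : RAAG Γ →* RAAG Γ)
    (h : ∀ g, ∀ᵐ x ∂μ, σ g * η x = η (g • x) * g) :
    ∃ k, (∀ᵐ x ∂μ, η x = k) ∧ ∀ g, σ g = k * g * k⁻¹ := by
  have h1 : ∀ g, ∀ᵐ x ∂μ, σ g = η x * g * (η x)⁻¹ := by
    intro g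
    have h2 := hη.recurrent (hG g) (fun k => σ g * k * g⁻¹) (by
      filter_upwards [h g] with x hx
      rw [hx, mul_inv_cancel_right])
    have h3 : ∀ n : ℕ, ∀ k, (fun k => σ g * k * g⁻¹)^[n] k = σ g ^ n * k * (g ^ n)⁻¹ :=
      fun n k => by
        induction n with
        | zero => simp
        | succ n ih => rw [Function.iterate_succ_apply', ih, pow_succ' (σ g), pow_succ']; group
    filter_upwards [h2] with x ⟨n, hn, hx⟩
    rw [h3] at hx
    refine raag_root hn ?_
    rw [conj_pow, eq_mul_inv_iff_mul_eq]
    exact mul_inv_eq_iff_eq_mul.1 hx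
  obtain ⟨k, hk⟩ := hη.ergodic_const hv (by
    filter_upwards [h (gen Γ v), h1 (gen Γ v)] with x h2 h3
    rw [h3, inv_mul_cancel_right] at h2
    exact (mul_right_cancel h2).symm)
  refine ⟨k, hk, fun g => ?_⟩
  obtain ⟨x, h2, h3⟩ := (hk.and (h1 g)).exists
  rw [h3, h2]

end Rigid

section Rigidity

variable {X Y V W : Type} {Γ : SimpleGraph V} {Λ : SimpleGraph W}
  [MeasurableSpace X] [MulAction (RAAG Γ) X] [MeasurableSpace Y] [MulAction (RAAG Λ) Y]
  {μ : Measure X} {ν : Measure Y} [IsProbabilityMeasure μ] [IsProbabilityMeasure ν]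

theorem Cpl.measIso_of_hom [Finite V] [Finite W] [MeasurableEq Y]
    (C : Cpl (RAAG Γ) (RAAG Λ) μ ν) (α : RAAG Γ ≃* RAAG Λ)
    (hα : ∀ g, ∀ᵐ x ∂μ, C.c g x = α g) {k : RAAG Γ} (hk : ∀ᵐ x ∂μ, C.η x = k) {h : RAAG Λ}
    (hh : Ergodic (h • · : Y → Y) ν) : MeasIso μ ν C.F := by
  have h1 : MeasurePreserving (h • · : Y → Y) (μ.map C.F) (μ.map C.F) := by
    refine ⟨hh.measurable, ?_⟩
    rw [Measure.map_map hh.measurable C.hF.measurable]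
    have h2 : (h • ·) ∘ C.F =ᵐ[μ] C.F ∘ (α.symm h • ·) := by
      filter_upwards [C.F_eq (α.symm h), hα (α.symm h)] with x h2 h3
      simp only [Function.comp_apply]
      rw [h2, h3, α.apply_symm_apply]
    rw [Measure.map_congr h2, ← Measure.map_map C.hF.measurable (C.hG _).measurable, (C.hG _).map_eq]
  have : IsProbabilityMeasure (μ.map C.F) :=
    Measure.isProbabilityMeasure_map C.hF.measurable.aemeasurable
  have h2 : MeasurePreserving C.F μ ν :=
    ⟨C.hF.measurable, hh.eq_of_absolutelyContinuous h1 C.hF.absolutelyContinuous⟩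
  have h3 : Measurable fun y => k⁻¹ • C.E y := (C.hG k⁻¹).measurable.comp C.hE.measurable
  have h4 : ∀ᵐ x ∂μ, k⁻¹ • C.E (C.F x) = x := by
    filter_upwards [C.EF, hk] with x h5 h6
    rw [h5, h6, inv_smul_smul]
  refine ⟨C.hF.measurable, h2, _, h3, h4, ?_⟩
  suffices h5 : ∀ᵐ y ∂(μ.map C.F), C.F (k⁻¹ • C.E y) = y by rwa [h2.map_eq] at h5
  have h5 : MeasurableSet {y | C.F (k⁻¹ • C.E y) = y} :=
    measurableSet_eq_fun (C.hF.measurable.comp h3) measurable_id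
  rw [ae_map_iff h2.aemeasurable h5]
  filter_upwards [h4] with x hx
  exact congrArg C.F hx

/-- Cocycle rigidity for couplings of right-angled Artin groups all of whose generators act
ergodically. -/
theorem Cpl.rigid [Finite V] [Finite W] [MeasurableEq Y] (C : Cpl (RAAG Γ) (RAAG Λ) μ ν)
    (heX : ∀ v, Ergodic (gen Γ v • · : X → X) μ) (heY : ∀ w, Ergodic (gen Λ w • · : Y → Y) ν)
    (hΓ : Γ.Preconnected) (hΛ : Λ.Preconnected) {S : Set V} (hS : IsMaxJoin Γ S)
    (hcone : NoCone Γ S) :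
    ∃ (α : RAAG Γ ≃* RAAG Λ) (φ : X → RAAG Λ), Cm φ ∧
      (∀ g, ∀ᵐ x ∂μ, OEPaper.gauge φ C.c g x = α g) ∧ MeasIso μ ν (fun x => φ x • C.F x) := by
  obtain ⟨⟨T, hT, hT'⟩, φ, hφ, v, s, hs⟩ := C.exists_const_of_isMaxJoin heX heY hS hcone
  obtain ⟨α, hα⟩ := exists_hom_of_preconnected C.hG (C.gauge φ hφ).hc heX hΓ hs
  obtain ⟨-, ψ, hψ, w, t, ht⟩ := (C.gauge φ hφ).swap.exists_const_of_isMaxJoin heY heX hT hT'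
  obtain ⟨β, hβ⟩ := exists_hom_of_preconnected C.hH ((C.gauge φ hφ).swap.gauge ψ hψ).hc heY hΛ ht
  set C' := ((C.gauge φ hφ).swap.gauge ψ hψ).swap with hC'
  have hα' : ∀ g, ∀ᵐ x ∂μ, C'.c g x = α g := hα
  have hβ' : ∀ h, ∀ᵐ y ∂ν, C'.d h y = β h := hβ
  obtain ⟨k, hk, hk'⟩ := exists_conj_of_intertwine C.hG (heX v) C'.hη (β.comp α) fun g => by
    filter_upwards [C'.η_eq g, hα' g, C'.hF.ae (hβ' (α g))] with x h1 h2 h3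
    rw [h2, h3] at h1
    exact h1
  obtain ⟨l, -, hl⟩ := exists_conj_of_intertwine C.hH (heY w) C'.hθ (α.comp β) fun h => by
    filter_upwards [C'.θ_eq h, hβ' h, C'.hE.ae (hα' (β h))] with x h1 h2 h3
    rw [h2, h3] at h1
    exact h1
  have hbij : Function.Bijective α := by
    refine ⟨fun a b hab => ?_, fun h => ⟨β (l⁻¹ * h * l), ?_⟩⟩
    · have h1 : β.comp α a = β.comp α b := congrArg β hab
      rw [hk', hk'] at h1
      exact mul_left_cancel (mul_right_cancel h1)
    · have h1 := hl (l⁻¹ * h * l)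
      rw [MonoidHom.comp_apply] at h1
      rw [h1]; group
  exact ⟨MulEquiv.ofBijective α hbij, φ, hφ, hα,
    C'.measIso_of_hom (MulEquiv.ofBijective α hbij) hα' hk (heY w)⟩

end Rigidity

section Selection

variable {G H X Y : Type} [Group G] [Group H] [MeasurableSpace X] [MulAction G X]
  [MeasurableSpace Y] [MulAction H Y] {μ : Measure X} {ν : Measure Y}

/-- Measurable selection from countably many measurable sets. -/
theorem exists_cm_select {D : Type} [Countable D] [Nonempty D] {A : D → Set X}
    (hA : ∀ d, MeasurableSet (A d)) (h : ∀ᵐ x ∂μ, ∃ d, x ∈ A d) :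
    ∃ φ : X → D, Cm φ ∧ ∀ᵐ x ∂μ, x ∈ A (φ x) := by
  classical
  obtain ⟨u, hu⟩ := exists_surjective_nat D
  let φ : X → D := fun x => if hx : ∃ n, x ∈ A (u n) then u (Nat.find hx) else u 0
  have hm : ∀ n, MeasurableSet {x | ∃ hx : ∃ n, x ∈ A (u n), Nat.find hx = n} := by
    intro n
    have : {x | ∃ hx : ∃ n, x ∈ A (u n), Nat.find hx = n} =
        A (u n) ∩ ⋂ m, ⋂ (_ : m < n), (A (u m))ᶜ := by
      ext x
      simp only [Set.mem_ofPred_eq, Set.mem_inter_iff, Set.mem_iInter, Set.mem_compl_iff]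
      constructor
      · rintro ⟨hx, rfl⟩
        exact ⟨Nat.find_spec hx, fun m hm => Nat.find_min hx hm⟩
      · rintro ⟨h1, h2⟩
        exact ⟨⟨n, h1⟩, (Nat.find_eq_iff _).2 ⟨h1, h2⟩⟩
    rw [this]
    exact (hA _).inter (.iInter fun m => .iInter fun _ => (hA _).compl)
  refine ⟨φ, fun d => ?_, ?_⟩
  · have : {x | φ x = d} =
        (⋃ n, ⋃ (_ : u n = d), {x | ∃ hx : ∃ n, x ∈ A (u n), Nat.find hx = n}) ∪
          {x | (∀ n, x ∉ A (u n)) ∧ u 0 = d} := by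
      ext x
      by_cases hx : ∃ n, x ∈ A (u n)
      · have hx' : ¬ ∀ n, x ∉ A (u n) := by push Not; exact hx
        simp [φ, hx, hx']
      · have hx' : ∀ n, x ∉ A (u n) := by push Not at hx; exact hx
        simp [φ, hx']
    rw [this]
    refine .union (.iUnion fun n => .iUnion fun _ => hm n) ?_
    have : {x | (∀ n, x ∉ A (u n)) ∧ u 0 = d} = (⋂ n, (A (u n))ᶜ) ∩ {_x | u 0 = d} := by
      ext x; simp
    rw [this]
    exact (MeasurableSet.iInter fun n => (hA _).compl).inter (.const _)
  · filter_upwards [h] with x ⟨d, hd⟩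
    obtain ⟨n, rfl⟩ := hu d
    have hx : ∃ n, x ∈ A (u n) := ⟨n, hd⟩
    simp only [φ, hx, dif_pos]
    exact Nat.find_spec hx

theorem FreeAction.ae_injective [Countable H] (hfree : FreeAction H Y ν) :
    ∀ᵐ y ∂ν, ∀ h h' : H, h • y = h' • y → h = h' := by
  have : ∀ᵐ y ∂ν, ∀ h : H, h ≠ 1 → h • y ≠ y := by
    refine ae_all_iff.2 fun h => ?_
    by_cases hh : h = 1
    · exact .of_forall fun y h' => absurd hh h'
    · filter_upwards [show ∀ᵐ y ∂ν, h • y ≠ y from by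
        rw [ae_iff]; simpa using hfree h hh] with y hy _ using hy
  filter_upwards [this] with y hy h h' he
  by_contra hne
  refine hy (h'⁻¹ * h) (fun h1 => hne (inv_mul_eq_one.1 h1).symm) ?_
  rw [mul_smul, he, inv_smul_smul]

/-- The cocycle of a map sending orbits to orbits of a free action. -/
theorem exists_cocycle_of_orbit [Countable H] [MeasurableEq Y] (hG : PmpAction G X μ)
    (hH : PmpAction H Y ν) (hfree : FreeAction H Y ν) {F : X → Y}
    (hF : Measure.QuasiMeasurePreserving F μ ν)
    (h : ∀ g : G, ∀ᵐ x ∂μ, F (g • x) ∈ MulAction.orbit H (F x)) :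
    ∃ c : G → X → H, IsCocycle G X H μ c ∧ ∀ g, ∀ᵐ x ∂μ, F (g • x) = c g x • F x := by
  have h1 : ∀ g : G, ∃ φ : X → H, Cm φ ∧ ∀ᵐ x ∂μ, x ∈ {x | F (g • x) = φ x • F x} := by
    intro g
    refine exists_cm_select (A := fun k => {x | F (g • x) = k • F x}) (fun k =>
      measurableSet_eq_fun (hF.measurable.comp (hG g).measurable)
        ((hH k).measurable.comp hF.measurable)) ?_
    filter_upwards [h g] with x ⟨k, hk⟩ using ⟨k, hk.symm⟩
  choose c hc hc' using h1
  refine ⟨c, ⟨fun g => hc g, fun g g' => ?_⟩, hc'⟩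
  filter_upwards [hc' (g * g'), hc' g', hG.ae (hc' g) g', hF.ae hfree.ae_injective]
    with x h1 h2 h3 h4
  refine h4 _ _ ?_
  rw [← h1, mul_smul, mul_smul, h3, h2]

/-- An ergodic transformation makes almost every orbit hit a set of positive measure. -/
theorem exists_orbit_section [Countable G] [IsProbabilityMeasure μ] (hG : PmpAction G X μ) {g : G}
    (hg : Ergodic (g • · : X → X) μ) {U : Set X} (hU : MeasurableSet U) (h0 : 0 < μ U) :
    ∃ p : X → X, Measurable p ∧ ∀ᵐ x ∂μ, p x ∈ U ∧ p x ∈ MulAction.orbit G x := by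
  have hm : MeasurableSet (⋃ k : G, (k • · : X → X) ⁻¹' U) :=
    .iUnion fun k => (hG k).measurable hU
  have hinv : (g • · : X → X) ⁻¹' (⋃ k : G, (k • · : X → X) ⁻¹' U) =
      ⋃ k : G, (k • · : X → X) ⁻¹' U := by
    ext x
    simp only [Set.mem_preimage, Set.mem_iUnion]
    constructor
    · rintro ⟨k, hk⟩
      exact ⟨k * g, by rwa [mul_smul]⟩
    · rintro ⟨k, hk⟩
      exact ⟨k * g⁻¹, by rwa [mul_smul, inv_smul_smul]⟩
  have h1 : ∀ᵐ x ∂μ, ∃ k : G, x ∈ (k • · : X → X) ⁻¹' U := by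
    rcases hg.toPreErgodic.ae_empty_or_univ hm hinv with h | h
    · refine absurd (measure_mono_null ?_ (ae_eq_empty.1 h)) h0.ne'
      exact fun x hx => Set.mem_iUnion.2 ⟨1, by simpa using hx⟩
    · filter_upwards [Filter.eventuallyEq_univ.1 h] with x hx using Set.mem_iUnion.1 hx
  obtain ⟨φ, hφ, h2⟩ := exists_cm_select (fun k => (hG k).measurable hU) h1
  refine ⟨fun x => φ x • x, hφ.preimage_countable measurable_id fun k => (hG k).measurable, ?_⟩
  filter_upwards [h2] with x hx using ⟨hx, φ x, rfl⟩

end Selection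

section FromSOE

variable {G H X Y : Type} [Group G] [Group H] [MeasurableSpace X] [MulAction G X]
  [MeasurableSpace Y] [MulAction H Y] {μ : Measure X} {ν : Measure Y}

namespace StableOE

variable (f : StableOE G X H Y μ ν)

theorem null_image [IsFiniteMeasure ν] {N : Set X} (hN : μ N = 0) :
    ν (f.V ∩ f.invFun ⁻¹' N) = 0 := by
  have hm := measurableSet_toMeasurable μ N
  refine measure_mono_null (Set.inter_subset_inter_right _
    (Set.preimage_mono (subset_toMeasurable μ N))) ?_
  have h1 := f.pushforward (f.V ∩ f.invFun ⁻¹' toMeasurable μ N) Set.inter_subset_left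
    (f.measV.inter (f.meas_invFun hm))
  have h2 : μ (f.U ∩ f.toFun ⁻¹' (f.V ∩ f.invFun ⁻¹' toMeasurable μ N)) = 0 := by
    refine measure_mono_null ?_ ((measure_toMeasurable N).trans hN)
    rintro x ⟨hx, -, hx'⟩
    rwa [Set.mem_preimage, f.left_inv x hx] at hx'
  rw [h2, mul_zero, eq_comm, mul_eq_zero] at h1
  exact h1.resolve_left (ENNReal.inv_ne_zero.2 (measure_ne_top ν _))

theorem ae_invFun [IsFiniteMeasure ν] {P : X → Prop} (h : ∀ᵐ x ∂μ, P x) :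
    ∀ᵐ y ∂ν, y ∈ f.V → P (f.invFun y) := by
  rw [ae_iff]
  refine measure_mono_null ?_ (f.null_image (ae_iff.1 h))
  intro y hy
  simpa using hy

/-- The inverse stable orbit equivalence. -/
def symm [IsFiniteMeasure ν] : StableOE H Y G X ν μ where
  U := f.V
  V := f.U
  measU := f.measV
  measV := f.measU
  posU := f.posV
  posV := f.posU
  toFun := f.invFun
  invFun := f.toFun
  meas_toFun := f.meas_invFun
  meas_invFun := f.meas_toFun
  maps := f.maps_inv
  maps_inv := f.maps
  left_inv := f.right_inv
  right_inv := f.left_inv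
  pushforward B hBU hB := by
    rw [← f.pushforward _ Set.inter_subset_left (f.measV.inter (f.meas_invFun hB))]
    congr 2
    ext x
    constructor
    · rintro ⟨hx, -, hx'⟩
      rwa [Set.mem_preimage, f.left_inv x hx] at hx'
    · intro hx
      refine ⟨hBU hx, f.maps (hBU hx), ?_⟩
      rwa [Set.mem_preimage, f.left_inv x (hBU hx)]
  orbit_eq := by
    filter_upwards [f.ae_invFun f.orbit_eq] with y h1 hy
    have h2 := h1 hy (f.maps_inv hy)
    rw [f.right_inv y hy] at h2
    rw [← h2, ← Set.image_comp]
    exact (Set.image_congr fun x hx => f.left_inv x hx.2).trans (Set.image_id _)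

theorem ae_toFun [IsFiniteMeasure μ] [IsFiniteMeasure ν] {Q : Y → Prop} (h : ∀ᵐ y ∂ν, Q y) :
    ∀ᵐ x ∂μ, x ∈ f.U → Q (f.toFun x) := f.symm.ae_invFun h

section Section

variable [Countable G] {p : X → X}

theorem quasiMeasurePreserving_section (hG : PmpAction G X μ) (hp : Measurable p)
    (hp' : ∀ᵐ x ∂μ, p x ∈ f.U ∧ p x ∈ MulAction.orbit G x) :
    Measure.QuasiMeasurePreserving p μ μ := by
  refine ⟨hp, Measure.AbsolutelyContinuous.mk fun N hN h0 => ?_⟩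
  rw [Measure.map_apply hp hN]
  have h1 : ∀ᵐ x ∂μ, x ∉ N := measure_eq_zero_iff_ae_notMem.1 h0
  refine measure_eq_zero_iff_ae_notMem.2 ?_
  filter_upwards [hp', ae_all_iff.2 fun g => hG.ae h1 g] with x ⟨_, g, hg⟩ h2 h3
  refine h2 g ?_
  have : g • x = p x := hg
  rwa [this]

theorem quasiMeasurePreserving_comp_section [IsFiniteMeasure μ] [IsFiniteMeasure ν]
    (hG : PmpAction G X μ) (hp : Measurable p)
    (hp' : ∀ᵐ x ∂μ, p x ∈ f.U ∧ p x ∈ MulAction.orbit G x) :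
    Measure.QuasiMeasurePreserving (fun x => f.toFun (p x)) μ ν := by
  refine ⟨f.meas_toFun.comp hp, Measure.AbsolutelyContinuous.mk fun N hN h0 => ?_⟩
  rw [Measure.map_apply (f := fun x => f.toFun (p x)) (f.meas_toFun.comp hp) hN]
  refine measure_eq_zero_iff_ae_notMem.2 ?_
  filter_upwards [hp', (f.quasiMeasurePreserving_section hG hp hp').ae
    (f.ae_toFun (measure_eq_zero_iff_ae_notMem.1 h0))] with x h1 h2
  exact h2 h1.1

theorem ae_orbit_section (hG : PmpAction G X μ) (hp : Measurable p)
    (hp' : ∀ᵐ x ∂μ, p x ∈ f.U ∧ p x ∈ MulAction.orbit G x) :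
    ∀ᵐ x ∂μ, (∀ z ∈ f.U, z ∈ MulAction.orbit G x →
        f.toFun z ∈ MulAction.orbit H (f.toFun (p x))) ∧
      ∀ y ∈ f.V, y ∈ MulAction.orbit H (f.toFun (p x)) → f.invFun y ∈ MulAction.orbit G x := by
  filter_upwards [hp', (f.quasiMeasurePreserving_section hG hp hp').ae f.orbit_eq]
    with x ⟨h1, h2⟩ h3
  have h4 := h3 h1
  rw [MulAction.orbit_eq_iff.2 h2] at h4
  refine ⟨fun z hz hzx => (h4.subset ⟨z, ⟨hzx, hz⟩, rfl⟩).1, fun y hy hyx => ?_⟩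
  obtain ⟨z, ⟨h5, h6⟩, rfl⟩ := h4.superset ⟨hyx, hy⟩
  rwa [f.left_inv z h6]

theorem ae_orbit_smul_section (hG : PmpAction G X μ) (hp : Measurable p)
    (hp' : ∀ᵐ x ∂μ, p x ∈ f.U ∧ p x ∈ MulAction.orbit G x) (g : G) :
    ∀ᵐ x ∂μ, f.toFun (p (g • x)) ∈ MulAction.orbit H (f.toFun (p x)) := by
  filter_upwards [f.ae_orbit_section hG hp hp', hG.ae hp' g] with x h1 ⟨h2, h3⟩
  exact h1.1 _ h2 (by rwa [MulAction.orbit_smul] at h3)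

end Section

/-- A measurable translation comparing `E ∘ F` with the identity. -/
theorem exists_translation [Countable G] [Countable H] [MeasurableEq X] [IsFiniteMeasure μ]
    [IsFiniteMeasure ν] (hG : PmpAction G X μ) {p : X → X} (hp : Measurable p)
    (hp' : ∀ᵐ x ∂μ, p x ∈ f.U ∧ p x ∈ MulAction.orbit G x) {q : Y → Y} (hq : Measurable q)
    (hq' : ∀ᵐ y ∂ν, q y ∈ f.V ∧ q y ∈ MulAction.orbit H y) :
    ∃ η : X → G, Cm η ∧ ∀ᵐ x ∂μ, f.invFun (q (f.toFun (p x))) = η x • x := by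
  have hm : Measurable fun x => f.invFun (q (f.toFun (p x))) :=
    f.meas_invFun.comp (hq.comp (f.meas_toFun.comp hp))
  refine exists_cm_select (A := fun k : G => {x | f.invFun (q (f.toFun (p x))) = k • x})
    (fun k => measurableSet_eq_fun hm (hG k).measurable) ?_
  filter_upwards [f.ae_orbit_section hG hp hp',
    (f.quasiMeasurePreserving_comp_section hG hp hp').ae hq'] with x h1 ⟨h2, h3⟩
  obtain ⟨k, hk⟩ := h1.2 _ h2 h3
  exact ⟨k, hk.symm⟩

/-- The coupling of a stable orbit equivalence. -/
theorem exists_cpl [Countable G] [Countable H] [MeasurableEq X] [MeasurableEq Y]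
    [IsProbabilityMeasure μ] [IsProbabilityMeasure ν] (hG : PmpAction G X μ)
    (hH : PmpAction H Y ν) (hGf : FreeAction G X μ) (hHf : FreeAction H Y ν) {h₀ : H}
    (h₀e : Ergodic (h₀ • · : Y → Y) ν) {c : G → X → H} (hc : IsCocycle G X H μ c) {p : X → X}
    (hp : Measurable p) (hp' : ∀ᵐ x ∂μ, p x ∈ f.U ∧ p x ∈ MulAction.orbit G x)
    (hcp : ∀ g : G, ∀ᵐ x ∂μ, f.toFun (p (g • x)) = c g x • f.toFun (p x)) :
    ∃ C : Cpl G H μ ν, C.c = c ∧ C.F = fun x => f.toFun (p x) := by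
  obtain ⟨q, hq, hq'⟩ := exists_orbit_section hH h₀e f.measV f.posV
  have hF := f.quasiMeasurePreserving_comp_section hG hp hp'
  have hE : Measure.QuasiMeasurePreserving (fun y => f.invFun (q y)) ν μ :=
    f.symm.quasiMeasurePreserving_comp_section hH hq hq'
  obtain ⟨d, hd, hdq⟩ := exists_cocycle_of_orbit (F := fun y => f.invFun (q y)) hH hG hGf hE
    (f.symm.ae_orbit_smul_section hH hq hq')
  obtain ⟨η, hη, hη'⟩ := f.exists_translation hG hp hp' hq hq'
  obtain ⟨θ, hθ, hθ'⟩ : ∃ θ : Y → H, Cm θ ∧ ∀ᵐ y ∂ν, f.toFun (p (f.invFun (q y))) = θ y • y :=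
    f.symm.exists_translation hH hq hq' hp hp'
  refine ⟨{ c := c, d := d, F := _, E := _, η := η, θ := θ, hG := hG, hH := hH, hc := hc, hd := hd,
            hF := hF, hE := hE, hη := hη, hθ := hθ, F_eq := hcp, E_eq := hdq, EF := hη', FE := hθ',
            η_eq := fun g => ?_, θ_eq := fun h => ?_ }, rfl, rfl⟩
  · filter_upwards [hη', hG.ae hη' g, hcp g, hF.ae (ae_all_iff.2 hdq), hGf.ae_injective]
      with x h1 h2 h3 h4 h5
    refine h5 _ _ ?_
    rw [mul_smul, mul_smul, ← h1, ← h2, h3, h4]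
  · filter_upwards [hθ', hH.ae hθ' h, hdq h, hE.ae (ae_all_iff.2 hcp), hHf.ae_injective]
      with x h1 h2 h3 h4 h5
    refine h5 _ _ ?_
    rw [mul_smul, mul_smul, ← h1, ← h2, h3, h4]

/-- A stable orbit equivalence that is locally a translate of a measure isomorphism sending
orbits into orbits has compression constant one. -/
theorem kappa_eq_one [Countable G] [Countable H] [MeasurableEq Y] [IsProbabilityMeasure μ]
    [IsProbabilityMeasure ν] (hH : PmpAction H Y ν) {F : X → Y} (hF : MeasIso μ ν F)
    (hfF : ∀ᵐ x ∂μ, x ∈ f.U → f.toFun x ∈ MulAction.orbit H (F x)) : f.kappa = 1 := by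
  obtain ⟨hFm, hFp, F', -, hF', -⟩ := hF
  obtain ⟨l, hl, hl'⟩ := exists_cm_select (μ := μ)
    (A := fun h : H => {x | x ∈ f.U → f.toFun x = h • F x})
    (fun h => by
      have : {x | x ∈ f.U → f.toFun x = h • F x} = f.Uᶜ ∪ {x | f.toFun x = h • F x} := by
        ext x; simp [imp_iff_not_or]
      rw [this]
      exact f.measU.compl.union (measurableSet_eq_fun f.meas_toFun ((hH h).measurable.comp hFm)))
    (by
      filter_upwards [hfF] with x hx
      by_cases hxU : x ∈ f.U
      · obtain ⟨h, hh⟩ := hx hxU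
        exact ⟨h, fun _ => hh.symm⟩
      · exact ⟨1, fun h => absurd h hxU⟩)
  obtain ⟨h, hh⟩ : ∃ h, μ (f.U ∩ {x | l x = h}) ≠ 0 := by
    by_contra! h0
    refine f.posU.ne' (measure_mono_null ?_ (measure_iUnion_null h0))
    exact fun x hx => Set.mem_iUnion.2 ⟨l x, hx, rfl⟩
  have hBm : MeasurableSet (f.V ∩ f.invFun ⁻¹' {x | l x = h}) :=
    f.measV.inter (f.meas_invFun (hl h))
  have h1 := f.pushforward _ Set.inter_subset_left hBm
  have h2 : f.U ∩ f.toFun ⁻¹' (f.V ∩ f.invFun ⁻¹' {x | l x = h}) = f.U ∩ {x | l x = h} := by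
    ext x
    refine and_congr_right fun hx => ?_
    simp [f.maps hx, f.left_inv x hx]
  have h3 : MeasurePreserving (fun x => h • F x) μ ν := (hH h).comp hFp
  have h4 : ν (f.V ∩ f.invFun ⁻¹' {x | l x = h}) = μ (f.U ∩ {x | l x = h}) := by
    rw [← h3.measure_preimage hBm.nullMeasurableSet]
    refine measure_congr ?_
    filter_upwards [hl', hF', h3.quasiMeasurePreserving.ae (f.ae_invFun (hl'.and hF'))]
      with x h5 h6 h7
    refine propext ⟨fun ⟨h8, h9⟩ => ?_, fun ⟨h8, h9⟩ => ?_⟩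
    · have h8' : h • F x ∈ f.V := h8
      have h9' : l (f.invFun (h • F x)) = h := h9
      obtain ⟨h10, h11⟩ := h7 h8'
      have h12 := h10 (f.maps_inv h8')
      rw [f.right_inv _ h8', h9', smul_left_cancel_iff] at h12
      rw [← h12, h6] at h11
      have h13 : x ∈ f.U := h11 ▸ f.maps_inv h8'
      exact ⟨h13, by rw [← h11] at h9'; exact h9'⟩
    · have h9' : l x = h := h9
      have h10 : f.toFun x = h • F x := h9' ▸ h5 h8
      show h • F x ∈ f.V ∧ l (f.invFun (h • F x)) = h
      rw [← h10, f.left_inv x h8]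
      exact ⟨f.maps h8, h9'⟩
  rw [h2, h4] at h1
  have h5 := (ENNReal.mul_left_inj hh (measure_ne_top μ _)).1 h1
  rw [kappa, inv_injective h5]
  exact ENNReal.div_self f.posV.ne' (measure_ne_top ν _)

end StableOE

end FromSOE

section Transport

variable {G H X Y : Type} [Group G] [Group H] [MeasurableSpace X] [MulAction G X]
  [MeasurableSpace Y] [MulAction H Y] {μ : Measure X} {ν : Measure Y}

/-- Transport of a coupling along group isomorphisms. -/
def Cpl.transport [Countable G] [Countable H] (C : Cpl G H μ ν) {G' H' : Type} [Group G']
    [Group H'] (e : G' ≃* G) (e' : H' ≃* H) :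
    letI := MulAction.compHom X e.toMonoidHom
    letI := MulAction.compHom Y e'.toMonoidHom
    Cpl G' H' μ ν :=
  letI := MulAction.compHom X e.toMonoidHom
  letI := MulAction.compHom Y e'.toMonoidHom
  { c := fun g x => e'.symm (C.c (e g) x)
    d := fun h y => e.symm (C.d (e' h) y)
    F := C.F
    E := C.E
    η := fun x => e.symm (C.η x)
    θ := fun y => e'.symm (C.θ y)
    hG := fun g => C.hG (e g)
    hH := fun h => C.hH (e' h)
    hc := ⟨fun g => (C.hc.cm (e g)).comp e'.symm, fun g g' => by
      filter_upwards [C.hc.2 (e g) (e g')] with x hx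
      rw [map_mul, hx, map_mul]
      rfl⟩
    hd := ⟨fun h => (C.hd.cm (e' h)).comp e.symm, fun h h' => by
      filter_upwards [C.hd.2 (e' h) (e' h')] with y hy
      rw [map_mul, hy, map_mul]
      rfl⟩
    hF := C.hF
    hE := C.hE
    hη := C.hη.comp e.symm
    hθ := C.hθ.comp e'.symm
    F_eq := fun g => by
      filter_upwards [C.F_eq (e g)] with x hx
      refine hx.trans ?_
      show _ = e' (e'.symm (C.c (e g) x)) • C.F x
      rw [MulEquiv.apply_symm_apply]
    E_eq := fun h => by
      filter_upwards [C.E_eq (e' h)] with y hy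
      refine hy.trans ?_
      show _ = e (e.symm (C.d (e' h) y)) • C.E y
      rw [MulEquiv.apply_symm_apply]
    EF := by
      filter_upwards [C.EF] with x hx
      refine hx.trans ?_
      show _ = e (e.symm (C.η x)) • x
      rw [MulEquiv.apply_symm_apply]
    FE := by
      filter_upwards [C.FE] with y hy
      refine hy.trans ?_
      show _ = e' (e'.symm (C.θ y)) • y
      rw [MulEquiv.apply_symm_apply]
    η_eq := fun g => by
      filter_upwards [C.η_eq (e g)] with x hx
      rw [MulEquiv.apply_symm_apply, ← map_mul, hx, map_mul, MulEquiv.symm_apply_apply]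
      rfl
    θ_eq := fun h => by
      filter_upwards [C.θ_eq (e' h)] with y hy
      rw [MulEquiv.apply_symm_apply, ← map_mul, hy, map_mul, MulEquiv.symm_apply_apply]
      rfl }

end Transport

section Main

variable {V W X Y : Type} [Finite V] [Finite W] {Γ : SimpleGraph V} {Λ : SimpleGraph W}
  [MeasurableSpace X] [MeasurableSpace Y] [MulAction (RAAG Γ) X] [MulAction (RAAG Λ) Y]
  {μ : Measure X} {ν : Measure Y} [IsProbabilityMeasure μ] [IsProbabilityMeasure ν]

theorem Cpl.rigid_of_irreducible [MeasurableEq Y] [Nontrivial V] [Nontrivial W]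
    (C : Cpl (RAAG Γ) (RAAG Λ) μ ν) (hΓ : Γ.Connected) (hΛ : Λ.Connected)
    (hX : IrreducibleAction (RAAG Γ) X μ) (hY : IrreducibleAction (RAAG Λ) Y ν) {S : Set V}
    (hS : IsMaxJoin Γ S) (hcone : NoCone Γ S) :
    ∃ (α : RAAG Γ ≃* RAAG Λ) (φ : X → RAAG Λ), Cm φ ∧
      (∀ g, ∀ᵐ x ∂μ, OEPaper.gauge φ C.c g x = α g) ∧ MeasIso μ ν (fun x => φ x • C.F x) := by
  obtain ⟨n, Δ, e, he⟩ := hX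
  obtain ⟨n', Δ', e', he'⟩ := hY
  obtain ⟨T, hT, hT'⟩ := exists_noCone_of_equiv e.symm hS hcone
  let _ := MulAction.compHom X e.toMonoidHom
  let _ := MulAction.compHom Y e'.toMonoidHom
  obtain ⟨α, φ, hφ, hα, hF⟩ := (C.transport e e').rigid he he' (preconnected_transfer hΓ e.symm)
    (preconnected_transfer hΛ e'.symm) hT hT'
  refine ⟨(e.symm.trans α).trans e', fun x => e' (φ x), hφ.comp e', fun g => ?_, hF⟩
  filter_upwards [hα (e.symm g)] with x hx
  rw [MulEquiv.trans_apply, MulEquiv.trans_apply, ← hx]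
  show e' (φ (g • x)) * C.c g x * (e' (φ x))⁻¹ =
    e' (φ (e (e.symm g) • x) * e'.symm (C.c (e (e.symm g)) x) * (φ x)⁻¹)
  simp

theorem StableOE.rigid [MeasurableEq X] [MeasurableEq Y] [Nontrivial V] [Nontrivial W]
    (f : StableOE (RAAG Γ) X (RAAG Λ) Y μ ν) (hΓ : Γ.Connected) (hΛ : Λ.Connected)
    (hG : PmpAction (RAAG Γ) X μ) (hH : PmpAction (RAAG Λ) Y ν)
    (hGf : FreeAction (RAAG Γ) X μ) (hHf : FreeAction (RAAG Λ) Y ν)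
    (hX : IrreducibleAction (RAAG Γ) X μ) (hY : IrreducibleAction (RAAG Λ) Y ν)
    {h₀ : RAAG Λ} (h₀e : Ergodic (h₀ • · : Y → Y) ν) {S : Set V}
    (hS : IsMaxJoin Γ S) (hcone : NoCone Γ S) {c : RAAG Γ → X → RAAG Λ}
    (hc : IsCocycle (RAAG Γ) X (RAAG Λ) μ c) {p : X → X}
    (hp : Measurable p) (hp' : ∀ᵐ x ∂μ, p x ∈ f.U ∧ p x ∈ MulAction.orbit (RAAG Γ) x)
    (hcp : ∀ g : RAAG Γ, ∀ᵐ x ∂μ, f.toFun (p (g • x)) = c g x • f.toFun (p x)) :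
    ∃ (α : RAAG Γ ≃* RAAG Λ) (φ : X → RAAG Λ), Cm φ ∧
      (∀ g, ∀ᵐ x ∂μ, gauge φ c g x = α g) ∧ MeasIso μ ν (fun x => φ x • f.toFun (p x)) := by
  obtain ⟨C, rfl, hCF⟩ := f.exists_cpl hG hH hGf hHf h₀e hc hp hp' hcp
  obtain ⟨α, φ, hφ, hα, hF⟩ := C.rigid_of_irreducible hΓ hΛ hX hY hS hcone
  rw [hCF] at hF
  exact ⟨α, φ, hφ, hα, hF⟩

/-- Irreducible actions have an ergodic group element. -/
theorem IrreducibleAction.exists_ergodic [Nontrivial V] (hX : IrreducibleAction (RAAG Γ) X μ) :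
    ∃ g : RAAG Γ, Ergodic (g • · : X → X) μ := by
  obtain ⟨n, Δ, e, he⟩ := hX
  rcases isEmpty_or_nonempty (Fin n) with h | ⟨⟨v⟩⟩
  · obtain ⟨v⟩ : Nonempty V := inferInstance
    have h1 : (⊤ : Subgroup (RAAG Δ)) = ⊥ := by
      rw [← standardSub_univ, ← standardSub_empty, Set.univ_eq_empty_iff.2 h]
    have h2 : e.symm (gen Γ v) = 1 := by
      rw [← Subgroup.mem_bot, ← h1]; trivial
    have h3 : gen Γ v = 1 := by simpa using h2
    exact absurd (by rw [pow_one]; exact h3) (gen_pow_ne_one (Γ := Γ) (v := v) one_pos)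
  · exact ⟨_, he v⟩

end Main

/-- Rigidity of stable orbit equivalences when some maximal join parabolic
subgroup of `G` has trivial center. -/
theorem stmt1
    {V W : Type} [Fintype V] [Fintype W]
    (Γ : SimpleGraph V) (Λ : SimpleGraph W)
    (hΓconn : Γ.Connected) (hΓcard : 2 ≤ Fintype.card V)
    (hΛconn : Λ.Connected) (hΛcard : 2 ≤ Fintype.card W)
    (hmax : ∃ P : Subgroup (RAAG Γ), IsMaxJoinParabolic Γ P ∧ ∀ x ∈ subCenter P, x = 1)
    (X Y : Type) [MeasurableSpace X] [MeasurableSpace Y]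
    [StandardBorelSpace X] [StandardBorelSpace Y]
    (μ : Measure X) (ν : Measure Y) [IsProbabilityMeasure μ] [IsProbabilityMeasure ν]
    [MulAction (RAAG Γ) X] [MulAction (RAAG Λ) Y]
    (hXpmp : PmpAction (RAAG Γ) X μ) (hXfree : FreeAction (RAAG Γ) X μ)
    (hXirr : IrreducibleAction (RAAG Γ) X μ)
    (hYpmp : PmpAction (RAAG Λ) Y ν) (hYfree : FreeAction (RAAG Λ) Y ν)
    (hYirr : IrreducibleAction (RAAG Λ) Y ν)
    (f : StableOE (RAAG Γ) X (RAAG Λ) Y μ ν) :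
    f.kappa = 1 ∧
    (∀ c : RAAG Γ → X → RAAG Λ, f.IsSOECocycle c →
      ∃ α : RAAG Γ ≃* RAAG Λ, Cohomologous (RAAG Γ) X (RAAG Λ) μ c fun g _ => α g) ∧
    ∃ α : RAAG Γ ≃* RAAG Λ, ConjugateVia (RAAG Γ) X (RAAG Λ) Y μ ν α := by
  have : Nontrivial V := Fintype.one_lt_card_iff_nontrivial.1 hΓcard
  have : Nontrivial W := Fintype.one_lt_card_iff_nontrivial.1 hΛcard
  obtain ⟨_, ⟨g, S, hS, rfl⟩, hcenter⟩ := hmax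
  have hcone := noCone_of_subCenter hcenter
  obtain ⟨g₀, hg₀⟩ := hXirr.exists_ergodic
  obtain ⟨h₀, hh₀⟩ := hYirr.exists_ergodic
  obtain ⟨p, hp, hp'⟩ := exists_orbit_section hXpmp hg₀ f.measU f.posU
  obtain ⟨c, hc, hcp⟩ := exists_cocycle_of_orbit (F := fun x => f.toFun (p x)) hXpmp hYpmp hYfree
    (f.quasiMeasurePreserving_comp_section hXpmp hp hp') (f.ae_orbit_smul_section hXpmp hp hp')
  obtain ⟨α, φ, -, hα, hF⟩ := f.rigid hΓconn hΛconn hXpmp hYpmp hXfree hYfree hXirr hYirr hh₀ hS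
    hcone hc hp hp' hcp
  refine ⟨f.kappa_eq_one hYpmp hF ?_, fun c ⟨hc, p, hp, hp', hcp⟩ => ?_, α, _, hF, fun g => ?_⟩
  · filter_upwards [f.ae_orbit_section hXpmp hp hp'] with x hx hxU
    rw [MulAction.orbit_smul]
    exact hx.1 x hxU (MulAction.mem_orbit_self x)
  · obtain ⟨α, φ, hφ, hα, -⟩ := f.rigid hΓconn hΛconn hXpmp hYpmp hXfree hYfree hXirr hYirr hh₀ hS
      hcone hc hp hp' hcp
    refine ⟨α, φ, hφ, fun g => ?_⟩
    filter_upwards [hα g] with x hx using hx.symm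
  · filter_upwards [hα g, hcp g] with x h1 h2
    rw [← h1, h2]
    simp only [gauge, mul_smul, inv_smul_smul]

end OEPaper
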